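/- Existence of conformal harmonic coordinates in the interior (Theorem 2.2, parts (1) and (3), coordinate version): Let n ≥ 3, k ∈ ℕ with k ≥ 2, and α ∈ (0,1). Let g be a metric of class C^{k+α} on an open neighborhood Ω of 0 in ℝⁿ. Then there exist an open neighborhood V ⊆ Ω of 0 and functions f¹, …, fⁿ, f of class C^{k+α} on V with f > 0 on V and L_g f¹ = ⋯ = L_g fⁿ = L_g f = 0 on V, such that the map Z := (f¹/f, …, fⁿ/f) : V → ℝⁿ is a diffeomorphism of class C^{k+1+α} onto an open subset of ℝⁿ with Z(0) = 0. Moreover, the functions f¹, …, fⁿ, f can be chosen so that in addition DZ(0)ᵀ DZ(0) = g(0), i.e. the coordinate representation of g in the coordinates Z equals the identity matrix at the point 0. -/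

import Mathlib

noncomputable section

open Set Matrix Matrix

/-- Points of `ℝⁿ`. -/
abbrev Pt (n : ℕ) := Fin n → ℝ

/-- A metric in coordinates: a matrix-valued map. -/
abbrev Met (n : ℕ) := Pt n → Matrix (Fin n) (Fin n) ℝ

/-- Partial derivative of `f` in the `a`-th coordinate direction. -/
def pd {n : ℕ} (a : Fin n) (f : Pt n → ℝ) (x : Pt n) : ℝ :=
  fderiv ℝ f x (Pi.single a 1)

/-- `g` is a metric (pointwise symmetric positive definite) on `U`. -/
def IsMetricOn {n : ℕ} (g : Met n) (U : Set (Pt n)) : Prop :=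
  ∀ x ∈ U, (g x).IsSymm ∧ (g x).PosDef

/-- Christoffel symbols `Γ^c_{ab}` of `g`. -/
def christoffel {n : ℕ} (g : Met n) (c a b : Fin n) (x : Pt n) : ℝ :=
  (1 / 2) * ∑ d, (g x)⁻¹ c d *
    (pd a (fun y => g y b d) x + pd b (fun y => g y a d) x - pd d (fun y => g y a b) x)

/-- Ricci tensor `R_{ab}` of `g`. -/
def ricci {n : ℕ} (g : Met n) (a b : Fin n) (x : Pt n) : ℝ :=
  (∑ c, pd c (christoffel g c a b) x) - (∑ c, pd a (christoffel g c c b) x)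
    + (∑ c, ∑ d, christoffel g c a b x * christoffel g d d c x)
    - (∑ c, ∑ d, christoffel g d c b x * christoffel g c a d x)

/-- Scalar curvature `R(g)`. -/
def scalarCurv {n : ℕ} (g : Met n) (x : Pt n) : ℝ :=
  ∑ a, ∑ b, (g x)⁻¹ a b * ricci g a b x

/-- Laplace–Beltrami operator `Δ_g`. -/
def laplaceBeltrami {n : ℕ} (g : Met n) (u : Pt n → ℝ) (x : Pt n) : ℝ :=
  -(Real.sqrt (g x).det)⁻¹ *
    ∑ a, pd a (fun y => Real.sqrt (g y).det * ∑ b, (g y)⁻¹ a b * pd b u y) x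

/-- Conformal Laplacian `L_g`. -/
def confLap {n : ℕ} (g : Met n) (u : Pt n → ℝ) (x : Pt n) : ℝ :=
  laplaceBeltrami g u x + (((n : ℝ) - 2) / (4 * ((n : ℝ) - 1))) * scalarCurv g x * u x

/-- `f` is of class `C^{k+α}` on `s`: it is `C^k` there and its `k`-th order derivatives are
locally `α`-Hölder continuous. -/
def CHolderOn {n : ℕ} (k : ℕ) (α : ℝ) (s : Set (Pt n)) (f : Pt n → ℝ) : Prop :=
  ContDiffOn ℝ k f s ∧
    ∀ x ∈ s, ∃ C : NNReal, ∃ t ∈ nhdsWithin x s,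
      HolderOnWith C (Real.toNNReal α) (iteratedFDerivWithin ℝ k f s) t

/-- All entries of `g` are of class `C^{k+α}` on `s`. -/
def MetCHolderOn {n : ℕ} (k : ℕ) (α : ℝ) (s : Set (Pt n)) (g : Met n) : Prop :=
  ∀ a b, CHolderOn k α s fun x => g x a b

/-- Contracted Christoffel symbol `Γ^a = g^{bc} Γ^a_{bc}`. -/
def gammaUp {n : ℕ} (g : Met n) (a : Fin n) (x : Pt n) : ℝ :=
  ∑ b, ∑ c, (g x)⁻¹ b c * christoffel g a b c x

/-- Contracted Christoffel symbol `Γ_a = g_{ab} Γ^b`. -/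
def gammaLow {n : ℕ} (g : Met n) (a : Fin n) (x : Pt n) : ℝ :=
  ∑ b, g x a b * gammaUp g b x

/-- `g` satisfies the conformal harmonic gauge on `U`. -/
def ConfHarmonicGauge {n : ℕ} (g : Met n) (U : Set (Pt n)) : Prop :=
  ∃ f : Pt n → ℝ, ContDiffOn ℝ 2 f U ∧ (∀ x ∈ U, 0 < f x) ∧
    (∀ x ∈ U, confLap g f x = 0) ∧
    ∀ a : Fin n, ∀ x ∈ U, gammaLow g a x = 2 * pd a (fun y => Real.log (f y)) x

/-- Determinant-normalized metric `ĝ = (det g)^{-1/n} g`. -/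
def dnorm {n : ℕ} (g : Met n) : Met n :=
  fun x => ((g x).det ^ (-(1 : ℝ) / (n : ℝ))) • g x

/-- Jacobian matrix of a map `Z : ℝⁿ → ℝⁿ`. -/
def jac {n : ℕ} (Z : Pt n → Pt n) (x : Pt n) : Matrix (Fin n) (Fin n) ℝ :=
  Matrix.of fun i j => pd j (fun y => Z y i) x

/-- Riemann curvature tensor `R_{abc}{}^{d}`. -/
def riemannUp {n : ℕ} (g : Met n) (a b c d : Fin n) (x : Pt n) : ℝ :=
  pd a (christoffel g d b c) x - pd b (christoffel g d a c) x
    + (∑ e, christoffel g e b c x * christoffel g d a e x)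
    - (∑ e, christoffel g e a c x * christoffel g d b e x)

/-- Riemann curvature tensor `R_{abcd} = R_{abc}{}^{e} g_{ed}`. -/
def riemannLow {n : ℕ} (g : Met n) (a b c d : Fin n) (x : Pt n) : ℝ :=
  ∑ e, riemannUp g a b c e x * g x e d

/-- Schouten tensor `P_{ab}`. -/
def schouten {n : ℕ} (g : Met n) (a b : Fin n) (x : Pt n) : ℝ :=
  (1 / ((n : ℝ) - 2)) * (ricci g a b x - (scalarCurv g x / (2 * ((n : ℝ) - 1))) * g x a b)

/-- Weyl tensor `W_{abcd}`. -/
def weyl {n : ℕ} (g : Met n) (a b c d : Fin n) (x : Pt n) : ℝ :=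
  riemannLow g a b c d x + schouten g a c x * g x b d - schouten g b c x * g x a d
    + schouten g b d x * g x a c - schouten g a d x * g x b c

/-- Weyl tensor with raised last index, `W_{abc}{}^{d} = g^{de} W_{abce}`. -/
def weylUp {n : ℕ} (g : Met n) (a b c d : Fin n) (x : Pt n) : ℝ :=
  ∑ e, (g x)⁻¹ d e * weyl g a b c e x

/-- Covariant derivative of a 2-tensor: `(∇T)_{cab} = ∇_c T_{ab}`. -/
def cov2 {n : ℕ} (g : Met n) (T : Fin n → Fin n → Pt n → ℝ) (c a b : Fin n) (x : Pt n) : ℝ :=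
  pd c (T a b) x - (∑ d, christoffel g d c a x * T d b x)
    - ∑ d, christoffel g d c b x * T a d x

/-- Covariant derivative of a 3-tensor: `(∇T)_{dabc} = ∇_d T_{abc}`. -/
def cov3 {n : ℕ} (g : Met n) (T : Fin n → Fin n → Fin n → Pt n → ℝ) (d a b c : Fin n)
    (x : Pt n) : ℝ :=
  pd d (T a b c) x - (∑ e, christoffel g e d a x * T e b c x)
    - (∑ e, christoffel g e d b x * T a e c x)
    - ∑ e, christoffel g e d c x * T a b e x

/-- Cotton tensor `C_{abc} = ∇_a P_{bc} - ∇_b P_{ac}`. -/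
def cotton {n : ℕ} (g : Met n) (a b c : Fin n) (x : Pt n) : ℝ :=
  cov2 g (schouten g) a b c x - cov2 g (schouten g) b a c x

/-- Bach tensor `B_{ab}`. -/
def bach {n : ℕ} (g : Met n) (a b : Fin n) (x : Pt n) : ℝ :=
  (∑ c, ∑ d, (g x)⁻¹ c d *
      (cov3 g (cov2 g (schouten g)) d a b c x - cov3 g (cov2 g (schouten g)) d c a b x))
    + ∑ c, ∑ d, ∑ e, ∑ f, (g x)⁻¹ c e * (g x)⁻¹ d f * schouten g e f x * weyl g a c d b x

namespace ConfHarm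

open scoped ContDiff Topology
open MeasureTheory

section PartialDerivatives

variable {n : ℕ}

lemma fderiv_apply_eq_sum_pd (f : Pt n → ℝ) (x v : Pt n) :
    fderiv ℝ f x v = ∑ i, v i * pd i f x := by
  conv_lhs => rw [pi_eq_sum_univ' v]
  simp [pd, map_sum, ← smul_eq_mul]

lemma norm_fderiv_le_of_pd {f : Pt n → ℝ} {x : Pt n} {M : ℝ} (hM : 0 ≤ M)
    (h : ∀ i, |pd i f x| ≤ M) : ‖fderiv ℝ f x‖ ≤ n * M := by
  refine ContinuousLinearMap.opNorm_le_bound _ (by positivity) fun v => ?_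
  rw [fderiv_apply_eq_sum_pd, Real.norm_eq_abs]
  calc |∑ i, v i * pd i f x| ≤ ∑ i, |v i * pd i f x| := Finset.abs_sum_le_sum_abs _ _
    _ ≤ ∑ _i : Fin n, ‖v‖ * M := by
        refine Finset.sum_le_sum fun i _ => ?_
        rw [abs_mul]
        exact mul_le_mul (norm_le_pi_norm v i) (h i) (abs_nonneg _) (norm_nonneg _)
    _ = n * M * ‖v‖ := by simp; ring

lemma pd_congr {f g : Pt n → ℝ} {x : Pt n} (h : f =ᶠ[𝓝 x] g) (i : Fin n) :
    pd i f x = pd i g x := by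
  rw [pd, pd, h.fderiv_eq]

lemma pd_congr_on {U : Set (Pt n)} (hU : IsOpen U) {f g : Pt n → ℝ} (h : EqOn f g U)
    (i : Fin n) : EqOn (pd i f) (pd i g) U := fun _ hx =>
  pd_congr (Filter.mem_of_superset (hU.mem_nhds hx) h) i

@[simp] lemma pd_const (i : Fin n) (c : ℝ) (x : Pt n) : pd i (fun _ => c) x = 0 := by
  simp [pd]

lemma pd_add {f g : Pt n → ℝ} {x : Pt n} (hf : DifferentiableAt ℝ f x)
    (hg : DifferentiableAt ℝ g x) (i : Fin n) :
    pd i (fun y => f y + g y) x = pd i f x + pd i g x := by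
  simp only [pd]
  rw [fderiv_fun_add hf hg]; rfl

lemma pd_sub {f g : Pt n → ℝ} {x : Pt n} (hf : DifferentiableAt ℝ f x)
    (hg : DifferentiableAt ℝ g x) (i : Fin n) :
    pd i (fun y => f y - g y) x = pd i f x - pd i g x := by
  simp only [pd]
  rw [fderiv_fun_sub hf hg]; rfl

lemma pd_const_mul (c : ℝ) (f : Pt n → ℝ) (x : Pt n) (i : Fin n) :
    pd i (fun y => c * f y) x = c * pd i f x := by
  have : (fun y => c * f y) = c • f := rfl
  rw [this, pd, fderiv_const_smul_field]
  rfl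

lemma pd_mul {f g : Pt n → ℝ} {x : Pt n} (hf : DifferentiableAt ℝ f x)
    (hg : DifferentiableAt ℝ g x) (i : Fin n) :
    pd i (fun y => f y * g y) x = pd i f x * g x + f x * pd i g x := by
  simp only [pd]
  rw [fderiv_fun_mul hf hg]
  simp; ring

lemma pd_sum {ι : Type*} {s : Finset ι} {f : ι → Pt n → ℝ} {x : Pt n}
    (hf : ∀ j ∈ s, DifferentiableAt ℝ (f j) x) (i : Fin n) :
    pd i (fun y => ∑ j ∈ s, f j y) x = ∑ j ∈ s, pd i (f j) x := by
  simp only [pd]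
  rw [fderiv_fun_sum hf]
  simp

lemma pd_coord (i j : Fin n) (x : Pt n) :
    pd i (fun y : Pt n => y j) x = if i = j then 1 else 0 := by
  have : (fun y : Pt n => y j) = ContinuousLinearMap.proj (R := ℝ) (φ := fun _ : Fin n => ℝ) j := rfl
  rw [pd, this, ContinuousLinearMap.fderiv]
  simp [Pi.single_apply, eq_comm]

lemma pd_comp_smul (r : ℝ) (f : Pt n → ℝ) (x : Pt n) (i : Fin n) :
    pd i (fun y => f (r • y)) x = r * pd i f (r • x) := by
  rw [pd, fderiv_comp_smul]
  rfl

lemma pd_comp {φ : ℝ → ℝ} {f : Pt n → ℝ} {x : Pt n} (hφ : DifferentiableAt ℝ φ (f x))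
    (hf : DifferentiableAt ℝ f x) (i : Fin n) :
    pd i (fun y => φ (f y)) x = deriv φ (f x) * pd i f x := by
  have := (hφ.hasDerivAt.comp_hasFDerivAt x hf.hasFDerivAt).fderiv
  simp only [pd]
  rw [show (fun y => φ (f y)) = φ ∘ f from rfl, this]
  simp

lemma hasFDerivAt_pd_sum {f : Pt n → ℝ} {x : Pt n} (hf : DifferentiableAt ℝ f x) :
    HasFDerivAt f (∑ i, pd i f x • ContinuousLinearMap.proj (R := ℝ) (φ := fun _ : Fin n => ℝ) i)
      x := by
  have : ∑ i, pd i f x • ContinuousLinearMap.proj (R := ℝ) (φ := fun _ : Fin n => ℝ) i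
      = fderiv ℝ f x := by
    refine ContinuousLinearMap.ext fun v => ?_
    simp [fderiv_apply_eq_sum_pd, mul_comm]
  rw [this]
  exact hf.hasFDerivAt

lemma contDiff_succ_iff_pd {m : ℕ} {f : Pt n → ℝ} :
    ContDiff ℝ (m + 1 : ℕ) f ↔ Differentiable ℝ f ∧ ∀ i, ContDiff ℝ m (pd i f) := by
  have key : ContDiff ℝ (m + 1 : ℕ) f ↔ Differentiable ℝ f ∧ ContDiff ℝ m (fderiv ℝ f) := by
    push_cast
    rw [contDiff_succ_iff_fderiv]
    simp
  rw [key, contDiff_clm_apply_iff]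
  refine and_congr_right fun _ => ⟨fun h i => h _, fun h v => ?_⟩
  simp only [fderiv_apply_eq_sum_pd]
  exact ContDiff.sum fun i _ => contDiff_const.mul (h i)

lemma _root_.ContDiff.pd_infty {f : Pt n → ℝ} (hf : ContDiff ℝ ∞ f) (i : Fin n) :
    ContDiff ℝ ∞ (pd i f) :=
  (hf.fderiv_right (m := ∞) le_rfl).clm_apply contDiff_const

lemma hasCompactSupport_pd {f : Pt n → ℝ} (hf : HasCompactSupport f) (i : Fin n) :
    HasCompactSupport (pd i f) :=
  hf.fderiv_apply ℝ _

end PartialDerivatives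

section HolderBounds

variable {n : ℕ} {α : ℝ}

/-- `HBound α m M f`: all partial derivatives of `f` of order at most `m` are bounded by `M`, and
those of order `m` are `α`-Hölder continuous with constant `M`, on all of `ℝⁿ`. -/
def HBound (α : ℝ) : ℕ → ℝ → (Pt n → ℝ) → Prop
  | 0, M, f => (∀ x, |f x| ≤ M) ∧ ∀ x y, |f x - f y| ≤ M * dist x y ^ α
  | m + 1, M, f => (Differentiable ℝ f ∧ ∀ x, |f x| ≤ M) ∧ ∀ i, HBound α m M (pd i f)

namespace HBound

lemma bound {m : ℕ} {M : ℝ} {f : Pt n → ℝ} (h : HBound α m M f) (x : Pt n) : |f x| ≤ M := by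
  cases m with
  | zero => exact h.1 x
  | succ m => exact h.1.2 x

lemma nonneg {m : ℕ} {M : ℝ} {f : Pt n → ℝ} (h : HBound α m M f) : 0 ≤ M :=
  (abs_nonneg _).trans (h.bound 0)

lemma differentiable {m : ℕ} {M : ℝ} {f : Pt n → ℝ} (h : HBound α (m + 1) M f) :
    Differentiable ℝ f := h.1.1

lemma pd_bound {m : ℕ} {M : ℝ} {f : Pt n → ℝ} (h : HBound α (m + 1) M f) (i : Fin n) :
    HBound α m M (pd i f) := h.2 i

lemma mono {m : ℕ} {M N : ℝ} {f : Pt n → ℝ} (h : HBound α m M f) (hMN : M ≤ N) :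
    HBound α m N f := by
  induction m generalizing f with
  | zero =>
    exact ⟨fun x => (h.1 x).trans hMN, fun x y => (h.2 x y).trans (by gcongr)⟩
  | succ m ih => exact ⟨⟨h.1.1, fun x => (h.1.2 x).trans hMN⟩, fun i => ih (h.2 i)⟩

lemma continuous (hα : 0 < α) {m : ℕ} {M : ℝ} {f : Pt n → ℝ} (h : HBound α m M f) :
    Continuous f := by
  cases m with
  | zero =>
    refine continuous_iff_continuousAt.2 fun x => ?_
    rw [ContinuousAt, tendsto_iff_dist_tendsto_zero]
    refine squeeze_zero (fun _ => dist_nonneg) (fun y => (Real.dist_eq _ _).trans_le (h.2 y x)) ?_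
    have : ContinuousAt (fun y => M * dist y x ^ α) x :=
      continuousAt_const.mul ((continuousAt_id.dist continuousAt_const).rpow_const (Or.inr hα.le))
    have h2 := this.tendsto
    simp only [dist_self] at h2
    rwa [Real.zero_rpow hα.ne', mul_zero] at h2
  | succ m => exact h.1.1.continuous

lemma contDiff (hα : 0 < α) {m : ℕ} {M : ℝ} {f : Pt n → ℝ} (h : HBound α m M f) :
    ContDiff ℝ m f := by
  induction m generalizing f with
  | zero => exact contDiff_zero.2 (h.continuous hα)
  | succ m ih => exact contDiff_succ_iff_pd.2 ⟨h.1.1, fun i => ih (h.2 i)⟩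

lemma of_lipschitz (hα : α ∈ Ioo (0 : ℝ) 1) {M : ℝ} {f : Pt n → ℝ} (hf : Differentiable ℝ f)
    (hb : ∀ x, |f x| ≤ M) (hd : ∀ i x, |pd i f x| ≤ M) :
    HBound α 0 ((n + 2) * M) f := by
  have hM : 0 ≤ M := (abs_nonneg _).trans (hb 0)
  have hn : (0 : ℝ) ≤ n := n.cast_nonneg
  refine ⟨fun x => (hb x).trans (by nlinarith), fun x y => ?_⟩
  rcases le_total (dist x y) 1 with h | h
  · have h1 : ‖f x - f y‖ ≤ n * M * ‖x - y‖ :=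
      Convex.norm_image_sub_le_of_norm_fderiv_le (s := univ) (fun z _ => hf z)
        (fun z _ => norm_fderiv_le_of_pd hM fun i => hd i z) convex_univ (mem_univ _) (mem_univ _)
    rw [Real.norm_eq_abs, ← dist_eq_norm] at h1
    have h2 : dist x y ≤ dist x y ^ α := by
      simpa using Real.rpow_le_rpow_of_exponent_ge' dist_nonneg h hα.1.le hα.2.le
    calc _ ≤ _ := h1
      _ ≤ (n + 2) * M * dist x y ^ α := by
        gcongr; linarith
  · have h2 : 1 ≤ dist x y ^ α := Real.one_le_rpow h hα.1.le
    calc |f x - f y| ≤ |f x| + |f y| := abs_sub _ _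
      _ ≤ (n + 2) * M * 1 := by nlinarith [hb x, hb y]
      _ ≤ _ := by gcongr

lemma of_succ (hα : α ∈ Ioo (0 : ℝ) 1) {m : ℕ} {M : ℝ} {f : Pt n → ℝ}
    (h : HBound α (m + 1) M f) : HBound α m ((n + 2) * M) f := by
  induction m generalizing f with
  | zero => exact of_lipschitz hα h.1.1 h.1.2 fun i x => (h.2 i).1 x
  | succ m ih =>
    have hn : (0 : ℝ) ≤ n := n.cast_nonneg
    have := h.nonneg
    exact ⟨⟨h.1.1, fun x => (h.1.2 x).trans (by nlinarith)⟩, fun i => ih (h.2 i)⟩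

lemma add {m : ℕ} {M N : ℝ} {f g : Pt n → ℝ} (hf : HBound α m M f) (hg : HBound α m N g) :
    HBound α m (M + N) (fun x => f x + g x) := by
  induction m generalizing f g with
  | zero =>
    refine ⟨fun x => (abs_add_le _ _).trans (add_le_add (hf.1 x) (hg.1 x)), fun x y => ?_⟩
    calc |f x + g x - (f y + g y)| = |(f x - f y) + (g x - g y)| := by ring_nf
      _ ≤ |f x - f y| + |g x - g y| := abs_add_le _ _
      _ ≤ M * dist x y ^ α + N * dist x y ^ α := add_le_add (hf.2 x y) (hg.2 x y)
      _ = _ := by ring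
  | succ m ih =>
    refine ⟨⟨hf.1.1.add hg.1.1,
      fun x => (abs_add_le _ _).trans (add_le_add (hf.1.2 x) (hg.1.2 x))⟩, fun i => ?_⟩
    rw [show pd i (fun x => f x + g x)
        = fun x => pd i f x + pd i g x from
      funext fun x => pd_add (hf.1.1 x) (hg.1.1 x) i]
    exact ih (hf.2 i) (hg.2 i)

lemma const_mul {m : ℕ} {M : ℝ} {f : Pt n → ℝ} (c : ℝ) (hf : HBound α m M f) :
    HBound α m (|c| * M) (fun x => c * f x) := by
  induction m generalizing f with
  | zero =>
    refine ⟨fun x => ?_, fun x y => ?_⟩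
    · rw [abs_mul]; exact mul_le_mul_of_nonneg_left (hf.1 x) (abs_nonneg _)
    · rw [← mul_sub, abs_mul, mul_assoc]
      exact mul_le_mul_of_nonneg_left (hf.2 x y) (abs_nonneg _)
  | succ m ih =>
    refine ⟨⟨hf.1.1.const_mul c, fun x => ?_⟩, fun i => ?_⟩
    · rw [abs_mul]; exact mul_le_mul_of_nonneg_left (hf.1.2 x) (abs_nonneg _)
    · rw [show pd i (fun x => c * f x) = fun x => c * pd i f x from
        funext fun x => pd_const_mul c f x i]
      exact ih (hf.2 i)

lemma zero (m : ℕ) : HBound α m 0 (fun _ : Pt n => (0 : ℝ)) := by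
  induction m with
  | zero => simp [HBound]
  | succ m ih =>
    refine ⟨⟨by fun_prop, by simp⟩, fun i => ?_⟩
    rwa [show pd i (fun _ : Pt n => (0 : ℝ)) = fun _ => 0 from funext fun x => pd_const i 0 x]

lemma const (m : ℕ) (c : ℝ) : HBound α m |c| (fun _ : Pt n => c) := by
  cases m with
  | zero =>
    refine ⟨fun _ => le_rfl, fun x y => ?_⟩
    rw [sub_self, abs_zero]
    positivity
  | succ m =>
    refine ⟨⟨by fun_prop, fun _ => le_rfl⟩, fun i => ?_⟩
    have : pd i (fun _ : Pt n => c) = fun _ => 0 := funext fun x => by simp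
    rw [this]
    exact (zero m).mono (abs_nonneg c)

lemma sum {ι : Type*} (s : Finset ι) {m : ℕ} {M : ι → ℝ} {f : ι → Pt n → ℝ}
    (h : ∀ j ∈ s, HBound α m (M j) (f j)) :
    HBound α m (∑ j ∈ s, M j) (fun x => ∑ j ∈ s, f j x) := by
  classical
  induction s using Finset.induction_on with
  | empty => simpa using zero m
  | insert a s ha ih =>
    simp only [Finset.sum_insert ha]
    exact (h a (Finset.mem_insert_self _ _)).add
      (ih fun j hj => h j (Finset.mem_insert_of_mem hj))

lemma sum_univ {ι : Type*} [Fintype ι] {m : ℕ} {M : ℝ} {f : ι → Pt n → ℝ}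
    (h : ∀ j, HBound α m M (f j)) :
    HBound α m (Fintype.card ι * M) (fun x => ∑ j, f j x) := by
  simpa using sum Finset.univ (M := fun _ => M) (fun j _ => h j)

lemma mul (hα : α ∈ Ioo (0 : ℝ) 1) {m : ℕ} {M N : ℝ} {f g : Pt n → ℝ}
    (hf : HBound α m M f) (hg : HBound α m N g) :
    HBound α m ((2 * (n + 2)) ^ m * (2 * (M * N))) (fun x => f x * g x) := by
  induction m generalizing f g M N with
  | zero =>
    have hM := hf.nonneg
    have hN := hg.nonneg
    refine ⟨fun x => ?_, fun x y => ?_⟩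
    · rw [abs_mul]
      have := mul_le_mul (hf.1 x) (hg.1 x) (abs_nonneg _) hM
      have := mul_nonneg hM hN
      simp; linarith
    · calc |f x * g x - f y * g y| = |f x * (g x - g y) + (f x - f y) * g y| := by ring_nf
        _ ≤ |f x| * |g x - g y| + |f x - f y| * |g y| := by
          rw [← abs_mul, ← abs_mul]; exact abs_add_le _ _
        _ ≤ M * (N * dist x y ^ α) + (M * dist x y ^ α) * N := by
          have := hf.2 x y
          gcongr
          exacts [hf.1 x, hg.2 x y, hg.1 y]
        _ = _ := by ring
  | succ m ih =>
    have hM := hf.nonneg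
    have hN := hg.nonneg
    have hMN := mul_nonneg hM hN
    have hn : (0 : ℝ) ≤ n := n.cast_nonneg
    refine ⟨⟨hf.1.1.mul hg.1.1, fun x => ?_⟩, fun i => ?_⟩
    · rw [abs_mul]
      have h1 := mul_le_mul (hf.1.2 x) (hg.1.2 x) (abs_nonneg _) hM
      have h2 : (1 : ℝ) ≤ (2 * (n + 2)) ^ (m + 1) := one_le_pow₀ (by linarith)
      nlinarith
    · rw [show pd i (fun x => f x * g x)
          = fun x => pd i f x * g x + f x * pd i g x from
        funext fun x => pd_mul (hf.1.1 x) (hg.1.1 x) i]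
      refine ((ih (hf.2 i) (hg.of_succ hα)).add (ih (hf.of_succ hα) (hg.2 i))).mono (le_of_eq ?_)
      ring

lemma comp_smul {m : ℕ} {M : ℝ} {f : Pt n → ℝ} (r : ℝ) (hf : HBound α m M f) :
    HBound α m (max 1 (|r| ^ α) * max 1 |r| ^ m * M) (fun x => f (r • x)) := by
  induction m generalizing f M with
  | zero =>
    have hM := hf.nonneg
    have h1 : 1 ≤ max 1 (|r| ^ α) := le_max_left _ _
    refine ⟨fun x => (hf.1 _).trans ?_, fun x y => (hf.2 _ _).trans ?_⟩
    · simp; nlinarith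
    · rw [dist_smul₀, Real.mul_rpow (norm_nonneg _) dist_nonneg, Real.norm_eq_abs]
      have h2 := le_max_right 1 (|r| ^ α)
      calc M * (|r| ^ α * dist x y ^ α) ≤ M * (max 1 (|r| ^ α) * dist x y ^ α) := by gcongr
        _ = _ := by simp; ring
  | succ m ih =>
    have hM := hf.nonneg
    have h1 : 1 ≤ max 1 (|r| ^ α) := le_max_left _ _
    have h2 : 1 ≤ max 1 |r| ^ (m + 1) := one_le_pow₀ (le_max_left _ _)
    refine ⟨⟨hf.1.1.comp (differentiable_id.const_smul r), fun x => (hf.1.2 _).trans ?_⟩,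
      fun i => ?_⟩
    · have := one_le_mul_of_one_le_of_one_le h1 h2
      nlinarith
    · rw [show pd i (fun x => f (r • x)) = fun x => r * pd i f (r • x) from
        funext fun x => pd_comp_smul r f x i]
      refine ((ih (hf.2 i)).const_mul r).mono ?_
      calc |r| * (max 1 (|r| ^ α) * max 1 |r| ^ m * M)
          ≤ max 1 |r| * (max 1 (|r| ^ α) * max 1 |r| ^ m * M) := by
            gcongr; exact le_max_right _ _
        _ = _ := by ring

end HBound

lemma exists_hBound_of_contDiff (hα : α ∈ Ioo (0 : ℝ) 1) (m : ℕ) {f : Pt n → ℝ}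
    (hf : ContDiff ℝ ∞ f) (hc : HasCompactSupport f) : ∃ M, HBound α m M f := by
  have hb : ∀ {f : Pt n → ℝ}, ContDiff ℝ ∞ f → HasCompactSupport f → ∃ M, ∀ x, |f x| ≤ M :=
    fun hf hc => hc.exists_bound_of_continuous hf.continuous
  induction m generalizing f with
  | zero =>
    obtain ⟨M, hM⟩ := hb hf hc
    choose D hD using fun i => hb (hf.pd_infty i) (hasCompactSupport_pd hc i)
    have h0 : ∀ i, 0 ≤ D i := fun i => (abs_nonneg _).trans (hD i 0)
    have h1 : 0 ≤ ∑ i, D i := Finset.sum_nonneg fun i _ => h0 i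
    refine ⟨_, HBound.of_lipschitz hα (M := M + ∑ i, D i) (hf.differentiable (by simp))
      (fun x => (hM x).trans (by linarith)) fun i x => (hD i x).trans ?_⟩
    have := Finset.single_le_sum (fun i _ => h0 i) (Finset.mem_univ i)
    linarith [(abs_nonneg _).trans (hM 0)]
  | succ m ih =>
    obtain ⟨M, hM⟩ := hb hf hc
    choose D hD using fun i => ih (hf.pd_infty i) (hasCompactSupport_pd hc i)
    have h1 : 0 ≤ ∑ i, D i := Finset.sum_nonneg fun i _ => (hD i).nonneg
    refine ⟨M + ∑ i, D i, ⟨hf.differentiable (by simp), fun x => (hM x).trans (by linarith)⟩,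
      fun i => (hD i).mono ?_⟩
    have := Finset.single_le_sum (fun i _ => (hD i).nonneg) (Finset.mem_univ i)
    linarith [(abs_nonneg _).trans (hM 0)]

end HolderBounds

section Series

variable {n : ℕ} {α : ℝ}

lemma differentiable_tsum_pd {f : ℕ → Pt n → ℝ} {M : ℕ → ℝ} (hM : Summable M)
    (hf : ∀ j, Differentiable ℝ (f j)) (hd : ∀ j i x, |pd i (f j) x| ≤ M j)
    (hs : ∀ x, Summable fun j => f j x) :
    Differentiable ℝ (fun x => ∑' j, f j x) ∧
      ∀ i x, pd i (fun x => ∑' j, f j x) x = ∑' j, pd i (f j) x := by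
  rcases isEmpty_or_nonempty (Fin n) with hn | ⟨⟨i₀⟩⟩
  · exact ⟨fun x => (hasFDerivAt_of_subsingleton _ x).differentiableAt, fun i => hn.elim i⟩
  have h0 : ∀ j, 0 ≤ M j := fun j => (abs_nonneg _).trans (hd j i₀ 0)
  have hu : Summable fun j => n * M j := hM.mul_left _
  have hb : ∀ j x, ‖fderiv ℝ (f j) x‖ ≤ n * M j := fun j x =>
    norm_fderiv_le_of_pd (h0 j) fun i => hd j i x
  have key := fun x => hasFDerivAt_tsum hu (fun j y => (hf j y).hasFDerivAt) hb (hs 0) x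
  refine ⟨fun x => (key x).differentiableAt, fun i x => ?_⟩
  rw [pd, (key x).fderiv]
  have hsum : Summable fun j => fderiv ℝ (f j) x := .of_norm_bounded hu fun j => hb j x
  exact (ContinuousLinearMap.apply ℝ ℝ (Pi.single i (1 : ℝ) : Pt n)).map_tsum hsum

lemma HBound.summable {f : ℕ → Pt n → ℝ} {m : ℕ} {M : ℕ → ℝ} (hM : Summable M)
    (hf : ∀ j, HBound α m (M j) (f j)) (x : Pt n) : Summable fun j => f j x :=
  .of_norm_bounded hM fun j => (hf j).bound x

lemma HBound.pd_tsum {f : ℕ → Pt n → ℝ} {m : ℕ} {M : ℕ → ℝ} (hM : Summable M)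
    (hf : ∀ j, HBound α (m + 1) (M j) (f j)) (i : Fin n) :
    pd i (fun x => ∑' j, f j x) = fun x => ∑' j, pd i (f j) x :=
  funext <| (differentiable_tsum_pd hM (fun j => (hf j).differentiable)
    (fun j i => ((hf j).pd_bound i).bound) (HBound.summable hM hf)).2 i

lemma HBound.tsum {f : ℕ → Pt n → ℝ} {m : ℕ} {M : ℕ → ℝ} (hM : Summable M)
    (hf : ∀ j, HBound α m (M j) (f j)) : HBound α m (∑' j, M j) (fun x => ∑' j, f j x) := by
  have hb : ∀ {f : ℕ → Pt n → ℝ} {m : ℕ}, (∀ j, HBound α m (M j) (f j)) →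
      ∀ x, |∑' j, f j x| ≤ ∑' j, M j := fun hf x => by
    rw [← Real.norm_eq_abs]
    exact tsum_of_norm_bounded hM.hasSum fun j => (hf j).bound x
  induction m generalizing f with
  | zero =>
    refine ⟨hb hf, fun x y => ?_⟩
    rw [← (HBound.summable hM hf x).tsum_sub (HBound.summable hM hf y), ← tsum_mul_right]
    rw [← Real.norm_eq_abs]
    exact tsum_of_norm_bounded (hM.mul_right _).hasSum fun j => (hf j).2 x y
  | succ m ih =>
    refine ⟨⟨?_, hb hf⟩, fun i => ?_⟩
    · exact (differentiable_tsum_pd hM (fun j => (hf j).differentiable)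
        (fun j i => ((hf j).pd_bound i).bound) (HBound.summable hM hf)).1
    · rw [HBound.pd_tsum hM hf]
      exact ih fun j => (hf j).pd_bound i

end Series

section Convolution

variable {n : ℕ} {α : ℝ}

/-- Convolution of a kernel `κ` with a function `w`. -/
def conv (κ w : Pt n → ℝ) (x : Pt n) : ℝ := ∫ y, κ y * w (x - y)

lemma integrable_conv {κ w : Pt n → ℝ} (hκ : Continuous κ) (hc : HasCompactSupport κ)
    (hw : Continuous w) (x : Pt n) : Integrable fun y => κ y * w (x - y) :=
  (hκ.mul (hw.comp (continuous_const.sub continuous_id))).integrable_of_hasCompactSupport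
    hc.mul_right

lemma abs_conv_le {κ w : Pt n → ℝ} {M : ℝ} (hκ : Continuous κ) (hc : HasCompactSupport κ)
    (hw : ∀ x, |w x| ≤ M) (x : Pt n) :
    |conv κ w x| ≤ (∫ y, |κ y|) * M := by
  rw [← integral_mul_const, ← Real.norm_eq_abs]
  refine norm_integral_le_of_norm_le
    ((hκ.abs.integrable_of_hasCompactSupport hc.abs).mul_const _) (.of_forall fun y => ?_)
  rw [Real.norm_eq_abs, abs_mul]
  exact mul_le_mul_of_nonneg_left (hw _) (abs_nonneg _)

lemma integrable_moment {κ : Pt n → ℝ} (hα : 0 < α) (hκ : Continuous κ)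
    (hc : HasCompactSupport κ) : Integrable fun y => |κ y| * ‖y‖ ^ α :=
  (hκ.abs.mul (continuous_norm.rpow_const fun _ => Or.inr hα.le)).integrable_of_hasCompactSupport
    hc.abs.mul_right

/-- The convolution with `κ` differs from multiplication by `∫ κ` by the `α`-moment of `κ`. -/
lemma abs_conv_sub_le {κ w : Pt n → ℝ} {M : ℝ} (hα : 0 < α) (hκ : Continuous κ)
    (hc : HasCompactSupport κ) (hw : HBound α 0 M w) (x : Pt n) :
    |conv κ w x - (∫ y, κ y) * w x| ≤ (∫ y, |κ y| * ‖y‖ ^ α) * M := by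
  rw [conv, ← integral_mul_const, ← integral_mul_const, ← integral_sub
    (integrable_conv hκ hc (hw.continuous hα) x)
    ((hκ.integrable_of_hasCompactSupport hc).mul_const _), ← Real.norm_eq_abs]
  refine norm_integral_le_of_norm_le ((integrable_moment hα hκ hc).mul_const _)
    (.of_forall fun y => ?_)
  rw [Real.norm_eq_abs, ← mul_sub, abs_mul, mul_assoc]
  refine mul_le_mul_of_nonneg_left ((hw.2 _ _).trans (le_of_eq ?_)) (abs_nonneg _)
  rw [dist_eq_norm, mul_comm]
  simp

lemma pd_conv {κ w : Pt n → ℝ} (hκ : ContDiff ℝ 1 κ) (hc : HasCompactSupport κ)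
    (hw : Continuous w) : Differentiable ℝ (conv κ w) ∧
      ∀ i, pd i (conv κ w) = conv (pd i κ) w := by
  have key := fun x => hc.hasFDerivAt_convolution_left (μ := volume)
    (ContinuousLinearMap.mul ℝ ℝ) hκ (hw.locallyIntegrable (μ := volume)) x
  refine ⟨fun x => (key x).differentiableAt, fun i => funext fun x => ?_⟩
  have h1 := (key x).fderiv
  have h2 : conv κ w = convolution κ w (ContinuousLinearMap.mul ℝ ℝ) volume := rfl
  rw [pd, h2, h1, convolution_def, ContinuousLinearMap.integral_apply]
  · rfl
  · exact (hc.fderiv ℝ).convolutionExists_left _ (hκ.continuous_fderiv one_ne_zero)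
      hw.locallyIntegrable x

lemma conv_pd {κ w : Pt n → ℝ} (hκ : ContDiff ℝ 1 κ) (hc : HasCompactSupport κ)
    (hw : ContDiff ℝ 1 w) (i : Fin n) : conv (pd i κ) w = conv κ (pd i w) := by
  funext x
  have hw' : ContDiff ℝ 1 fun y => w (x - y) := hw.comp (contDiff_const.sub contDiff_id)
  have hd : ∀ y, fderiv ℝ (fun y => w (x - y)) y (Pi.single i 1) = - pd i w (x - y) := by
    intro y
    have h : HasFDerivAt (fun y => x - y) (-ContinuousLinearMap.id ℝ (Pt n)) y :=
      (hasFDerivAt_id y).const_sub x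
    have := ((hw.differentiable one_ne_zero _).hasFDerivAt.comp y h).fderiv
    rw [show (fun y => w (x - y)) = w ∘ fun y => x - y from rfl, this]
    simp [pd]
  have hpw : Continuous (pd i w) :=
    (hw.continuous_fderiv one_ne_zero).clm_apply continuous_const
  have hpκ : Continuous (pd i κ) :=
    (hκ.continuous_fderiv one_ne_zero).clm_apply continuous_const
  have := integral_mul_fderiv_eq_neg_fderiv_mul_of_integrable (μ := volume)
    (f := fun y => w (x - y)) (g := κ) (v := (Pi.single i 1 : Pt n)) ?_ ?_ ?_
    (fun y _ => hw'.differentiable one_ne_zero y) (fun y _ => hκ.differentiable one_ne_zero y)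
  · simp only [hd, neg_mul, integral_neg, neg_neg] at this
    simp only [conv, mul_comm (κ _), ← this]
    simp only [pd, mul_comm]
  · simp only [hd, neg_mul]
    simp only [mul_comm (pd i w _)]
    exact (integrable_conv hκ.continuous hc hpw x).neg
  · simpa only [mul_comm, pd] using (integrable_conv hpκ (hasCompactSupport_pd hc i)
      hw.continuous x)
  · simpa only [mul_comm] using (integrable_conv hκ.continuous hc hw.continuous x)

/-- The `L¹`-normalized dilation of a kernel, at scale `2⁻ʲ`. -/
def dil (j : ℕ) (κ : Pt n → ℝ) (x : Pt n) : ℝ := (2 ^ j) ^ n * κ ((2 : ℝ) ^ j • x)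

lemma contDiff_dil (j : ℕ) {κ : Pt n → ℝ} {m : WithTop ℕ∞} (hκ : ContDiff ℝ m κ) :
    ContDiff ℝ m (dil j κ) :=
  contDiff_const.mul (hκ.comp (contDiff_const_smul _))

lemma hasCompactSupport_dil (j : ℕ) {κ : Pt n → ℝ} (hκ : HasCompactSupport κ) :
    HasCompactSupport (dil j κ) :=
  (hκ.comp_smul (c := (2 : ℝ) ^ j) (by positivity)).mul_left

lemma pd_dil (j : ℕ) (κ : Pt n → ℝ) (i : Fin n) :
    pd i (dil j κ) = fun x => 2 ^ j * dil j (pd i κ) x := by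
  funext x
  change pd i (fun x => _ * _) x = _
  rw [pd_const_mul, pd_comp_smul, dil]
  ring

lemma integral_comp_dil (j : ℕ) (κ : Pt n → ℝ) (φ : Pt n → ℝ) :
    ∫ x, dil j κ x * φ ((2 : ℝ) ^ j • x) = ∫ x, κ x * φ x := by
  have := Measure.integral_comp_smul (volume : Measure (Pt n)) (fun x => κ x * φ x) ((2 : ℝ) ^ j)
  simp only [dil, mul_assoc]
  rw [integral_const_mul, this, Module.finrank_fin_fun, abs_of_nonneg (by positivity), smul_eq_mul,
    ← mul_assoc, mul_inv_cancel₀ (by positivity), one_mul]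

lemma integral_dil (j : ℕ) (κ : Pt n → ℝ) : ∫ x, dil j κ x = ∫ x, κ x := by
  simpa using integral_comp_dil j κ fun _ => 1

lemma abs_dil (j : ℕ) (κ : Pt n → ℝ) (x : Pt n) : |dil j κ x| = dil j (fun x => |κ x|) x := by
  rw [dil, abs_mul, abs_of_nonneg (by positivity)]; rfl

lemma integral_abs_dil (j : ℕ) (κ : Pt n → ℝ) : ∫ x, |dil j κ x| = ∫ x, |κ x| := by
  simp only [abs_dil, integral_dil]

lemma integral_moment_dil (j : ℕ) (κ : Pt n → ℝ) :
    ∫ x, |dil j κ x| * ‖x‖ ^ α = ((2 : ℝ) ^ (-α)) ^ j * ∫ x, |κ x| * ‖x‖ ^ α := by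
  have h := integral_comp_dil j (fun x => |κ x|) (fun x => ‖x‖ ^ α)
  rw [← h, ← integral_const_mul]
  refine integral_congr_ae (.of_forall fun x => ?_)
  simp only [abs_dil]
  rw [norm_smul, Real.mul_rpow (norm_nonneg _) (norm_nonneg _)]
  have : ((2 : ℝ) ^ (-α)) ^ j * ‖(2 : ℝ) ^ j‖ ^ α = 1 := by
    rw [Real.norm_of_nonneg (by positivity), ← Real.rpow_natCast, ← Real.rpow_natCast,
      ← Real.rpow_mul (by norm_num), ← Real.rpow_mul (by norm_num), ← Real.rpow_add (by norm_num)]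
    simp [mul_comm]
  linear_combination (-dil j (fun x => |κ x|) x * ‖x‖ ^ α) * this

end Convolution

section DyadicPotential

variable {n : ℕ} {α : ℝ}

lemma two_rpow_neg_bounds (hα : α ∈ Ioo (0 : ℝ) 1) :
    0 < (2 : ℝ) ^ (-α) ∧ (2 : ℝ) ^ (-α) < 1 ∧ 1 < 2 * (2 : ℝ) ^ (-α) := by
  refine ⟨by positivity, Real.rpow_lt_one_of_one_lt_of_neg (by norm_num) (by linarith [hα.1]), ?_⟩
  have : 2 * (2 : ℝ) ^ (-α) = 2 ^ (1 - α) := by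
    rw [sub_eq_add_neg, Real.rpow_add (by norm_num), Real.rpow_one]
  rw [this]
  exact Real.one_lt_rpow (by norm_num) (by linarith [hα.2])

lemma two_rpow_neg_pow (j : ℕ) : ((2 : ℝ) ^ (-α)) ^ j = ((1 / 2 : ℝ) ^ j) ^ α := by
  rw [Real.rpow_neg (by norm_num), ← Real.inv_rpow (by norm_num), ← Real.rpow_natCast,
    ← Real.rpow_natCast, ← Real.rpow_mul (by norm_num), ← Real.rpow_mul (by norm_num)]
  norm_num [mul_comm]

/-- A dyadic sum whose `j`-th term has size `2^(-jα)` and Lipschitz constant `2^(j(1-α))` is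
`α`-Hölder continuous. -/
lemma exists_hBound_dyadic_sum (hα : α ∈ Ioo (0 : ℝ) 1) :
    ∃ K : ℝ, 0 ≤ K ∧ ∀ (C : ℝ) (a : ℕ → Pt n → ℝ), (∀ j x, |a j x| ≤ C * ((2 : ℝ) ^ (-α)) ^ j) →
      (∀ j x y, |a j x - a j y| ≤ C * (2 * (2 : ℝ) ^ (-α)) ^ j * dist x y) →
      HBound α 0 (K * C) (fun x => ∑' j, a j x) := by
  obtain ⟨hβ0, hβ1, hβ2⟩ := two_rpow_neg_bounds hα
  set β : ℝ := (2 : ℝ) ^ (-α) with hβ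
  have h1 : 0 < 1 - β := by linarith
  have h2 : 0 < 2 * β - 1 := by linarith
  have hi1 : 0 < (1 - β)⁻¹ := by positivity
  have hi2 : 0 < (2 * β - 1)⁻¹ := by positivity
  refine ⟨4 * (2 * β - 1)⁻¹ + 2 * (1 - β)⁻¹, by positivity, fun C a ha hl => ?_⟩
  have hC : 0 ≤ C := by simpa using (abs_nonneg _).trans (ha 0 0)
  have hgeo : Summable fun j : ℕ => C * β ^ j := (summable_geometric_of_lt_one hβ0.le hβ1).mul_left C
  have hsum : ∀ x, Summable fun j => a j x := fun x => .of_norm_bounded hgeo fun j => ha j x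
  have htot : ∑' j : ℕ, C * β ^ j = C * (1 - β)⁻¹ := by
    rw [tsum_mul_left, tsum_geometric_of_lt_one hβ0.le hβ1]
  have hbd : ∀ x, |∑' j, a j x| ≤ C * (1 - β)⁻¹ := fun x => by
    rw [← htot, ← Real.norm_eq_abs]
    exact tsum_of_norm_bounded hgeo.hasSum fun j => ha j x
  have hCi1 : 0 ≤ C * (1 - β)⁻¹ := by positivity
  have hCi2 : 0 ≤ C * (2 * β - 1)⁻¹ := by positivity
  refine ⟨fun x => (hbd x).trans (by linarith), fun x y => ?_⟩
  rcases lt_or_ge 1 (dist x y) with hD | hD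
  · have h3 : 1 ≤ dist x y ^ α := Real.one_le_rpow hD.le hα.1.le
    calc |∑' j, a j x - ∑' j, a j y| ≤ |∑' j, a j x| + |∑' j, a j y| := abs_sub _ _
      _ ≤ (4 * (2 * β - 1)⁻¹ + 2 * (1 - β)⁻¹) * C * 1 := by linarith [hbd x, hbd y]
      _ ≤ _ := by gcongr
  rcases (dist_nonneg (x := x) (y := y)).eq_or_lt with hD0 | hD0
  · have : x = y := dist_eq_zero.1 hD0.symm
    subst this
    simp only [sub_self, abs_zero]
    positivity
  obtain ⟨J, hJ1, hJ2⟩ := exists_nat_pow_near_of_lt_one hD0 hD (by norm_num : (0 : ℝ) < 1 / 2)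
    (by norm_num)
  set D := dist x y
  have hβJ : β ^ (J + 1) ≤ D ^ α := by
    rw [hβ, two_rpow_neg_pow]
    exact Real.rpow_le_rpow (by positivity) hJ1.le hα.1.le
  have hdiff : Summable fun j => a j x - a j y := (hsum x).sub (hsum y)
  rw [← (hsum x).tsum_sub (hsum y), ← hdiff.sum_add_tsum_nat_add (J + 1)]
  refine (abs_add_le _ _).trans ?_
  have hhead : |∑ j ∈ Finset.range (J + 1), (a j x - a j y)|
      ≤ 4 * (2 * β - 1)⁻¹ * C * D ^ α := by
    calc |∑ j ∈ Finset.range (J + 1), (a j x - a j y)|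
        ≤ ∑ j ∈ Finset.range (J + 1), |a j x - a j y| := Finset.abs_sum_le_sum_abs _ _
      _ ≤ ∑ j ∈ Finset.range (J + 1), C * (2 * β) ^ j * D :=
          Finset.sum_le_sum fun j _ => hl j x y
      _ = C * D * (((2 * β) ^ (J + 1) - 1) / (2 * β - 1)) := by
          rw [← Finset.sum_mul, ← Finset.mul_sum, geom_sum_eq hβ2.ne']; ring
      _ ≤ C * D * ((2 * β) ^ (J + 1) / (2 * β - 1)) := by
          gcongr; linarith
      _ = C * (2 * β - 1)⁻¹ * 2 * (D * 2 ^ J) * β ^ (J + 1) := by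
          rw [mul_pow, pow_succ 2 J, div_eq_mul_inv]; ring
      _ ≤ C * (2 * β - 1)⁻¹ * 2 * 1 * D ^ α := by
          gcongr
          calc D * 2 ^ J ≤ (1 / 2) ^ J * 2 ^ J := by gcongr
            _ = 1 := by rw [← mul_pow]; norm_num
      _ ≤ _ := by
          have : 0 ≤ C * (2 * β - 1)⁻¹ * D ^ α := by positivity
          linarith
  have htail : |∑' j, (a (j + (J + 1)) x - a (j + (J + 1)) y)|
      ≤ 2 * (1 - β)⁻¹ * C * D ^ α := by
    have hs : HasSum (fun j : ℕ => 2 * C * β ^ (J + 1) * β ^ j)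
        (2 * C * β ^ (J + 1) * (1 - β)⁻¹) :=
      (hasSum_geometric_of_lt_one hβ0.le hβ1).mul_left _
    have : |∑' j, (a (j + (J + 1)) x - a (j + (J + 1)) y)| ≤ 2 * C * β ^ (J + 1) * (1 - β)⁻¹ := by
      rw [← Real.norm_eq_abs]
      refine tsum_of_norm_bounded hs fun j => ?_
      have h3 := ha (j + (J + 1)) x
      have h4 := ha (j + (J + 1)) y
      rw [pow_add] at h3 h4
      refine (norm_sub_le _ _).trans ?_
      rw [Real.norm_eq_abs, Real.norm_eq_abs]
      linarith
    refine this.trans ?_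
    calc 2 * C * β ^ (J + 1) * (1 - β)⁻¹ ≤ 2 * C * D ^ α * (1 - β)⁻¹ := by gcongr
      _ = _ := by ring
  linarith

/-- The potential `∑ⱼ 4⁻ʲ κⱼ ∗ w` built from the dyadic dilations of a kernel `κ`. -/
def pot (κ w : Pt n → ℝ) (x : Pt n) : ℝ := ∑' j : ℕ, (1 / 4) ^ j * conv (dil j κ) w x

variable {κ : Pt n → ℝ}

lemma integral_pd_eq_zero (hκ : ContDiff ℝ 1 κ) (hc : HasCompactSupport κ) (i : Fin n) :
    ∫ x, pd i κ x = 0 := by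
  have h := congrFun (conv_pd hκ hc (contDiff_const (c := (1 : ℝ))) i) 0
  rw [show pd i (fun _ : Pt n => (1 : ℝ)) = fun _ => 0 from funext (pd_const i 1)] at h
  simpa [conv] using h

lemma abs_pot_term_le (hκ : Continuous κ) (hc : HasCompactSupport κ) {M : ℝ}
    {w : Pt n → ℝ} (hw : HBound α 0 M w) (c : ℝ) (j : ℕ) (x : Pt n) :
    |c ^ j * conv (dil j κ) w x| ≤ |c| ^ j * ((∫ y, |κ y|) * M) := by
  rw [abs_mul, abs_pow, ← integral_abs_dil j]
  exact mul_le_mul_of_nonneg_left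
    (abs_conv_le ((contDiff_dil j (contDiff_zero.2 hκ)).continuous) (hasCompactSupport_dil j hc)
      hw.1 x) (by positivity)

lemma summable_pot_term (hκ : Continuous κ) (hc : HasCompactSupport κ) {M : ℝ}
    {w : Pt n → ℝ} (hw : HBound α 0 M w) {c : ℝ} (h0 : |c| < 1) (x : Pt n) :
    Summable fun j : ℕ => c ^ j * conv (dil j κ) w x :=
  .of_norm_bounded ((summable_geometric_of_lt_one (abs_nonneg c) h0).mul_right _)
    fun j => abs_pot_term_le hκ hc hw c j x

lemma pd_conv_dil (hκ : ContDiff ℝ ∞ κ) (hc : HasCompactSupport κ) {w : Pt n → ℝ}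
    (hw : Continuous w) (j : ℕ) (i : Fin n) (x : Pt n) :
    pd i (conv (dil j κ) w) x = 2 ^ j * conv (dil j (pd i κ)) w x := by
  rw [(pd_conv ((contDiff_dil j hκ).of_le (by simp)) (hasCompactSupport_dil j hc) hw).2, pd_dil]
  simp only [conv, mul_assoc, integral_const_mul]

lemma differentiable_conv_dil (hκ : ContDiff ℝ ∞ κ) (hc : HasCompactSupport κ) {w : Pt n → ℝ}
    (hw : Continuous w) (j : ℕ) : Differentiable ℝ (conv (dil j κ) w) :=
  (pd_conv ((contDiff_dil j hκ).of_le (by simp)) (hasCompactSupport_dil j hc) hw).1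

lemma pd_pot (hα : 0 < α) (hκ : ContDiff ℝ ∞ κ) (hc : HasCompactSupport κ) {M : ℝ}
    {w : Pt n → ℝ} (hw : HBound α 0 M w) :
    Differentiable ℝ (pot κ w) ∧
      ∀ i, pd i (pot κ w) = fun x => ∑' j : ℕ, (1 / 2) ^ j * conv (dil j (pd i κ)) w x := by
  have hterm : ∀ j i x, pd i (fun x => (1 / 4 : ℝ) ^ j * conv (dil j κ) w x) x
      = (1 / 2) ^ j * conv (dil j (pd i κ)) w x := fun j i x => by
    rw [pd_const_mul, pd_conv_dil hκ hc (hw.continuous hα), ← mul_assoc, ← mul_pow]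
    norm_num
  have h0 : ∀ i, 0 ≤ ∫ y, |pd i κ y| := fun i => integral_nonneg fun _ => abs_nonneg _
  have hM := hw.nonneg
  have key := differentiable_tsum_pd
    (f := fun j x => (1 / 4 : ℝ) ^ j * conv (dil j κ) w x)
    (M := fun j => |1 / 2| ^ j * ((∑ i, ∫ y, |pd i κ y|) * M))
    ((summable_geometric_of_lt_one (by norm_num) (by norm_num [abs_of_pos])).mul_right _)
    (fun j => (differentiable_conv_dil hκ hc (hw.continuous hα) j).const_mul _)
    (fun j i x => ?_)
    (summable_pot_term hκ.continuous hc hw (by norm_num [abs_of_pos]))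
  · refine ⟨key.1, fun i => funext fun x => ?_⟩
    exact (key.2 i x).trans (by simp only [hterm])
  · rw [hterm]
    refine (abs_pot_term_le (hκ.pd_infty i).continuous (hasCompactSupport_pd hc i) hw _ j
      x).trans ?_
    gcongr
    exact Finset.single_le_sum (f := fun i => ∫ y, |pd i κ y|) (fun i _ => h0 i)
      (Finset.mem_univ i)

/-- Convolution with a dilated kernel of mean zero. -/
lemma abs_conv_dil_le (hα : 0 < α) (hκ : Continuous κ) (hc : HasCompactSupport κ)
    (h0 : ∫ x, κ x = 0) {M : ℝ} {w : Pt n → ℝ} (hw : HBound α 0 M w) (j : ℕ) (x : Pt n) :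
    |conv (dil j κ) w x| ≤ (∫ y, |κ y| * ‖y‖ ^ α) * M * ((2 : ℝ) ^ (-α)) ^ j := by
  have := abs_conv_sub_le hα (contDiff_dil j (contDiff_zero.2 hκ)).continuous
    (hasCompactSupport_dil j hc) hw x
  rw [integral_dil, h0, zero_mul, sub_zero, integral_moment_dil] at this
  linarith

lemma pd_pd_pot (hα : α ∈ Ioo (0 : ℝ) 1) (hκ : ContDiff ℝ ∞ κ) (hc : HasCompactSupport κ) {M : ℝ}
    {w : Pt n → ℝ} (hw : HBound α 0 M w) (i : Fin n) :
    Differentiable ℝ (pd i (pot κ w)) ∧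
      ∀ l, pd l (pd i (pot κ w)) = fun x => ∑' j : ℕ, conv (dil j (pd l (pd i κ))) w x := by
  obtain ⟨hβ0, hβ1, -⟩ := two_rpow_neg_bounds hα
  rw [(pd_pot hα.1 hκ hc hw).2 i]
  have hκi := hκ.pd_infty i
  have hci := hasCompactSupport_pd hc i
  have hterm : ∀ j l x, pd l (fun x => (1 / 2 : ℝ) ^ j * conv (dil j (pd i κ)) w x) x
      = conv (dil j (pd l (pd i κ))) w x := fun j l x => by
    rw [pd_const_mul, pd_conv_dil hκi hci (hw.continuous hα.1), ← mul_assoc, ← mul_pow]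
    norm_num
  have h0 : ∀ l, 0 ≤ ∫ y, |pd l (pd i κ) y| * ‖y‖ ^ α := fun i =>
    integral_nonneg fun _ => by positivity
  have hM := hw.nonneg
  have key := differentiable_tsum_pd
    (f := fun j x => (1 / 2 : ℝ) ^ j * conv (dil j (pd i κ)) w x)
    (M := fun j => (∑ l, ∫ y, |pd l (pd i κ) y| * ‖y‖ ^ α) * M * ((2 : ℝ) ^ (-α)) ^ j)
    ((summable_geometric_of_lt_one hβ0.le hβ1).mul_left _)
    (fun j => (differentiable_conv_dil hκi hci (hw.continuous hα.1) j).const_mul _)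
    (fun j l x => ?_)
    (summable_pot_term hκi.continuous hci hw (by norm_num [abs_of_pos]))
  · refine ⟨key.1, fun l => funext fun x => ?_⟩
    exact (key.2 l x).trans (by simp only [hterm])
  · rw [hterm]
    refine (abs_conv_dil_le hα.1 (hκi.pd_infty l).continuous (hasCompactSupport_pd hci l)
      (integral_pd_eq_zero (hκi.of_le (by simp)) hci l) hw j x).trans ?_
    gcongr
    exact Finset.single_le_sum (f := fun l => ∫ y, |pd l (pd i κ) y| * ‖y‖ ^ α) (fun l _ => h0 l)
      (Finset.mem_univ l)

lemma exists_hBound_sum_conv (hα : α ∈ Ioo (0 : ℝ) 1) (hκ : ContDiff ℝ ∞ κ)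
    (hc : HasCompactSupport κ) (h0 : ∫ x, κ x = 0) :
    ∃ C : ℝ, 0 ≤ C ∧ ∀ (M : ℝ) (w : Pt n → ℝ), HBound α 0 M w →
      HBound α 0 (C * M) (fun x => ∑' j : ℕ, conv (dil j κ) w x) := by
  obtain ⟨K, hK0, hK⟩ := exists_hBound_dyadic_sum (n := n) hα
  have hm : ∀ κ : Pt n → ℝ, 0 ≤ ∫ y, |κ y| * ‖y‖ ^ α := fun κ =>
    integral_nonneg fun _ => by positivity
  set A := (∫ y, |κ y| * ‖y‖ ^ α) with hA
  set B := ∑ l, ∫ y, |pd l κ y| * ‖y‖ ^ α with hB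
  have hA0 : 0 ≤ A := hm κ
  have hB0 : 0 ≤ B := Finset.sum_nonneg fun l _ => hm _
  refine ⟨K * (A + n * B), by positivity, fun M w hw => ?_⟩
  rw [mul_assoc]
  have hM := hw.nonneg
  refine hK _ _ (fun j x => ?_) (fun j x y => ?_)
  · refine (abs_conv_dil_le hα.1 hκ.continuous hc h0 hw j x).trans ?_
    gcongr
    exact le_add_of_nonneg_right (by positivity)
  · have hd : ∀ l z, |pd l (conv (dil j κ) w) z| ≤ B * M * (2 * (2 : ℝ) ^ (-α)) ^ j := by
      intro l z
      rw [pd_conv_dil hκ hc (hw.continuous hα.1), abs_mul, abs_of_nonneg (by positivity), mul_pow]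
      have h1 := abs_conv_dil_le hα.1 (hκ.pd_infty l).continuous (hasCompactSupport_pd hc l)
        (integral_pd_eq_zero (hκ.of_le (by simp)) hc l) hw j z
      have h2 : ∫ y, |pd l κ y| * ‖y‖ ^ α ≤ B :=
        Finset.single_le_sum (f := fun l => ∫ y, |pd l κ y| * ‖y‖ ^ α) (fun l _ => hm _)
          (Finset.mem_univ l)
      calc 2 ^ j * |conv (dil j (pd l κ)) w z|
          ≤ 2 ^ j * ((∫ y, |pd l κ y| * ‖y‖ ^ α) * M * ((2 : ℝ) ^ (-α)) ^ j) := by gcongr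
        _ ≤ 2 ^ j * (B * M * ((2 : ℝ) ^ (-α)) ^ j) := by gcongr
        _ = _ := by ring
    have h1 := Convex.norm_image_sub_le_of_norm_fderiv_le (f := conv (dil j κ) w) (s := univ)
      (x := y) (y := x) (fun z _ => differentiable_conv_dil hκ hc (hw.continuous hα.1) j z)
      (fun z _ => norm_fderiv_le_of_pd (by positivity) fun l => hd l z) convex_univ (mem_univ _)
      (mem_univ _)
    rw [Real.norm_eq_abs, ← dist_eq_norm] at h1
    refine h1.trans ?_
    have h2 : 0 ≤ A * (M * (2 * (2 : ℝ) ^ (-α)) ^ j * dist x y) := by positivity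
    linarith

/-- The dyadic potential gains two derivatives in Hölder spaces. -/
theorem exists_hBound_pot (hα : α ∈ Ioo (0 : ℝ) 1) (hκ : ContDiff ℝ ∞ κ)
    (hc : HasCompactSupport κ) :
    ∃ C : ℝ, 0 ≤ C ∧ ∀ (m : ℕ) (M : ℝ) (w : Pt n → ℝ), HBound α m M w →
      HBound α (m + 2) ((n + 2) ^ m * (C * M)) (pot κ w) := by
  choose D hD0 hD using fun i l => exists_hBound_sum_conv hα ((hκ.pd_infty i).pd_infty l)
    (hasCompactSupport_pd (hasCompactSupport_pd hc i) l)
    (integral_pd_eq_zero ((hκ.pd_infty i).of_le (by simp)) (hasCompactSupport_pd hc i) l)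
  have hg : ∀ (c : ℝ) (κ : Pt n → ℝ), |c| ≤ 1 / 2 → Continuous κ → HasCompactSupport κ →
      ∀ M w, HBound α 0 M w → ∀ x,
        |∑' j : ℕ, c ^ j * conv (dil j κ) w x| ≤ 2 * (∫ y, |κ y|) * M := by
    intro c κ hc1 hκ hc M w hw x
    have hg := hasSum_geometric_of_lt_one (abs_nonneg c) (by linarith)
    have h1 : (1 - |c|)⁻¹ ≤ 2 := by
      rw [inv_le_comm₀ (by linarith) (by norm_num)]; linarith
    have h2 : 0 ≤ (∫ y, |κ y|) * M := mul_nonneg (integral_nonneg fun _ => abs_nonneg _) hw.nonneg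
    calc |∑' j : ℕ, c ^ j * conv (dil j κ) w x| ≤ (1 - |c|)⁻¹ * ((∫ y, |κ y|) * M) := by
          rw [← Real.norm_eq_abs]
          exact tsum_of_norm_bounded (hg.mul_right _)
            fun j => abs_pot_term_le hκ hc hw c j x
      _ ≤ 2 * ((∫ y, |κ y|) * M) := by gcongr
      _ = _ := by ring
  have hI : ∀ κ : Pt n → ℝ, 0 ≤ ∫ y, |κ y| := fun κ => integral_nonneg fun _ => abs_nonneg _
  set A := 2 * ∫ y, |κ y| with hA
  set B := ∑ i, 2 * ∫ y, |pd i κ y| with hB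
  set E := ∑ i, ∑ l, D i l with hE
  have hA0 : 0 ≤ A := by have := hI κ; positivity
  have hB0 : 0 ≤ B := Finset.sum_nonneg fun i _ => by have := hI (pd i κ); positivity
  have hE0 : 0 ≤ E := Finset.sum_nonneg fun i _ => Finset.sum_nonneg fun l _ => hD0 i l
  refine ⟨A + B + E, by positivity, fun m M w hw => ?_⟩
  induction m generalizing M w with
  | zero =>
    have hM := hw.nonneg
    have hMA : 0 ≤ A * M := by positivity
    have hMB : 0 ≤ B * M := by positivity
    have hME : 0 ≤ E * M := by positivity
    refine ⟨⟨(pd_pot hα.1 hκ hc hw).1, fun x => ?_⟩, fun i =>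
      ⟨⟨(pd_pd_pot hα hκ hc hw i).1, fun x => ?_⟩, fun l => ?_⟩⟩
    · refine (hg (1 / 4) κ (by norm_num [abs_of_pos]) hκ.continuous hc M w hw x).trans ?_
      simp only [pow_zero, one_mul]
      linarith
    · rw [(pd_pot hα.1 hκ hc hw).2 i]
      refine (hg (1 / 2) _ (by norm_num [abs_of_pos]) (hκ.pd_infty i).continuous
        (hasCompactSupport_pd hc i) M w hw x).trans ?_
      have : 2 * (∫ y, |pd i κ y|) * M ≤ B * M := by
        gcongr
        exact Finset.single_le_sum (f := fun i => 2 * ∫ y, |pd i κ y|)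
          (fun i _ => by have := hI (pd i κ); positivity) (Finset.mem_univ i)
      simp only [pow_zero, one_mul]
      linarith
    · rw [(pd_pd_pot hα hκ hc hw i).2 l]
      refine (hD i l M w hw).mono ?_
      have : D i l ≤ E := (Finset.single_le_sum (f := fun l => D i l) (fun l _ => hD0 i l)
        (Finset.mem_univ l)).trans (Finset.single_le_sum (f := fun i => ∑ l, D i l)
          (fun i _ => Finset.sum_nonneg fun l _ => hD0 i l) (Finset.mem_univ i))
      have : D i l * M ≤ E * M := by gcongr
      simp only [pow_zero, one_mul]
      linarith
  | succ m ih =>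
    have hM := hw.nonneg
    have hn : (0 : ℝ) ≤ n := n.cast_nonneg
    have h1 := ih _ _ (hw.of_succ hα)
    have hpd : ∀ i, pd i (pot κ w) = pot κ (pd i w) := by
      intro i
      have hw0 : ∃ M', HBound α 0 M' w := by
        clear ih h1
        have : ∀ (m : ℕ) (M : ℝ), HBound α m M w → ∃ M', HBound α 0 M' w := by
          intro m
          induction m with
          | zero => exact fun M h => ⟨M, h⟩
          | succ m ih => exact fun M h => ih _ (h.of_succ hα)
        exact this _ _ hw
      obtain ⟨M', hw0⟩ := hw0
      funext x
      rw [(pd_pot hα.1 hκ hc hw0).2 i]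
      refine tsum_congr fun j => ?_
      have h2 := congrFun (conv_pd ((contDiff_dil j hκ).of_le (by simp))
        (hasCompactSupport_dil j hc) ((hw.contDiff hα.1).of_le (by simp)) i) x
      rw [← h2, ← (pd_conv ((contDiff_dil j hκ).of_le (by simp)) (hasCompactSupport_dil j hc)
        (hw.continuous hα.1)).2 i, pd_conv_dil hκ hc (hw.continuous hα.1), ← mul_assoc, ← mul_pow]
      norm_num
    have hc2 : (n + 2 : ℝ) ^ m * ((A + B + E) * M) ≤ (n + 2) ^ (m + 1) * ((A + B + E) * M) := by
      gcongr
      · linarith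
      · omega
    refine ⟨⟨h1.differentiable, fun x => (h1.bound x).trans (le_of_eq (by ring))⟩, fun i => ?_⟩
    rw [hpd i]
    exact (ih _ _ (hw.pd_bound i)).mono hc2

end DyadicPotential

variable {n : ℕ} {α : ℝ}

section LocalHolder

variable {E F G : Type*} [NormedAddCommGroup E] [NormedAddCommGroup F] [NormedAddCommGroup G]

/-- Local Hölder continuity near the points of an open set. -/
def LocHolder (α : ℝ) (U : Set E) (f : E → F) : Prop :=
  ∀ x ∈ U, ∃ C : ℝ, ∃ t ∈ 𝓝 x, ∀ y ∈ t, ∀ z ∈ t, ‖f y - f z‖ ≤ C * dist y z ^ α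

lemma locHolder_iff (hα : 0 < α) {U : Set E} (hU : IsOpen U) {f : E → F} :
    (∀ x ∈ U, ∃ C : NNReal, ∃ t ∈ 𝓝[U] x, HolderOnWith C (Real.toNNReal α) f t) ↔
      LocHolder α U f := by
  refine forall₂_congr fun x hx => ?_
  rw [hU.nhdsWithin_eq hx]
  constructor
  · rintro ⟨C, t, ht, h⟩
    refine ⟨C, t, ht, fun y hy z hz => ?_⟩
    have := h.dist_le hy hz
    rwa [dist_eq_norm, Real.coe_toNNReal _ hα.le] at this
  · rintro ⟨C, t, ht, h⟩
    refine ⟨C.toNNReal, t, ht, fun y hy z hz => ?_⟩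
    rw [edist_nndist, edist_nndist, ← ENNReal.coe_rpow_of_nonneg _ (NNReal.coe_nonneg _),
      ← ENNReal.coe_mul, ENNReal.coe_le_coe, ← NNReal.coe_le_coe]
    push_cast
    rw [dist_eq_norm, Real.coe_toNNReal _ hα.le]
    refine (h y hy z hz).trans ?_
    gcongr
    exact Real.le_coe_toNNReal C

lemma LocHolder.of_norm_le {U : Set E} (hU : IsOpen U) {f : E → F} {g : E → G} {K : ℝ}
    (hf : LocHolder α U f) (hK : 0 ≤ K)
    (h : ∀ y ∈ U, ∀ z ∈ U, ‖g y - g z‖ ≤ K * ‖f y - f z‖) : LocHolder α U g := by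
  intro x hx
  obtain ⟨C, t, ht, hC⟩ := hf x hx
  refine ⟨K * C, t ∩ U, Filter.inter_mem ht (hU.mem_nhds hx), fun y hy z hz => ?_⟩
  refine (h y hy.2 z hz.2).trans ?_
  rw [mul_assoc]
  exact mul_le_mul_of_nonneg_left (hC y hy.1 z hz.1) hK

lemma LocHolder.add {U : Set E} {f g : E → F} (hf : LocHolder α U f) (hg : LocHolder α U g) :
    LocHolder α U (fun x => f x + g x) := by
  intro x hx
  obtain ⟨C, t, ht, hC⟩ := hf x hx
  obtain ⟨D, u, hu, hD⟩ := hg x hx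
  refine ⟨C + D, t ∩ u, Filter.inter_mem ht hu, fun y hy z hz => ?_⟩
  rw [add_sub_add_comm, add_mul]
  exact (norm_add_le _ _).trans (add_le_add (hC y hy.1 z hz.1) (hD y hy.2 z hz.2))

lemma LocHolder.congr_on {U : Set E} (hU : IsOpen U) {f g : E → F} (hf : LocHolder α U f)
    (h : EqOn g f U) : LocHolder α U g :=
  hf.of_norm_le hU zero_le_one fun y hy z hz => by rw [h hy, h hz, one_mul]

variable [NormedSpace ℝ E] [NormedSpace ℝ F] [NormedSpace ℝ G]

/-- `C^{k+α}` regularity on an open set for maps with values in a normed space. -/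
def VHolderOn (k : ℕ) (α : ℝ) (U : Set E) (f : E → F) : Prop :=
  ContDiffOn ℝ k f U ∧ LocHolder α U (iteratedFDerivWithin ℝ k f U)

lemma vHolderOn_zero {U : Set E} (hU : IsOpen U) {f : E → F} :
    VHolderOn 0 α U f ↔ ContinuousOn f U ∧ LocHolder α U f := by
  have key : ∀ y z, ‖iteratedFDerivWithin ℝ 0 f U y - iteratedFDerivWithin ℝ 0 f U z‖
      = ‖f y - f z‖ := fun y z => by
    rw [iteratedFDerivWithin_zero_eq_comp, Function.comp_apply, Function.comp_apply, ← map_sub,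
      LinearIsometryEquiv.norm_map]
  rw [VHolderOn]
  refine and_congr (by rw [Nat.cast_zero, contDiffOn_zero]) ⟨fun h => ?_, fun h => ?_⟩
  · exact h.of_norm_le hU zero_le_one fun y _ z _ => by rw [one_mul, key]
  · exact h.of_norm_le hU zero_le_one fun y _ z _ => by rw [one_mul, key]

lemma vHolderOn_succ {U : Set E} (hU : IsOpen U) {k : ℕ} {f : E → F} :
    VHolderOn (k + 1) α U f ↔ DifferentiableOn ℝ f U ∧ VHolderOn k α U (fderiv ℝ f) := by
  have heq : EqOn (fderivWithin ℝ f U) (fderiv ℝ f) U := fun y hy => fderivWithin_of_isOpen hU hy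
  have key : ∀ y ∈ U, ∀ z ∈ U,
      ‖iteratedFDerivWithin ℝ (k + 1) f U y - iteratedFDerivWithin ℝ (k + 1) f U z‖
      = ‖iteratedFDerivWithin ℝ k (fderiv ℝ f) U y
        - iteratedFDerivWithin ℝ k (fderiv ℝ f) U z‖ := fun y hy z hz => by
    rw [iteratedFDerivWithin_succ_eq_comp_right hU.uniqueDiffOn hy,
      iteratedFDerivWithin_succ_eq_comp_right hU.uniqueDiffOn hz, Function.comp_apply,
      Function.comp_apply, ← dist_eq_norm, ← dist_eq_norm]
    refine ((continuousMultilinearCurryRightEquiv' ℝ k E F).symm.dist_map _ _).trans ?_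
    rw [iteratedFDerivWithin_congr heq hy, iteratedFDerivWithin_congr heq hz]
  rw [VHolderOn, VHolderOn, ← and_assoc]
  refine and_congr ?_ ⟨fun h => ?_, fun h => ?_⟩
  · rw [Nat.cast_add, Nat.cast_one, contDiffOn_succ_iff_fderiv_of_isOpen hU]
    simp
  · exact h.of_norm_le hU zero_le_one fun y hy z hz => by rw [one_mul, key y hy z hz]
  · exact h.of_norm_le hU zero_le_one fun y hy z hz => by rw [one_mul, key y hy z hz]

lemma VHolderOn.clm_comp {U : Set E} (hU : IsOpen U) {k : ℕ} {f : E → F} (L : F →L[ℝ] G)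
    (hf : VHolderOn k α U f) : VHolderOn k α U (fun x => L (f x)) := by
  refine ⟨L.contDiff.comp_contDiffOn hf.1, hf.2.of_norm_le hU (norm_nonneg L)
    fun y hy z hz => ?_⟩
  have h : ∀ y ∈ U, iteratedFDerivWithin ℝ k (fun x => L (f x)) U y
      = L.compContinuousMultilinearMap (iteratedFDerivWithin ℝ k f U y) := fun y hy =>
    L.iteratedFDerivWithin_comp_left (hf.1 y hy) hU.uniqueDiffOn hy le_rfl
  rw [h y hy, h z hz]
  have : L.compContinuousMultilinearMap (iteratedFDerivWithin ℝ k f U y)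
      - L.compContinuousMultilinearMap (iteratedFDerivWithin ℝ k f U z)
      = L.compContinuousMultilinearMap (iteratedFDerivWithin ℝ k f U y
        - iteratedFDerivWithin ℝ k f U z) := by
    ext m; simp
  rw [this]
  exact L.norm_compContinuousMultilinearMap_le _

lemma VHolderOn.add {U : Set E} (hU : IsOpen U) {k : ℕ} {f g : E → F} (hf : VHolderOn k α U f)
    (hg : VHolderOn k α U g) : VHolderOn k α U (fun x => f x + g x) :=
  ⟨hf.1.add hg.1, (hf.2.add hg.2).congr_on hU fun y hy =>
    iteratedFDerivWithin_add_apply (hf.1 y hy) (hg.1 y hy) hU.uniqueDiffOn hy⟩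

lemma VHolderOn.congr {U : Set E} (hU : IsOpen U) {k : ℕ} {f g : E → F} (hf : VHolderOn k α U f)
    (h : EqOn g f U) : VHolderOn k α U g :=
  ⟨hf.1.congr h, hf.2.congr_on hU fun _ hy => iteratedFDerivWithin_congr h hy k⟩

lemma VHolderOn.zero {U : Set E} {k : ℕ} : VHolderOn k α U (fun _ : E => (0 : F)) :=
  ⟨contDiffOn_const, fun x _ => ⟨0, univ, Filter.univ_mem, fun y _ z _ => by
    have : iteratedFDerivWithin ℝ k (fun _ : E => (0 : F)) U = 0 := iteratedFDerivWithin_fun_zero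
    simp [this]⟩⟩

lemma VHolderOn.sum {ι : Type*} (s : Finset ι) {U : Set E} (hU : IsOpen U) {k : ℕ}
    {f : ι → E → F} (hf : ∀ i ∈ s, VHolderOn k α U (f i)) :
    VHolderOn k α U (fun x => ∑ i ∈ s, f i x) := by
  classical
  induction s using Finset.induction_on with
  | empty => simpa using VHolderOn.zero
  | insert a s ha ih =>
    simp_rw [Finset.sum_insert ha]
    exact (hf a (by simp)).add hU (ih fun i hi => hf i (by simp [hi]))

end LocalHolder

lemma cHolderOn_iff_vHolderOn (hα : 0 < α) {U : Set (Pt n)} (hU : IsOpen U) {k : ℕ}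
    {f : Pt n → ℝ} : CHolderOn k α U f ↔ VHolderOn k α U f := by
  rw [CHolderOn, VHolderOn, locHolder_iff hα hU]

section HolderCalculus

lemma LocHolder.continuousOn {E : Type*} [NormedAddCommGroup E] (hα : 0 < α) {U : Set E}
    {f : E → ℝ} (hf : LocHolder α U f) : ContinuousOn f U := by
  intro x hx
  obtain ⟨C, t, ht, h⟩ := hf x hx
  apply ContinuousAt.continuousWithinAt
  rw [ContinuousAt, tendsto_iff_dist_tendsto_zero]
  have hlim : Filter.Tendsto (fun y => C * dist y x ^ α) (𝓝 x) (𝓝 0) := by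
    have : ContinuousAt (fun y => C * dist y x ^ α) x := by
      refine continuousAt_const.mul ((continuousAt_id.dist continuousAt_const).rpow_const (.inr hα.le))
    simpa [ContinuousAt, Real.zero_rpow hα.ne'] using this
  refine squeeze_zero' (.of_forall fun _ => dist_nonneg) ?_ hlim
  filter_upwards [ht] with y hy
  exact h y hy x (mem_of_mem_nhds ht)

lemma LocHolder.of_lipschitz {E : Type*} [NormedAddCommGroup E] (hα : α ∈ Ioo (0 : ℝ) 1)
    {U : Set E} {f : E → ℝ} (hf : ∀ x ∈ U, ∃ C : ℝ, 0 ≤ C ∧ ∃ t ∈ 𝓝 x, ∀ y ∈ t, ∀ z ∈ t,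
      |f y - f z| ≤ C * dist y z) : LocHolder α U f := by
  intro x hx
  obtain ⟨C, hC0, t, ht, h⟩ := hf x hx
  refine ⟨C, t ∩ Metric.ball x (1 / 2), Filter.inter_mem ht (Metric.ball_mem_nhds x (by norm_num)),
    fun y hy z hz => (h y hy.1 z hz.1).trans ?_⟩
  have hd : dist y z ≤ 1 := by
    have h1 := Metric.mem_ball.1 hy.2
    have h2 := Metric.mem_ball'.1 hz.2
    linarith [dist_triangle y x z]
  gcongr
  calc dist y z = dist y z ^ (1 : ℝ) := (Real.rpow_one _).symm
    _ ≤ dist y z ^ α := by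
      rcases (dist_nonneg (x := y) (y := z)).eq_or_lt with h0 | h0
      · rw [← h0, Real.zero_rpow hα.1.ne', Real.zero_rpow one_ne_zero]
      · exact Real.rpow_le_rpow_of_exponent_ge h0 hd hα.2.le

variable {U V W : Set (Pt n)} {k : ℕ} {f g : Pt n → ℝ}

lemma cHolderOn_zero (hα : 0 < α) (hU : IsOpen U) : CHolderOn 0 α U f ↔ LocHolder α U f := by
  rw [cHolderOn_iff_vHolderOn hα hU, vHolderOn_zero hU]
  exact ⟨fun h => h.2, fun h => ⟨h.continuousOn hα, h⟩⟩

lemma cHolderOn_succ (hα : 0 < α) (hU : IsOpen U) :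
    CHolderOn (k + 1) α U f ↔ DifferentiableOn ℝ f U ∧ ∀ i, CHolderOn k α U (pd i f) := by
  simp_rw [cHolderOn_iff_vHolderOn hα hU]
  rw [vHolderOn_succ hU]
  refine and_congr_right fun hd => ⟨fun h i => ?_, fun h => ?_⟩
  · exact h.clm_comp hU (ContinuousLinearMap.apply ℝ ℝ (Pi.single i (1 : ℝ)))
  · have h1 : VHolderOn k α U fun x => ∑ i, pd i f x •
        ContinuousLinearMap.proj (R := ℝ) (φ := fun _ : Fin n => ℝ) i :=
      VHolderOn.sum _ hU fun i _ => (h i).clm_comp hU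
        ((ContinuousLinearMap.id ℝ ℝ).smulRight
          (ContinuousLinearMap.proj (R := ℝ) (φ := fun _ : Fin n => ℝ) i))
    exact h1.congr hU fun x hx => (hasFDerivAt_pd_sum
      (hd.differentiableAt (hU.mem_nhds hx))).fderiv

lemma _root_.CHolderOn.congr (hα : 0 < α) (hU : IsOpen U) (hf : CHolderOn k α U f) (h : EqOn g f U) :
    CHolderOn k α U g :=
  (cHolderOn_iff_vHolderOn hα hU).2 (((cHolderOn_iff_vHolderOn hα hU).1 hf).congr hU h)

lemma _root_.CHolderOn.mono (hα : 0 < α) (hU : IsOpen U) (hV : IsOpen V) (hf : CHolderOn k α U f)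
    (hVU : V ⊆ U) : CHolderOn k α V f := by
  induction k generalizing f with
  | zero =>
    rw [cHolderOn_zero hα hU] at hf
    exact (cHolderOn_zero hα hV).2 fun x hx => hf x (hVU hx)
  | succ k ih =>
    rw [cHolderOn_succ hα hU] at hf
    exact (cHolderOn_succ hα hV).2 ⟨hf.1.mono hVU, fun i => ih (hf.2 i)⟩

lemma _root_.CHolderOn.differentiableAt (hU : IsOpen U) (hf : CHolderOn (k + 1) α U f) {x : Pt n}
    (hx : x ∈ U) : DifferentiableAt ℝ f x :=
  ((hf.1.contDiffAt (hU.mem_nhds hx)).differentiableAt (by simp))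

lemma _root_.CHolderOn.partialDeriv (hα : 0 < α) (hU : IsOpen U) (hf : CHolderOn (k + 1) α U f) (i : Fin n) :
    CHolderOn k α U (pd i f) := ((cHolderOn_succ hα hU).1 hf).2 i

lemma contDiffAt_lipschitz {E : Type*} [NormedAddCommGroup E] [NormedSpace ℝ E] {f : E → ℝ} {x : E}
    (hf : ContDiffAt ℝ 1 f x) : ∃ C : ℝ, 0 ≤ C ∧ ∃ t ∈ 𝓝 x, ∀ y ∈ t, ∀ z ∈ t,
      |f y - f z| ≤ C * dist y z := by
  obtain ⟨K, t, ht, h⟩ := hf.exists_lipschitzOnWith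
  exact ⟨K, K.2, t, ht, fun y hy z hz => by simpa [Real.dist_eq] using h.dist_le_mul y hy z hz⟩

lemma _root_.CHolderOn.of_contDiffOn (hα : α ∈ Ioo (0 : ℝ) 1) (hU : IsOpen U)
    (hf : ContDiffOn ℝ (k + 1 : ℕ) f U) : CHolderOn k α U f := by
  induction k generalizing f with
  | zero =>
    exact (cHolderOn_zero hα.1 hU).2 (.of_lipschitz hα fun x hx =>
      contDiffAt_lipschitz (by simpa using hf.contDiffAt (hU.mem_nhds hx)))
  | succ k ih =>
    rw [Nat.cast_add, Nat.cast_one, contDiffOn_succ_iff_fderiv_of_isOpen hU] at hf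
    exact (cHolderOn_succ hα.1 hU).2 ⟨hf.1, fun i => ih (hf.2.2.clm_apply contDiffOn_const)⟩

lemma _root_.CHolderOn.of_succ (hα : α ∈ Ioo (0 : ℝ) 1) (hU : IsOpen U) (hf : CHolderOn (k + 1) α U f) :
    CHolderOn k α U f := .of_contDiffOn hα hU hf.1

lemma _root_.CHolderOn.of_le (hα : α ∈ Ioo (0 : ℝ) 1) (hU : IsOpen U) (hf : CHolderOn k α U f) {j : ℕ}
    (hj : j ≤ k) : CHolderOn j α U f := by
  induction k, hj using Nat.le_induction with
  | base => exact hf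
  | succ m _ ih => exact ih (hf.of_succ hα hU)

lemma _root_.CHolderOn.of_contDiff (hα : α ∈ Ioo (0 : ℝ) 1) (hU : IsOpen U) (hf : ContDiff ℝ ∞ f) :
    CHolderOn k α U f := .of_contDiffOn hα hU (hf.contDiffOn.of_le (by exact_mod_cast le_top))

lemma _root_.CHolderOn.const (hα : α ∈ Ioo (0 : ℝ) 1) (hU : IsOpen U) (c : ℝ) :
    CHolderOn k α U (fun _ => c) := .of_contDiff hα hU contDiff_const

lemma _root_.CHolderOn.add (hα : 0 < α) (hU : IsOpen U) (hf : CHolderOn k α U f)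
    (hg : CHolderOn k α U g) : CHolderOn k α U (fun x => f x + g x) := by
  rw [cHolderOn_iff_vHolderOn hα hU] at *
  exact hf.add hU hg

lemma _root_.CHolderOn.const_mul (hα : 0 < α) (hU : IsOpen U) (hf : CHolderOn k α U f) (c : ℝ) :
    CHolderOn k α U (fun x => c * f x) := by
  rw [cHolderOn_iff_vHolderOn hα hU] at *
  exact hf.clm_comp hU (ContinuousLinearMap.mul ℝ ℝ c)

lemma _root_.CHolderOn.sub (hα : 0 < α) (hU : IsOpen U) (hf : CHolderOn k α U f)
    (hg : CHolderOn k α U g) : CHolderOn k α U (fun x => f x - g x) := by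
  have := hf.add hα hU (hg.const_mul hα hU (-1))
  simpa [sub_eq_add_neg] using this

lemma _root_.CHolderOn.sum {ι : Type*} {s : Finset ι} {f : ι → Pt n → ℝ} (hα : 0 < α)
    (hU : IsOpen U) (hf : ∀ i ∈ s, CHolderOn k α U (f i)) :
    CHolderOn k α U (fun x => ∑ i ∈ s, f i x) := by
  simp_rw [cHolderOn_iff_vHolderOn hα hU] at *
  exact VHolderOn.sum s hU hf

lemma LocHolder.mul (hα : 0 < α) (hU : IsOpen U) (hf : LocHolder α U f) (hg : LocHolder α U g) :
    LocHolder α U (fun x => f x * g x) := by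
  intro x hx
  obtain ⟨C, t, ht, hC⟩ := hf x hx
  obtain ⟨D, u, hu, hD⟩ := hg x hx
  have hb : ∀ {h : Pt n → ℝ}, LocHolder α U h → ∀ᶠ y in 𝓝 x, |h y| < |h x| + 1 := fun hh =>
    (((hh.continuousOn hα).continuousAt (hU.mem_nhds hx)).abs).eventually_lt continuousAt_const
      (lt_add_one _)
  refine ⟨(|f x| + 1) * D + C * (|g x| + 1), _, Filter.inter_mem (Filter.inter_mem ht hu)
    (Filter.inter_mem (hb hf) (hb hg)), ?_⟩
  rintro y ⟨⟨hy1, hy2⟩, hy3, hy4⟩ z ⟨⟨hz1, hz2⟩, hz3, hz4⟩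
  have h1 := hC y hy1 z hz1
  have h2 := hD y hy2 z hz2
  rw [Real.norm_eq_abs] at *
  calc |f y * g y - f z * g z| = |f y * (g y - g z) + (f y - f z) * g z| := by ring_nf
    _ ≤ |f y| * |g y - g z| + |f y - f z| * |g z| := by
      rw [← abs_mul, ← abs_mul]; exact abs_add_le _ _
    _ ≤ (|f x| + 1) * (D * dist y z ^ α) + (C * dist y z ^ α) * (|g x| + 1) := by
      have := (mem_ofPred.1 hy3).le
      have := (mem_ofPred.1 hz4).le
      gcongr
      exact (abs_nonneg _).trans h1
    _ = _ := by ring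

lemma _root_.CHolderOn.mul (hα : α ∈ Ioo (0 : ℝ) 1) (hU : IsOpen U) (hf : CHolderOn k α U f)
    (hg : CHolderOn k α U g) : CHolderOn k α U (fun x => f x * g x) := by
  induction k generalizing f g with
  | zero =>
    rw [cHolderOn_zero hα.1 hU] at *
    exact hf.mul hα.1 hU hg
  | succ k ih =>
    have hd : ∀ {h}, CHolderOn (k + 1) α U h → DifferentiableOn ℝ h U := fun hh =>
      ((cHolderOn_succ hα.1 hU).1 hh).1
    refine (cHolderOn_succ hα.1 hU).2 ⟨(hd hf).mul (hd hg), fun i => ?_⟩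
    have := (ih (hf.partialDeriv hα.1 hU i) (hg.of_succ hα hU)).add hα.1 hU
      (ih (hf.of_succ hα hU) (hg.partialDeriv hα.1 hU i))
    exact this.congr hα.1 hU fun x hx =>
      pd_mul (hf.differentiableAt hU hx) (hg.differentiableAt hU hx) i

lemma _root_.CHolderOn.prod {ι : Type*} {s : Finset ι} {f : ι → Pt n → ℝ} (hα : α ∈ Ioo (0 : ℝ) 1)
    (hU : IsOpen U) (hf : ∀ i ∈ s, CHolderOn k α U (f i)) :
    CHolderOn k α U (fun x => ∏ i ∈ s, f i x) := by
  classical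
  induction s using Finset.induction_on with
  | empty => simpa using CHolderOn.const hα hU 1
  | insert a s ha ih =>
    simp_rw [Finset.prod_insert ha]
    exact (hf a (by simp)).mul hα hU (ih fun i hi => hf i (by simp [hi]))

/-- Composition with a smooth function of one variable. -/
lemma _root_.CHolderOn.comp_real (hα : α ∈ Ioo (0 : ℝ) 1) (hU : IsOpen U) {S : Set ℝ} (hS : IsOpen S)
    {φ : ℝ → ℝ} (hφ : ContDiffOn ℝ ∞ φ S) (hf : CHolderOn k α U f) (hm : MapsTo f U S) :
    CHolderOn k α U (fun x => φ (f x)) := by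
  induction k generalizing φ f with
  | zero =>
    rw [cHolderOn_zero hα.1 hU] at *
    intro x hx
    obtain ⟨C, t, ht, hC⟩ := hf x hx
    obtain ⟨D, hD0, u, hu, hD⟩ := contDiffAt_lipschitz
      ((hφ.contDiffAt (hS.mem_nhds (hm hx))).of_le (by simp))
    have hc := (hf.continuousOn hα.1).continuousAt (hU.mem_nhds hx)
    refine ⟨D * C, t ∩ f ⁻¹' u, Filter.inter_mem ht (hc hu), fun y hy z hz => ?_⟩
    rw [mul_assoc]
    exact (hD _ hy.2 _ hz.2).trans (mul_le_mul_of_nonneg_left (hC y hy.1 z hz.1) hD0)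
  | succ k ih =>
    have hdφ : ∀ x ∈ U, DifferentiableAt ℝ φ (f x) := fun x hx =>
      (hφ.contDiffAt (hS.mem_nhds (hm hx))).differentiableAt (by simp)
    refine (cHolderOn_succ hα.1 hU).2 ⟨fun x hx => ((hdφ x hx).comp x
      (hf.differentiableAt hU hx)).differentiableWithinAt, fun i => ?_⟩
    have := (ih (hφ.deriv_of_isOpen hS (by simp)) (hf.of_succ hα hU) hm).mul hα hU
      (hf.partialDeriv hα.1 hU i)
    exact this.congr hα.1 hU fun x hx => pd_comp (hdφ x hx) (hf.differentiableAt hU hx) i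

lemma _root_.CHolderOn.inv (hα : α ∈ Ioo (0 : ℝ) 1) (hU : IsOpen U) (hf : CHolderOn k α U f)
    (h0 : ∀ x ∈ U, f x ≠ 0) : CHolderOn k α U (fun x => (f x)⁻¹) :=
  hf.comp_real hα hU isOpen_compl_singleton (φ := fun y => y⁻¹) (contDiffOn_inv ℝ) h0

lemma _root_.CHolderOn.sqrt (hα : α ∈ Ioo (0 : ℝ) 1) (hU : IsOpen U) (hf : CHolderOn k α U f)
    (h0 : ∀ x ∈ U, 0 < f x) : CHolderOn k α U (fun x => √(f x)) :=
  hf.comp_real hα hU isOpen_Ioi (S := Ioi 0)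
    (fun _ hx => (Real.contDiffAt_sqrt (ne_of_gt hx)).contDiffWithinAt) h0

lemma _root_.CHolderOn.det (hα : α ∈ Ioo (0 : ℝ) 1) (hU : IsOpen U) {m : ℕ}
    {A : Pt n → Matrix (Fin m) (Fin m) ℝ} (hA : ∀ i j, CHolderOn k α U fun x => A x i j) :
    CHolderOn k α U (fun x => (A x).det) := by
  simp_rw [Matrix.det_apply']
  exact .sum hα.1 hU fun σ _ => (CHolderOn.prod hα hU fun i _ => hA _ _).const_mul hα.1 hU _

lemma _root_.CHolderOn.matrix_inv (hα : α ∈ Ioo (0 : ℝ) 1) (hU : IsOpen U) {m : ℕ}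
    {A : Pt n → Matrix (Fin m) (Fin m) ℝ} (hA : ∀ i j, CHolderOn k α U fun x => A x i j)
    (h0 : ∀ x ∈ U, (A x).det ≠ 0) (i j : Fin m) : CHolderOn k α U (fun x => (A x)⁻¹ i j) := by
  simp_rw [Matrix.inv_def, Ring.inverse_eq_inv', Matrix.smul_apply, Matrix.adjugate_apply,
    smul_eq_mul]
  refine ((CHolderOn.det hα hU hA).inv hα hU h0).mul hα hU (.det hα hU fun a b => ?_)
  rcases eq_or_ne a j with rfl | h
  · simpa [Matrix.updateRow_self] using CHolderOn.const hα hU _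
  · simpa [Matrix.updateRow_ne h] using hA a b

/-- Composition with a map of class `C^1` and of the same Hölder class. -/
lemma _root_.CHolderOn.comp (hα : α ∈ Ioo (0 : ℝ) 1) (hU : IsOpen U) (hW : IsOpen W) {Z : Pt n → Pt n}
    (hf : CHolderOn k α W f) (hZ : ∀ i, CHolderOn k α U fun x => Z x i) (hZ1 : ContDiffOn ℝ 1 Z U)
    (hm : MapsTo Z U W) : CHolderOn k α U (fun x => f (Z x)) := by
  induction k generalizing f with
  | zero =>
    rw [cHolderOn_zero hα.1 hW] at hf
    refine (cHolderOn_zero hα.1 hU).2 fun x hx => ?_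
    obtain ⟨C, t, ht, hC⟩ := hf (Z x) (hm hx)
    obtain ⟨K, u, hu, hK⟩ := (hZ1.contDiffAt (hU.mem_nhds hx)).exists_lipschitzOnWith
    have hc := (hZ1.continuousOn.continuousAt (hU.mem_nhds hx)) ht
    refine ⟨max C 0 * K ^ α, u ∩ Z ⁻¹' t, Filter.inter_mem hu hc, fun y hy z hz => ?_⟩
    rw [mul_assoc, ← Real.mul_rpow K.coe_nonneg dist_nonneg]
    calc ‖f (Z y) - f (Z z)‖ ≤ C * dist (Z y) (Z z) ^ α := hC _ hy.2 _ hz.2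
      _ ≤ max C 0 * dist (Z y) (Z z) ^ α := by gcongr; exact le_max_left _ _
      _ ≤ _ := by
        gcongr
        · exact hα.1.le
        · exact hK.dist_le_mul y hy.1 z hz.1
  | succ k ih =>
    have hdf : ∀ x ∈ U, DifferentiableAt ℝ f (Z x) := fun x hx => hf.differentiableAt hW (hm hx)
    have hdZ : ∀ x ∈ U, DifferentiableAt ℝ Z x := fun x hx =>
      (hZ1.contDiffAt (hU.mem_nhds hx)).differentiableAt one_ne_zero
    refine (cHolderOn_succ hα.1 hU).2 ⟨fun x hx => ((hdf x hx).comp x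
      (hdZ x hx)).differentiableWithinAt, fun i => ?_⟩
    have := CHolderOn.sum (s := Finset.univ) hα.1 hU fun j _ =>
      (ih (hf.partialDeriv hα.1 hW j) fun l => (hZ l).of_succ hα hU).mul hα hU ((hZ j).partialDeriv hα.1 hU i)
    refine this.congr hα.1 hU fun x hx => ?_
    change fderiv ℝ (f ∘ Z) x (Pi.single i 1) = _
    rw [fderiv_comp x (hdf x hx) (hdZ x hx), ContinuousLinearMap.comp_apply,
      fderiv_apply_eq_sum_pd]
    refine Finset.sum_congr rfl fun j _ => ?_
    rw [mul_comm]
    congr 1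
    have h1 := (hasFDerivAt_pi'.1 (hdZ x hx).hasFDerivAt j).fderiv
    rw [pd, h1]
    rfl

end HolderCalculus

/-- The quadratic form of the matrix `B`. -/
def qf (B : Matrix (Fin n) (Fin n) ℝ) (x : Pt n) : ℝ := ∑ i, x i * ∑ j, B i j * x j

lemma contDiff_qf (B : Matrix (Fin n) (Fin n) ℝ) {m : WithTop ℕ∞} : ContDiff ℝ m (qf B) := by
  unfold qf
  fun_prop

lemma pd_lin (c : Fin n → ℝ) (i : Fin n) (x : Pt n) :
    pd i (fun y : Pt n => ∑ j, c j * y j) x = c i := by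
  rw [pd_sum (fun j _ => by fun_prop)]
  simp [pd_const_mul, pd_coord]

lemma pd_qf {B : Matrix (Fin n) (Fin n) ℝ} (hB : B.IsSymm) (i : Fin n) (x : Pt n) :
    pd i (qf B) x = 2 * ∑ j, B i j * x j := by
  unfold qf
  rw [pd_sum (fun j _ => by fun_prop)]
  have : ∀ k, pd i (fun y : Pt n => y k * ∑ j, B k j * y j) x
      = (if i = k then 1 else 0) * (∑ j, B k j * x j) + x k * B k i := fun k => by
    rw [pd_mul (by fun_prop) (by fun_prop), pd_lin, pd_coord]
  simp_rw [this, Finset.sum_add_distrib]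
  simp only [ite_mul, one_mul, zero_mul, Finset.sum_ite_eq, Finset.mem_univ, if_true]
  rw [two_mul]
  congr 1
  exact Finset.sum_congr rfl fun k _ => by rw [hB.apply, mul_comm]

lemma qf_smul (B : Matrix (Fin n) (Fin n) ℝ) (r : ℝ) (x : Pt n) :
    qf B (r • x) = r ^ 2 * qf B x := by
  simp only [qf, Pi.smul_apply, smul_eq_mul, Finset.mul_sum]
  exact Finset.sum_congr rfl fun i _ => Finset.sum_congr rfl fun j _ => by ring

lemma qf_eq (B : Matrix (Fin n) (Fin n) ℝ) (x : Pt n) : qf B x = x ⬝ᵥ (B *ᵥ x) := rfl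

lemma qf_nonneg {B : Matrix (Fin n) (Fin n) ℝ} (hB : B.PosDef) (x : Pt n) : 0 ≤ qf B x := by
  have := hB.posSemidef.dotProduct_mulVec_nonneg x
  simpa [qf_eq] using this

lemma qf_pos {B : Matrix (Fin n) (Fin n) ℝ} (hB : B.PosDef) {x : Pt n} (hx : x ≠ 0) :
    0 < qf B x := by
  have := hB.dotProduct_mulVec_pos hx
  simpa [qf_eq] using this

lemma exists_norm_le_qf {B : Matrix (Fin n) (Fin n) ℝ} (hB : B.PosDef) :
    ∃ c > 0, ∀ x : Pt n, c * ‖x‖ ^ 2 ≤ qf B x := by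
  rcases (Metric.sphere (0 : Pt n) 1).eq_empty_or_nonempty with he | hne
  · refine ⟨1, one_pos, fun x => ?_⟩
    have : x = 0 := by
      by_contra hx
      have h : ‖x‖⁻¹ • x ∈ Metric.sphere (0 : Pt n) 1 := by
        simp [norm_smul, norm_ne_zero_iff.2 hx]
      simp [he] at h
    subst this
    simpa using qf_nonneg hB 0
  · obtain ⟨z, hz, hmin⟩ := (isCompact_sphere (0 : Pt n) 1).exists_isMinOn hne
      (contDiff_qf B (m := 0)).continuous.continuousOn
    have hz0 : z ≠ 0 := by rintro rfl; simp at hz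
    refine ⟨qf B z, qf_pos hB hz0, fun x => ?_⟩
    rcases eq_or_ne x 0 with rfl | hx
    · simpa using qf_nonneg hB 0
    have h : ‖x‖⁻¹ • x ∈ Metric.sphere (0 : Pt n) 1 := by
      simp [norm_smul, norm_ne_zero_iff.2 hx]
    have h1 : qf B z ≤ qf B (‖x‖⁻¹ • x) := hmin h
    rw [qf_smul] at h1
    have h2 : 0 < ‖x‖ := norm_pos_iff.2 hx
    calc qf B z * ‖x‖ ^ 2 ≤ (‖x‖⁻¹ ^ 2 * qf B x) * ‖x‖ ^ 2 := by gcongr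
      _ = qf B x := by field_simp

lemma hasCompactSupport_comp_qf {B : Matrix (Fin n) (Fin n) ℝ} (hB : B.PosDef) {f : Pt n → ℝ}
    {s : ℝ} (h : ∀ x, s < qf B x → f x = 0) : HasCompactSupport f := by
  obtain ⟨c, hc, hq⟩ := exists_norm_le_qf hB
  refine HasCompactSupport.of_support_subset_isCompact
    (isCompact_closedBall (0 : Pt n) (√(s / c))) fun x hx => ?_
  have h1 : qf B x ≤ s := by
    by_contra h'
    exact hx (h x (not_le.1 h'))
  rw [mem_closedBall_zero_iff]
  apply Real.le_sqrt_of_sq_le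
  rw [le_div_iff₀ hc]
  linarith [hq x]

lemma pd_comp_qf {B : Matrix (Fin n) (Fin n) ℝ} (hB : B.IsSymm) {Θ : ℝ → ℝ}
    (hΘ : Differentiable ℝ Θ) (i : Fin n) :
    pd i (fun x => Θ (qf B x)) = fun x => deriv Θ (qf B x) * (2 * ∑ j, B i j * x j) := by
  ext x
  rw [pd_comp hΘ.differentiableAt ((contDiff_qf B (m := 1)).differentiable one_ne_zero x),
    pd_qf hB]

lemma sum_pd_pd_comp_qf {A : Matrix (Fin n) (Fin n) ℝ} (hA : A.IsSymm) (hd : IsUnit A.det)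
    {Θ : ℝ → ℝ} (hΘ : ContDiff ℝ ∞ Θ) (x : Pt n) :
    ∑ i, ∑ j, A i j * pd i (pd j fun x => Θ (qf A⁻¹ x)) x
      = 4 * qf A⁻¹ x * deriv (deriv Θ) (qf A⁻¹ x) + 2 * n * deriv Θ (qf A⁻¹ x) := by
  have hB : (A⁻¹).IsSymm := by
    rw [Matrix.IsSymm, Matrix.transpose_nonsing_inv, hA.eq]
  have hΘ' : ContDiff ℝ ∞ (deriv Θ) := (contDiff_infty_iff_deriv.1 hΘ).2
  have hdΘ' := hΘ'.differentiable (by simp)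
  set B := A⁻¹ with hBdef
  have hAB : ∀ i k, ∑ j, A i j * B j k = if i = k then 1 else 0 := fun i k => by
    have := congrFun (congrFun (Matrix.mul_nonsing_inv A hd) i) k
    simpa [Matrix.mul_apply, Matrix.one_apply] using this
  have h2 : ∀ i j, pd i (pd j fun x => Θ (qf B x)) x
      = deriv (deriv Θ) (qf B x) * 4 * ((∑ k, B i k * x k) * ∑ k, B j k * x k)
        + 2 * deriv Θ (qf B x) * B j i := fun i j => by
    rw [pd_comp_qf hB (hΘ.differentiable (by simp))]
    have hq : DifferentiableAt ℝ (fun x => deriv Θ (qf B x)) x :=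
      hdΘ'.differentiableAt.comp x ((contDiff_qf B (m := 1)).differentiable one_ne_zero x)
    rw [pd_mul hq (by fun_prop), pd_comp_qf hB hdΘ', pd_const_mul, pd_lin]
    ring
  have hS : ∀ i, ∑ j, A i j * ∑ k, B j k * x k = x i := fun i => by
    simp_rw [Finset.mul_sum]
    rw [Finset.sum_comm]
    simp_rw [← mul_assoc, ← Finset.sum_mul, hAB]
    simp
  calc ∑ i, ∑ j, A i j * pd i (pd j fun x => Θ (qf B x)) x
      = ∑ i, (4 * deriv (deriv Θ) (qf B x) * ((∑ k, B i k * x k) * ∑ j, A i j * ∑ k, B j k * x k)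
          + 2 * deriv Θ (qf B x) * ∑ j, A i j * B j i) := by
        refine Finset.sum_congr rfl fun i _ => ?_
        simp_rw [h2, mul_add, Finset.sum_add_distrib, Finset.mul_sum (s := Finset.univ)
          (f := fun j => A i j * B j i), Finset.mul_sum (s := Finset.univ)
          (f := fun j => A i j * ∑ k, B j k * x k)]
        rw [Finset.mul_sum]
        congr 1 <;> exact Finset.sum_congr rfl fun j _ => by ring
    _ = _ := by
        simp_rw [hS, hAB, Finset.sum_add_distrib, ← Finset.mul_sum]
        simp only [if_true, Finset.sum_const, Finset.card_univ, Fintype.card_fin, nsmul_eq_mul,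
          mul_one, qf]
        have : ∑ i, (∑ k, B i k * x k) * x i = ∑ i, x i * ∑ j, B i j * x j :=
          Finset.sum_congr rfl fun i _ => mul_comm _ _
        rw [this]
        ring

/-- Radial profile agreeing with that of the fundamental solution away from the origin. -/
def profile (n : ℕ) (s : ℝ) : ℝ := Real.smoothTransition (s - 1) * s ^ (1 - (n : ℝ) / 2)

lemma profile_of_le {s : ℝ} (hs : s ≤ 1) : profile n s = 0 := by
  rw [profile, Real.smoothTransition.zero_of_nonpos (by linarith), zero_mul]

lemma profile_of_ge {s : ℝ} (hs : 2 ≤ s) : profile n s = s ^ (1 - (n : ℝ) / 2) := by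
  rw [profile, Real.smoothTransition.one_of_one_le (by linarith), one_mul]

lemma contDiff_profile : ContDiff ℝ ∞ (profile n) := by
  rw [contDiff_iff_contDiffAt]
  intro s
  rcases lt_or_ge s 1 with hs | hs
  · refine contDiffAt_const (c := (0 : ℝ)) |>.congr_of_eventuallyEq ?_
    filter_upwards [gt_mem_nhds hs] with t ht using profile_of_le ht.le
  · exact (Real.smoothTransition.contDiff.comp (contDiff_id.sub contDiff_const)).contDiffAt.mul
      (contDiffAt_id.rpow_const_of_ne (by simp; linarith))

lemma deriv_profile_of_gt {s : ℝ} (hs : 2 < s) :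
    deriv (profile n) s = (1 - (n : ℝ) / 2) * s ^ (-(n : ℝ) / 2) := by
  have h : profile n =ᶠ[𝓝 s] fun t => t ^ (1 - (n : ℝ) / 2) := by
    filter_upwards [lt_mem_nhds hs] with t ht using profile_of_ge ht.le
  rw [h.deriv_eq, Real.deriv_rpow_const]
  ring_nf

lemma deriv_deriv_profile_of_gt {s : ℝ} (hs : 2 < s) :
    deriv (deriv (profile n)) s
      = (1 - (n : ℝ) / 2) * (-(n : ℝ) / 2 * s ^ (-(n : ℝ) / 2 - 1)) := by
  have h : deriv (profile n) =ᶠ[𝓝 s] fun t => (1 - (n : ℝ) / 2) * t ^ (-(n : ℝ) / 2) := by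
    filter_upwards [lt_mem_nhds hs] with t ht using deriv_profile_of_gt ht
  rw [h.deriv_eq, deriv_const_mul_field, Real.deriv_rpow_const]

lemma deriv_profile_of_lt {s : ℝ} (hs : s < 1) : deriv (profile n) s = 0 := by
  have h : profile n =ᶠ[𝓝 s] fun _ => 0 := by
    filter_upwards [gt_mem_nhds hs] with t ht using profile_of_le ht.le
  rw [h.deriv_eq, deriv_const]

lemma deriv_deriv_profile_of_lt {s : ℝ} (hs : s < 1) : deriv (deriv (profile n)) s = 0 := by
  have h : deriv (profile n) =ᶠ[𝓝 s] fun _ => 0 := by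
    filter_upwards [gt_mem_nhds hs] with t ht using deriv_profile_of_lt ht
  rw [h.deriv_eq, deriv_const]

/-- The profile of the constant coefficient operator applied to `profile`. -/
def lapProfile (n : ℕ) (s : ℝ) : ℝ :=
  4 * s * deriv (deriv (profile n)) s + 2 * n * deriv (profile n) s

lemma contDiff_deriv_profile : ContDiff ℝ ∞ (deriv (profile n)) :=
  (contDiff_infty_iff_deriv.1 contDiff_profile).2

lemma contDiff_lapProfile : ContDiff ℝ ∞ (lapProfile n) := by
  have := (contDiff_infty_iff_deriv.1 (contDiff_deriv_profile (n := n))).2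
  have h2 := contDiff_deriv_profile (n := n)
  unfold lapProfile
  fun_prop

lemma lapProfile_of_lt {s : ℝ} (hs : s < 1) : lapProfile n s = 0 := by
  rw [lapProfile, deriv_deriv_profile_of_lt hs, deriv_profile_of_lt hs]; ring

lemma lapProfile_of_gt {s : ℝ} (hs : 2 < s) : lapProfile n s = 0 := by
  rw [lapProfile, deriv_deriv_profile_of_gt hs, deriv_profile_of_gt hs,
    Real.rpow_sub_one (by linarith)]
  field_simp
  ring

lemma profile_four_mul {s : ℝ} (hs : 2 < s) : 2 ^ n / 4 * profile n (4 * s) = profile n s := by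
  rw [profile_of_ge (by linarith), profile_of_ge hs.le,
    Real.mul_rpow (by norm_num) (by linarith), ← mul_assoc]
  have : (2 : ℝ) ^ n / 4 * 4 ^ (1 - (n : ℝ) / 2) = 1 := by
    rw [show (4 : ℝ) = 2 ^ (2 : ℝ) by norm_num, ← Real.rpow_mul (by norm_num), ← Real.rpow_natCast,
      div_mul_eq_mul_div, ← Real.rpow_add (by norm_num)]
    rw [show (n : ℝ) + 2 * (1 - (n : ℝ) / 2) = 2 by ring]
    norm_num
  rw [this, one_mul]

/-- A smooth radial cutoff equal to `1` for `s ≤ 2` and to `0` for `s ≥ 3`. -/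
def cutProfile (s : ℝ) : ℝ := 1 - Real.smoothTransition (s - 2)

lemma contDiff_cutProfile : ContDiff ℝ ∞ cutProfile :=
  contDiff_const.sub (Real.smoothTransition.contDiff.comp (contDiff_id.sub contDiff_const))

lemma cutProfile_of_le {s : ℝ} (hs : s ≤ 2) : cutProfile s = 1 := by
  rw [cutProfile, Real.smoothTransition.zero_of_nonpos (by linarith), sub_zero]

lemma cutProfile_of_ge {s : ℝ} (hs : 3 ≤ s) : cutProfile s = 0 := by
  rw [cutProfile, Real.smoothTransition.one_of_one_le (by linarith), sub_self]

lemma deriv_cutProfile_nonpos (s : ℝ) : deriv cutProfile s ≤ 0 := by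
  have : Antitone cutProfile := fun a b hab =>
    sub_le_sub_left (Real.smoothTransition.monotone (by linarith)) 1
  exact this.deriv_nonpos

lemma deriv_cutProfile_of_le {s : ℝ} (hs : s ≤ 2) : deriv cutProfile s = 0 := by
  refine IsLocalMax.deriv_eq_zero (Filter.Eventually.of_forall fun t => ?_)
  rw [cutProfile_of_le hs]
  exact sub_le_self 1 (Real.smoothTransition.nonneg _)

lemma deriv_cutProfile_of_gt {s : ℝ} (hs : 3 < s) : deriv cutProfile s = 0 := by
  have h : cutProfile =ᶠ[𝓝 s] fun _ => 0 := by
    filter_upwards [lt_mem_nhds hs] with t ht using cutProfile_of_ge ht.le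
  rw [h.deriv_eq, deriv_const]

lemma exists_deriv_cutProfile : ∃ s ∈ Ioo (2 : ℝ) 3, deriv cutProfile s = -1 := by
  obtain ⟨c, hc, h⟩ := exists_deriv_eq_slope cutProfile (by norm_num : (2 : ℝ) < 3)
    contDiff_cutProfile.continuous.continuousOn
    (contDiff_cutProfile.differentiable (by simp)).differentiableOn
  exact ⟨c, hc, by rw [h, cutProfile_of_le le_rfl, cutProfile_of_ge le_rfl]; norm_num⟩

lemma sum_pd_mul_pd_comp_qf {A : Matrix (Fin n) (Fin n) ℝ} (hA : A.IsSymm) (hd : IsUnit A.det)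
    {Θ H : ℝ → ℝ} (hΘ : Differentiable ℝ Θ) (hH : Differentiable ℝ H) (x : Pt n) :
    ∑ i, ∑ j, A i j * (pd i (fun x => H (qf A⁻¹ x)) x * pd j (fun x => Θ (qf A⁻¹ x)) x)
      = 4 * qf A⁻¹ x * deriv Θ (qf A⁻¹ x) * deriv H (qf A⁻¹ x) := by
  have hB : (A⁻¹).IsSymm := by
    rw [Matrix.IsSymm, Matrix.transpose_nonsing_inv, hA.eq]
  have hAB : ∀ i k, ∑ j, A i j * A⁻¹ j k = if i = k then 1 else 0 := fun i k => by
    have := congrFun (congrFun (Matrix.mul_nonsing_inv A hd) i) k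
    simpa [Matrix.mul_apply, Matrix.one_apply] using this
  have hS : ∀ i, ∑ j, A i j * ∑ k, A⁻¹ j k * x k = x i := fun i => by
    simp_rw [Finset.mul_sum]
    rw [Finset.sum_comm]
    simp_rw [← mul_assoc, ← Finset.sum_mul, hAB]
    simp
  rw [show qf A⁻¹ x = ∑ i, x i * ∑ j, A⁻¹ i j * x j from rfl]
  simp_rw [pd_comp_qf hB hΘ, pd_comp_qf hB hH]
  rw [show (∑ i, x i * ∑ j, A⁻¹ i j * x j) = qf A⁻¹ x from rfl]
  calc _ = ∑ i, 4 * deriv Θ (qf A⁻¹ x) * deriv H (qf A⁻¹ x) * ((∑ k, A⁻¹ i k * x k)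
        * ∑ j, A i j * ∑ k, A⁻¹ j k * x k) := by
        refine Finset.sum_congr rfl fun i _ => ?_
        have key : ∀ (P c d : ℝ) (Q : Fin n → ℝ), ∑ j, A i j * (c * (2 * P) * (d * (2 * Q j)))
            = 4 * d * c * (P * ∑ j, A i j * Q j) := fun P c d Q => by
          rw [Finset.mul_sum, Finset.mul_sum]
          exact Finset.sum_congr rfl fun j _ => by ring
        exact key _ _ _ _
    _ = _ := by
        simp_rw [hS, ← Finset.mul_sum]
        have : ∑ i, (∑ k, A⁻¹ i k * x k) * x i = qf A⁻¹ x :=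
          Finset.sum_congr rfl fun i _ => mul_comm _ _
        rw [this]
        ring

lemma integral_pd_mul {f g : Pt n → ℝ} (hf : ContDiff ℝ 1 f) (hc : HasCompactSupport f)
    (hg : ContDiff ℝ 1 g) (i : Fin n) :
    ∫ x, pd i g x * f x = - ∫ x, pd i f x * g x := by
  have hpf : Continuous (pd i f) := (hf.continuous_fderiv one_ne_zero).clm_apply continuous_const
  have hpg : Continuous (pd i g) := (hg.continuous_fderiv one_ne_zero).clm_apply continuous_const
  simp_rw [mul_comm (pd i g _)]
  exact integral_mul_fderiv_eq_neg_fderiv_mul_of_integrable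
    ((hpf.mul hg.continuous).integrable_of_hasCompactSupport (hasCompactSupport_pd hc i).mul_right)
    ((hf.continuous.mul hpg).integrable_of_hasCompactSupport hc.mul_right)
    ((hf.continuous.mul hg.continuous).integrable_of_hasCompactSupport hc.mul_right)
    (fun x _ => hf.differentiable one_ne_zero x) (fun x _ => hg.differentiable one_ne_zero x)

lemma posDef_isSymm {A : Matrix (Fin n) (Fin n) ℝ} (hA : A.PosDef) : A.IsSymm := by
  have := hA.isHermitian.eq
  rwa [Matrix.conjTranspose_eq_transpose_of_trivial] at this

lemma integral_lapProfile_ne_zero (hn : 3 ≤ n) {A : Matrix (Fin n) (Fin n) ℝ} (hA : A.PosDef) :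
    ∫ x, lapProfile n (qf A⁻¹ x) ≠ 0 := by
  have hd : IsUnit A.det := hA.det_pos.ne'.isUnit
  have hB : (A⁻¹).PosDef := hA.inv
  have hAs := posDef_isSymm hA
  have hn' : (3 : ℝ) ≤ n := by exact_mod_cast hn
  have hq : ContDiff ℝ ∞ (qf A⁻¹) := contDiff_qf _
  have hG : ContDiff ℝ ∞ fun x => profile n (qf A⁻¹ x) := contDiff_profile.comp hq
  have hη : ContDiff ℝ ∞ fun x => cutProfile (qf A⁻¹ x) := contDiff_cutProfile.comp hq
  have hηc : HasCompactSupport fun x => cutProfile (qf A⁻¹ x) :=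
    hasCompactSupport_comp_qf hB (s := 3) fun x hx => cutProfile_of_ge hx.le
  set G := fun x => profile n (qf A⁻¹ x)
  set η := fun x => cutProfile (qf A⁻¹ x)
  have hle : ∀ {f : Pt n → ℝ}, ContDiff ℝ ∞ f → ContDiff ℝ 1 f := fun h => h.of_le (by simp)
  have hI1 : ∀ i j, Integrable fun x => A i j * (pd i (pd j G) x * η x) := fun i j =>
    ((((hG.pd_infty j).pd_infty i).continuous.mul hη.continuous).integrable_of_hasCompactSupport
      hηc.mul_left).const_mul _
  have hI2 : ∀ i j, Integrable fun x => A i j * (pd i η x * pd j G x) := fun i j =>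
    (((hη.pd_infty i).continuous.mul (hG.pd_infty j).continuous).integrable_of_hasCompactSupport
      (hasCompactSupport_pd hηc i).mul_right).const_mul _
  have h1 : ∫ x, lapProfile n (qf A⁻¹ x)
      = - ∫ x, 4 * qf A⁻¹ x * deriv (profile n) (qf A⁻¹ x) * deriv cutProfile (qf A⁻¹ x) := by
    calc ∫ x, lapProfile n (qf A⁻¹ x) = ∫ x, ∑ i, ∑ j, A i j * (pd i (pd j G) x * η x) := by
          congr 1 with x
          simp_rw [← mul_assoc, ← Finset.sum_mul]
          rw [sum_pd_pd_comp_qf hAs hd contDiff_profile]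
          change lapProfile n _ = lapProfile n _ * cutProfile _
          rcases le_or_gt (qf A⁻¹ x) 2 with h | h
          · rw [cutProfile_of_le h, mul_one]
          · rw [lapProfile_of_gt h, zero_mul]
      _ = ∑ i, ∑ j, A i j * ∫ x, pd i (pd j G) x * η x := by
          rw [integral_finsetSum _ fun i _ => integrable_finsetSum _ fun j _ => hI1 i j]
          refine Finset.sum_congr rfl fun i _ => ?_
          rw [integral_finsetSum _ fun j _ => hI1 i j]
          exact Finset.sum_congr rfl fun j _ => integral_const_mul _ _
      _ = - ∑ i, ∑ j, A i j * ∫ x, pd i η x * pd j G x := by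
          simp_rw [integral_pd_mul (hle hη) hηc (hle (hG.pd_infty _)), mul_neg,
            Finset.sum_neg_distrib]
      _ = - ∫ x, ∑ i, ∑ j, A i j * (pd i η x * pd j G x) := by
          rw [integral_finsetSum _ fun i _ => integrable_finsetSum _ fun j _ => hI2 i j]
          congr 1
          refine Finset.sum_congr rfl fun i _ => ?_
          rw [integral_finsetSum _ fun j _ => hI2 i j]
          exact Finset.sum_congr rfl fun j _ => (integral_const_mul _ _).symm
      _ = _ := by
          simp_rw [G, η, sum_pd_mul_pd_comp_qf hAs hd (contDiff_profile.differentiable (by simp))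
            (contDiff_cutProfile.differentiable (by simp))]
  rw [h1, neg_ne_zero]
  have hc' : ContDiff ℝ ∞ (deriv cutProfile) := (contDiff_infty_iff_deriv.1 contDiff_cutProfile).2
  obtain ⟨s, hs, hs1⟩ := exists_deriv_cutProfile
  obtain ⟨y, hy⟩ : ∃ y, qf A⁻¹ y = s := by
    have : Nonempty (Fin n) := ⟨⟨0, by omega⟩⟩
    have h1 : 0 < qf A⁻¹ 1 := qf_pos hB one_ne_zero
    refine ⟨√(s / qf A⁻¹ 1) • 1, ?_⟩
    rw [qf_smul, Real.sq_sqrt (div_nonneg (by linarith [hs.1]) h1.le), div_mul_cancel₀ _ h1.ne']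
  refine (Continuous.integral_pos_of_hasCompactSupport_nonneg_nonzero (μ := volume) (x := y)
    (f := fun x => 4 * qf A⁻¹ x * deriv (profile n) (qf A⁻¹ x) * deriv cutProfile (qf A⁻¹ x))
    ?_ ?_ ?_ ?_).ne'
  · exact ((continuous_const.mul hq.continuous).mul
      (contDiff_deriv_profile.continuous.comp hq.continuous)).mul (hc'.continuous.comp hq.continuous)
  · exact hasCompactSupport_comp_qf hB (s := 3) fun x hx => by
      rw [deriv_cutProfile_of_gt hx, mul_zero]
  · intro x
    rcases le_or_gt (qf A⁻¹ x) 2 with h | h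
    · change 0 ≤ 4 * qf A⁻¹ x * deriv (profile n) (qf A⁻¹ x) * deriv cutProfile (qf A⁻¹ x)
      rw [deriv_cutProfile_of_le h, mul_zero]
    · change 0 ≤ 4 * qf A⁻¹ x * deriv (profile n) (qf A⁻¹ x) * deriv cutProfile (qf A⁻¹ x)
      have h3 : 0 < (qf A⁻¹ x) ^ (-(n : ℝ) / 2) := Real.rpow_pos_of_pos (by linarith) _
      rw [deriv_profile_of_gt h]
      have h4 : (1 - (n : ℝ) / 2) * (qf A⁻¹ x) ^ (-(n : ℝ) / 2) ≤ 0 :=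
        mul_nonpos_of_nonpos_of_nonneg (by linarith) h3.le
      exact mul_nonneg_of_nonpos_of_nonpos
        (mul_nonpos_of_nonneg_of_nonpos (by linarith) h4) (deriv_cutProfile_nonpos _)
  · have h3 : 0 < s ^ (-(n : ℝ) / 2) := Real.rpow_pos_of_pos (by linarith [hs.1]) _
    simp only [hy, hs1]
    rw [deriv_profile_of_gt hs.1]
    have h4 : (1 - (n : ℝ) / 2) < 0 := by linarith
    have h5 : 4 * s ≠ 0 := by linarith [hs.1]
    exact mul_ne_zero (mul_ne_zero h5 (mul_ne_zero h4.ne h3.ne')) (by norm_num)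

lemma exists_kernel (hn : 3 ≤ n) {A : Matrix (Fin n) (Fin n) ℝ} (hA : A.PosDef) :
    ∃ κ φ : Pt n → ℝ, ContDiff ℝ ∞ κ ∧ HasCompactSupport κ ∧ ContDiff ℝ ∞ φ ∧
      HasCompactSupport φ ∧ ∫ x, φ x ≠ 0 ∧ (∃ δ > 0, ∀ x, ‖x‖ < 2 * δ → φ x = 0) ∧
      ∀ x, ∑ i, ∑ j, A i j * pd i (pd j κ) x = dil 1 φ x - φ x := by
  have hd : IsUnit A.det := hA.det_pos.ne'.isUnit
  have hB : (A⁻¹).PosDef := hA.inv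
  have hAs := posDef_isSymm hA
  have hq : ContDiff ℝ ∞ (qf A⁻¹) := contDiff_qf _
  set G := fun x => profile n (qf A⁻¹ x) with hGdef
  have hG : ContDiff ℝ ∞ G := contDiff_profile.comp hq
  have hG2 : ContDiff ℝ ∞ fun x : Pt n => G ((2 : ℝ) • x) :=
    hG.comp (contDiff_const_smul (2 : ℝ))
  refine ⟨fun x => 2 ^ n / 4 * G ((2 : ℝ) • x) - G x, fun x => lapProfile n (qf A⁻¹ x),
    (contDiff_const.mul hG2).sub hG,
    hasCompactSupport_comp_qf hB (s := 2) fun x hx => ?_, contDiff_lapProfile.comp hq,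
    hasCompactSupport_comp_qf hB (s := 2) fun x hx => lapProfile_of_gt hx,
    integral_lapProfile_ne_zero hn hA, ?_, fun x => ?_⟩
  · simp only [hGdef, qf_smul]
    rw [show (2 : ℝ) ^ 2 = 4 by norm_num, profile_four_mul hx, sub_self]
  · have h0 : qf A⁻¹ (0 : Pt n) < 1 := by simp [qf]
    obtain ⟨ε, hε, h⟩ := Metric.eventually_nhds_iff.1
      (hq.continuous.continuousAt.eventually_lt continuousAt_const h0)
    refine ⟨ε / 2, by positivity, fun x hx => lapProfile_of_lt (h ?_)⟩
    rw [dist_zero_right]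
    linarith
  · have hdiff : ∀ {f : Pt n → ℝ}, ContDiff ℝ ∞ f → Differentiable ℝ f :=
      fun h => h.differentiable (by simp)
    have h1 : ∀ j, pd j (fun x => 2 ^ n / 4 * G ((2 : ℝ) • x) - G x)
        = fun x => 2 ^ n / 4 * (2 * pd j G ((2 : ℝ) • x)) - pd j G x := fun j => by
      ext x
      rw [pd_sub ((hdiff hG2 x).const_mul _) (hdiff hG x), pd_const_mul, pd_comp_smul]
    have h2 : ∀ i j, pd i (pd j fun x => 2 ^ n / 4 * G ((2 : ℝ) • x) - G x) x
        = 2 ^ n * pd i (pd j G) ((2 : ℝ) • x) - pd i (pd j G) x := fun i j => by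
      have hs : DifferentiableAt ℝ (fun x : Pt n => pd j G ((2 : ℝ) • x)) x :=
        (hdiff ((hG.pd_infty j).comp (contDiff_const_smul (2 : ℝ)))) x
      rw [h1, pd_sub ((hs.const_mul _).const_mul _) (hdiff (hG.pd_infty j) x), pd_const_mul,
        pd_const_mul, pd_comp_smul]
      ring
    simp_rw [h2, mul_sub, Finset.sum_sub_distrib, mul_left_comm _ ((2 : ℝ) ^ n),
      ← Finset.mul_sum]
    rw [sum_pd_pd_comp_qf hAs hd contDiff_profile, sum_pd_pd_comp_qf hAs hd contDiff_profile]
    simp [dil, lapProfile]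

lemma dil_dil_one (j : ℕ) (φ : Pt n → ℝ) : dil j (dil 1 φ) = dil (j + 1) φ := by
  ext x
  simp only [dil, smul_smul, pow_succ, pow_zero, one_mul, mul_pow]
  rw [mul_comm 2 ((2 : ℝ) ^ j)]
  ring

lemma sum_conv_dil {A : Matrix (Fin n) (Fin n) ℝ} {κ : Fin n → Fin n → Pt n → ℝ} {w : Pt n → ℝ}
    (hκ : ∀ i l, Continuous (κ i l)) (hc : ∀ i l, HasCompactSupport (κ i l)) (hw : Continuous w)
    (j : ℕ) (x : Pt n) :
    ∑ i, ∑ l, A i l * conv (dil j (κ i l)) w x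
      = conv (dil j fun y => ∑ i, ∑ l, A i l * κ i l y) w x := by
  have hI : ∀ i l, Integrable fun y => A i l * (dil j (κ i l) y * w (x - y)) := fun i l =>
    (integrable_conv (contDiff_dil j (contDiff_zero.2 (hκ i l))).continuous
      (hasCompactSupport_dil j (hc i l)) hw x).const_mul _
  simp only [conv]
  simp_rw [← integral_const_mul]
  symm
  calc _ = ∫ y, ∑ i, ∑ l, A i l * (dil j (κ i l) y * w (x - y)) := by
        congr 1 with y
        simp only [dil, Finset.mul_sum, Finset.sum_mul]
        exact Finset.sum_congr rfl fun i _ => Finset.sum_congr rfl fun l _ => by ring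
    _ = _ := by
        rw [integral_finsetSum _ fun i _ => integrable_finsetSum _ fun j _ => hI i j]
        exact Finset.sum_congr rfl fun i _ => integral_finsetSum _ fun l _ => hI i l

lemma conv_sub_left {κ φ w : Pt n → ℝ} (hκ : Continuous κ) (hc : HasCompactSupport κ)
    (hφ : Continuous φ) (hc' : HasCompactSupport φ) (hw : Continuous w) (x : Pt n) :
    conv (fun y => κ y - φ y) w x = conv κ w x - conv φ w x := by
  simp only [conv, sub_mul]
  exact integral_sub (integrable_conv hκ hc hw x) (integrable_conv hφ hc' hw x)

lemma tendsto_conv_dil (hα : α ∈ Ioo (0 : ℝ) 1) {φ w : Pt n → ℝ} {M : ℝ} (hφ : Continuous φ)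
    (hc : HasCompactSupport φ) (hw : HBound α 0 M w) (x : Pt n) :
    Filter.Tendsto (fun j => conv (dil j φ) w x) Filter.atTop (𝓝 ((∫ y, φ y) * w x)) := by
  rw [tendsto_iff_dist_tendsto_zero]
  obtain ⟨hβ0, hβ1, -⟩ := two_rpow_neg_bounds hα
  have hlim : Filter.Tendsto (fun j : ℕ => ((2 : ℝ) ^ (-α)) ^ j * (∫ y, |φ y| * ‖y‖ ^ α) * M)
      Filter.atTop (𝓝 0) := by
    have := ((tendsto_pow_atTop_nhds_zero_of_lt_one hβ0.le hβ1).mul_const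
      (∫ y, |φ y| * ‖y‖ ^ α)).mul_const M
    simpa using this
  refine squeeze_zero (fun _ => dist_nonneg) (fun j => ?_) hlim
  have := abs_conv_sub_le hα.1 (contDiff_dil j (contDiff_zero.2 hφ)).continuous
    (hasCompactSupport_dil j hc) hw x
  rwa [integral_dil, integral_moment_dil] at this

theorem exists_right_inverse (hn : 3 ≤ n) (hα : α ∈ Ioo (0 : ℝ) 1)
    {A : Matrix (Fin n) (Fin n) ℝ} (hA : A.PosDef) :
    ∃ (T : (Pt n → ℝ) → Pt n → ℝ) (δ : ℝ), 0 < δ ∧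
      (∀ m : ℕ, ∃ C : ℝ, 0 ≤ C ∧ ∀ M w, HBound α m M w → HBound α (m + 2) (C * M) (T w)) ∧
      ∀ M w, HBound α 0 M w → (∀ x, δ ≤ ‖x‖ → w x = 0) → ∀ x, ‖x‖ < δ →
        ∑ i, ∑ l, A i l * pd i (pd l (T w)) x = w x := by
  obtain ⟨κ, φ, hκ, hκc, hφ, hφc, h0, ⟨δ, hδ, hφ0⟩, hLap⟩ := exists_kernel hn hA
  obtain ⟨C, hC, hpot⟩ := exists_hBound_pot hα hκ hκc
  set I := ∫ x, φ x
  refine ⟨fun w x => I⁻¹ * pot κ w x, δ, hδ, fun m => ⟨|I⁻¹| * ((n + 2) ^ m * C), by positivity,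
    fun M w hw => ?_⟩, fun M w hw hw0 x hx => ?_⟩
  · have := (hpot m M w hw).const_mul I⁻¹
    rwa [show |I⁻¹| * ((n + 2) ^ m * C) * M = |I⁻¹| * ((n + 2) ^ m * (C * M)) by ring]
  have hwc := hw.continuous hα.1
  have hpp : ∀ i l, ContDiff ℝ ∞ (pd i (pd l κ)) := fun i l => (hκ.pd_infty l).pd_infty i
  have hppc : ∀ i l, HasCompactSupport (pd i (pd l κ)) :=
    fun i l => hasCompactSupport_pd (hasCompactSupport_pd hκc l) i
  have hsum : ∀ i l, Summable fun j : ℕ => conv (dil j (pd i (pd l κ))) w x := fun i l => by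
    obtain ⟨hβ0, hβ1, -⟩ := two_rpow_neg_bounds hα
    refine .of_norm_bounded ((summable_geometric_of_lt_one hβ0.le hβ1).mul_left
      ((∫ y, |pd i (pd l κ) y| * ‖y‖ ^ α) * M)) fun j => ?_
    exact abs_conv_dil_le hα.1 (hpp i l).continuous (hppc i l)
      (integral_pd_eq_zero ((hκ.pd_infty l).of_le (by simp)) (hasCompactSupport_pd hκc l) i) hw j x
  have hterm : ∀ j, ∑ i, ∑ l, A i l * conv (dil j (pd i (pd l κ))) w x
      = conv (dil (j + 1) φ) w x - conv (dil j φ) w x := fun j => by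
    rw [sum_conv_dil (fun i l => (hpp i l).continuous) hppc hwc, ← conv_sub_left
      (contDiff_dil _ hφ).continuous (hasCompactSupport_dil _ hφc) (contDiff_dil _ hφ).continuous
      (hasCompactSupport_dil _ hφc) hwc, ← dil_dil_one]
    congr 1
    ext y
    simp only [dil, hLap]
    ring
  have hHS : HasSum (fun j => conv (dil (j + 1) φ) w x - conv (dil j φ) w x)
      (∑ i, ∑ l, A i l * ∑' j, conv (dil j (pd i (pd l κ))) w x) := by
    simp_rw [← hterm]
    exact hasSum_sum fun i _ => hasSum_sum fun l _ => (hsum i l).hasSum.mul_left _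
  have hz : conv (dil 0 φ) w x = 0 := by
    have : ∀ y, dil 0 φ y * w (x - y) = 0 := fun y => by
      rcases lt_or_ge ‖y‖ (2 * δ) with h | h
      · simp [dil, hφ0 y h]
      · rw [hw0 (x - y), mul_zero]
        have := norm_sub_norm_le y x
        rw [norm_sub_rev] at this
        linarith
    simp [conv, this]
  have hval : ∑ i, ∑ l, A i l * ∑' j, conv (dil j (pd i (pd l κ))) w x = I * w x := by
    refine tendsto_nhds_unique hHS.tendsto_sum_nat ?_
    simp_rw [Finset.sum_range_sub (fun j => conv (dil j φ) w x), hz, sub_zero]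
    exact tendsto_conv_dil hα hφ.continuous hφc hw x
  have h1 : ∀ l, pd l (fun x => I⁻¹ * pot κ w x) = fun x => I⁻¹ * pd l (pot κ w) x :=
    fun l => by ext x; rw [pd_const_mul]
  simp_rw [h1, pd_const_mul, (pd_pd_pot hα hκ hκc hw _).2, mul_left_comm _ I⁻¹, ← Finset.mul_sum,
    hval]
  field_simp

lemma HBound.cHolderOn (hα : 0 < α) {m : ℕ} {M : ℝ} {f : Pt n → ℝ} (hf : HBound α m M f)
    {U : Set (Pt n)} (hU : IsOpen U) : CHolderOn m α U f := by
  induction m generalizing f with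
  | zero => exact (cHolderOn_zero hα hU).2 fun x _ =>
      ⟨M, univ, Filter.univ_mem, fun y _ z _ => hf.2 y z⟩
  | succ m ih =>
    exact (cHolderOn_succ hα hU).2
      ⟨hf.differentiable.differentiableOn, fun i => ih (hf.pd_bound i)⟩

lemma pd_eq_zero_of_notMem_tsupport {f : Pt n → ℝ} {x : Pt n} (hx : x ∉ tsupport f) (i : Fin n) :
    pd i f x = 0 := by
  rw [pd_congr (notMem_tsupport_iff_eventuallyEq.1 hx) i]
  exact pd_const i 0 x

lemma tsupport_pd_subset {f : Pt n → ℝ} (i : Fin n) : tsupport (pd i f) ⊆ tsupport f :=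
  closure_minimal (fun x hx => by
    by_contra h
    exact hx (pd_eq_zero_of_notMem_tsupport h i)) (isClosed_tsupport f)

lemma HBound.abs_mul_le {M N : ℝ} {χ f : Pt n → ℝ} (hχ : HBound α 0 M χ) {s : Set (Pt n)}
    (hs : ∀ x ∉ s, χ x = 0) {D : ℝ} (hD : 0 ≤ D) (hN : ∀ x ∈ s, |f x| ≤ N)
    (hf : ∀ x ∈ s, ∀ y ∈ s, |f x - f y| ≤ D * dist x y ^ α) (h0 : 0 ≤ N) :
    HBound α 0 (M * (N + D)) (fun x => χ x * f x) := by
  have hM := hχ.nonneg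
  have hd : ∀ x y : Pt n, 0 ≤ dist x y ^ α := fun x y => Real.rpow_nonneg dist_nonneg _
  have hMN : M * N ≤ M * (N + D) := by gcongr; linarith
  have key : ∀ x ∈ s, ∀ y, |χ x * f x - χ y * f y| ≤ M * (N + D) * dist x y ^ α := by
    intro x hx y
    by_cases hy : y ∈ s
    · calc |χ x * f x - χ y * f y| = |(χ x - χ y) * f x + χ y * (f x - f y)| := by ring_nf
        _ ≤ |χ x - χ y| * |f x| + |χ y| * |f x - f y| := by
          rw [← abs_mul, ← abs_mul]; exact abs_add_le _ _
        _ ≤ (M * dist x y ^ α) * N + M * (D * dist x y ^ α) := by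
          have := hχ.2 x y
          have := hN x hx
          have := hf x hx y hy
          have := hχ.1 y
          gcongr
        _ = _ := by ring
    · calc |χ x * f x - χ y * f y| = |χ x - χ y| * |f x| := by
            rw [hs y hy, zero_mul, sub_zero, sub_zero, abs_mul]
        _ ≤ (M * dist x y ^ α) * N := by
          have := hχ.2 x y
          have := hN x hx
          gcongr
        _ = M * N * dist x y ^ α := by ring
        _ ≤ _ := mul_le_mul_of_nonneg_right hMN (hd x y)
  refine ⟨fun x => ?_, fun x y => ?_⟩
  · by_cases hx : x ∈ s
    · rw [abs_mul]
      exact (mul_le_mul (hχ.1 x) (hN x hx) (abs_nonneg _) hM).trans hMN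
    · simp only [hs x hx, zero_mul, abs_zero]
      positivity
  · by_cases hx : x ∈ s
    · exact key x hx y
    · by_cases hy : y ∈ s
      · rw [abs_sub_comm, dist_comm]
        exact key y hy x
      · simp only [hs x hx, hs y hy, zero_mul, sub_zero, abs_zero]
        exact mul_nonneg (by positivity) (hd x y)

/-- Cutting off a function of class `C^{m+α}` near a point gives globally bounded norms. -/
lemma exists_hBound_cutoff (hα : α ∈ Ioo (0 : ℝ) 1) {m : ℕ} {U : Set (Pt n)} (hU : IsOpen U)
    (h0 : (0 : Pt n) ∈ U) {f : Pt n → ℝ} (hf : CHolderOn m α U f) :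
    ∃ δ > 0, Metric.ball (0 : Pt n) δ ⊆ U ∧ ∀ χ : Pt n → ℝ, ContDiff ℝ ∞ χ → HasCompactSupport χ →
      tsupport χ ⊆ Metric.ball 0 δ → ∃ M, HBound α m M (fun x => χ x * f x) := by
  induction m generalizing f with
  | zero =>
    rw [cHolderOn_zero hα.1 hU] at hf
    obtain ⟨C, t, ht, hC⟩ := hf 0 h0
    obtain ⟨δ, hδ, hb⟩ := Metric.mem_nhds_iff.1 (Filter.inter_mem ht (hU.mem_nhds h0))
    refine ⟨min δ 1, by positivity, (Metric.ball_subset_ball (min_le_left _ _)).trans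
      (hb.trans inter_subset_right), fun χ hχ hc hs => ?_⟩
    obtain ⟨M, hM⟩ := exists_hBound_of_contDiff hα 0 hχ hc
    have hsub : Metric.ball (0 : Pt n) (min δ 1) ⊆ t :=
      (Metric.ball_subset_ball (min_le_left _ _)).trans (hb.trans inter_subset_left)
    refine ⟨_, hM.abs_mul_le (s := Metric.ball 0 (min δ 1)) (N := |f 0| + max C 0) (D := max C 0)
      (fun x hx => image_eq_zero_of_notMem_tsupport fun h => hx (hs h)) (le_max_right _ _)
      (fun x hx => ?_) (fun x hx y hy => ?_) (by positivity)⟩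
    · have h1 := hC x (hsub hx) 0 (mem_of_mem_nhds ht)
      rw [Real.norm_eq_abs] at h1
      have h2 : dist x 0 ^ α ≤ 1 := Real.rpow_le_one dist_nonneg
        ((Metric.mem_ball.1 hx).le.trans (min_le_right _ _)) hα.1.le
      have h3 : C * dist x 0 ^ α ≤ max C 0 * 1 := by
        gcongr
        exact le_max_left _ _
      have h4 : |f x| ≤ |f x - f 0| + |f 0| := by
        have := abs_add_le (f x - f 0) (f 0)
        rwa [sub_add_cancel] at this
      linarith
    · refine (hC x (hsub hx) y (hsub hy)).trans ?_
      gcongr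
      exact le_max_left _ _
  | succ m ih =>
    obtain ⟨δ₀, hδ₀, hsub, hb⟩ := ih (hf.of_succ hα hU)
    have hpd := fun i => ih (hf.partialDeriv hα.1 hU i)
    choose δ hδ hsub' hb' using hpd
    obtain ⟨ρ, hρ, hρ0, hρi⟩ : ∃ ρ > 0, ρ ≤ δ₀ ∧ ∀ i, ρ ≤ δ i := by
      rcases isEmpty_or_nonempty (Fin n) with he | hne
      · exact ⟨δ₀, hδ₀, le_rfl, fun i => he.elim i⟩
      · obtain ⟨i₀, hi₀⟩ := Finite.exists_min δ
        exact ⟨min δ₀ (δ i₀), lt_min hδ₀ (hδ i₀), min_le_left _ _,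
          fun i => (min_le_right _ _).trans (hi₀ i)⟩
    refine ⟨ρ, hρ, (Metric.ball_subset_ball hρ0).trans hsub, fun χ hχ hc hs => ?_⟩
    obtain ⟨M, hM⟩ := hb χ hχ hc (hs.trans (Metric.ball_subset_ball hρ0))
    have h1 := fun i => hb (pd i χ) (hχ.pd_infty i) (hasCompactSupport_pd hc i)
      ((tsupport_pd_subset i).trans (hs.trans (Metric.ball_subset_ball hρ0)))
    have h2 := fun i => hb' i χ hχ hc (hs.trans (Metric.ball_subset_ball (hρi i)))
    choose M1 hM1 using h1
    choose M2 hM2 using h2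
    have hχd := hχ.differentiable (by simp)
    have hnear : ∀ x ∉ tsupport χ, (fun x => χ x * f x) =ᶠ[𝓝 x] fun _ => 0 := fun x hx => by
      filter_upwards [notMem_tsupport_iff_eventuallyEq.1 hx] with y hy
      simp [hy]
    have hfd : ∀ x ∈ tsupport χ, DifferentiableAt ℝ f x := fun x hx =>
      hf.differentiableAt hU (hsub (Metric.ball_subset_ball hρ0 (hs hx)))
    have hpd : ∀ i, pd i (fun x => χ x * f x) = fun x => pd i χ x * f x + χ x * pd i f x :=
      fun i => by
        ext x
        by_cases hx : x ∈ tsupport χ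
        · exact pd_mul (hχd x) (hfd x hx) i
        · rw [pd_congr (hnear x hx), pd_const, pd_eq_zero_of_notMem_tsupport hx,
            image_eq_zero_of_notMem_tsupport hx, zero_mul, zero_mul, add_zero]
    have hM0 := hM.nonneg
    have hS : ∀ i, 0 ≤ M1 i + M2 i := fun i => add_nonneg (hM1 i).nonneg (hM2 i).nonneg
    refine ⟨M + ∑ i, (M1 i + M2 i), ⟨fun x => ?_, fun x => (hM.bound x).trans ?_⟩, fun i => ?_⟩
    · by_cases hx : x ∈ tsupport χ
      · exact (hχd x).mul (hfd x hx)
      · exact (differentiableAt_const 0).congr_of_eventuallyEq (hnear x hx)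
    · linarith [Finset.sum_nonneg fun i (_ : i ∈ Finset.univ) => hS i]
    · rw [hpd]
      refine ((hM1 i).add (hM2 i)).mono ?_
      linarith [Finset.single_le_sum (fun i _ => hS i) (Finset.mem_univ i)]

lemma exists_hBound_mul_comp_smul (hα : α ∈ Ioo (0 : ℝ) 1) {m : ℕ} {M : ℝ} {f η : Pt n → ℝ}
    (hf : HBound α m M f) (hη : ContDiff ℝ ∞ η) (hc : HasCompactSupport η) :
    ∃ C, 0 ≤ C ∧ ∀ r ∈ Ioc (0 : ℝ) 1, HBound α m C (fun x => η x * f (r • x)) := by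
  obtain ⟨N, hN⟩ := exists_hBound_of_contDiff hα m hη hc
  refine ⟨_, (hN.mul hα hf).nonneg, fun r hr => hN.mul hα ((hf.comp_smul r).mono ?_)⟩
  have h1 : |r| ≤ 1 := by rw [abs_of_pos hr.1]; exact hr.2
  rw [max_eq_left h1, max_eq_left (Real.rpow_le_one (abs_nonneg _) h1 hα.1.le)]
  simp

lemma exists_hBound_mul_comp_smul_small (hα : α ∈ Ioo (0 : ℝ) 1) {m : ℕ} {M : ℝ} {f η : Pt n → ℝ}
    (hf : HBound α m M f) (h0 : f 0 = 0) (hη : ContDiff ℝ ∞ η) (hc : HasCompactSupport η) :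
    ∃ C, 0 ≤ C ∧ ∀ r ∈ Ioc (0 : ℝ) 1, HBound α m (C * r ^ α) (fun x => η x * f (r • x)) := by
  induction m generalizing M η with
  | zero =>
    obtain ⟨N, hN⟩ := exists_hBound_of_contDiff hα 0 hη hc
    obtain ⟨R, hR, hηR⟩ := hc.exists_pos_le_norm
    have hM := hf.nonneg
    have hN0 := hN.nonneg
    refine ⟨N * (M * R ^ α + M), by positivity, fun r hr => ?_⟩
    have hr0 : 0 < r ^ α := Real.rpow_pos_of_pos hr.1 _
    have := hN.abs_mul_le (f := fun x => f (r • x)) (s := {x | ‖x‖ < R})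
      (N := M * R ^ α * r ^ α) (D := M * r ^ α)
      (fun x hx => hηR x (not_lt.1 hx)) (by positivity) (fun x hx => ?_) (fun x _ y _ => ?_)
      (by positivity)
    · rwa [show N * (M * R ^ α + M) * r ^ α = N * (M * R ^ α * r ^ α + M * r ^ α) by ring]
    · have h1 := hf.2 (r • x) 0
      rw [h0, sub_zero, dist_zero_right, norm_smul, Real.norm_of_nonneg hr.1.le,
        Real.mul_rpow hr.1.le (norm_nonneg _)] at h1
      have h2 : ‖x‖ ^ α ≤ R ^ α := Real.rpow_le_rpow (norm_nonneg _) (mem_ofPred.1 hx).le hα.1.le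
      calc _ ≤ M * (r ^ α * ‖x‖ ^ α) := h1
        _ ≤ M * (r ^ α * R ^ α) := by gcongr
        _ = _ := by ring
    · have h1 := hf.2 (r • x) (r • y)
      rw [dist_smul₀, Real.norm_of_nonneg hr.1.le, Real.mul_rpow hr.1.le dist_nonneg] at h1
      rwa [mul_assoc]
  | succ m ih =>
    obtain ⟨C0, hC0, h1⟩ := ih (hf.of_succ hα) hη hc
    have h2 := fun i => ih (hf.of_succ hα) (hη.pd_infty i) (hasCompactSupport_pd hc i)
    have h3 := fun i => exists_hBound_mul_comp_smul hα (hf.pd_bound i) hη hc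
    choose C1 hC1 hb1 using h2
    choose C2 hC2 hb2 using h3
    have hS : ∀ i, 0 ≤ C1 i + C2 i := fun i => add_nonneg (hC1 i) (hC2 i)
    have hS' := Finset.sum_nonneg fun i (_ : i ∈ Finset.univ) => hS i
    refine ⟨C0 + ∑ i, (C1 i + C2 i), by positivity, fun r hr => ?_⟩
    have hr0 : 0 < r ^ α := Real.rpow_pos_of_pos hr.1 _
    have hrα : r ≤ r ^ α := by
      have := Real.rpow_le_rpow_of_exponent_ge hr.1 hr.2 hα.2.le
      rwa [Real.rpow_one] at this
    have hfd := hf.differentiable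
    have hηd := hη.differentiable (by simp)
    have hfr : Differentiable ℝ fun x => f (r • x) := hfd.comp (differentiable_id.const_smul r)
    refine ⟨⟨hηd.mul hfr, fun x => ((h1 r hr).bound x).trans ?_⟩, fun i => ?_⟩
    · gcongr
      linarith
    · have : pd i (fun x => η x * f (r • x))
          = fun x => pd i η x * f (r • x) + r * (η x * pd i f (r • x)) := by
        ext x
        rw [pd_mul (hηd x) (hfr x), pd_comp_smul]
        ring
      rw [this]
      refine ((hb1 i r hr).add ((hb2 i r hr).const_mul r)).mono ?_
      rw [abs_of_pos hr.1]
      calc C1 i * r ^ α + r * C2 i ≤ C1 i * r ^ α + r ^ α * C2 i := by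
            gcongr
            exact hC2 i
        _ = (C1 i + C2 i) * r ^ α := by ring
        _ ≤ _ := by
          refine mul_le_mul_of_nonneg_right ?_ hr0.le
          linarith [Finset.single_le_sum (fun i _ => hS i) (Finset.mem_univ i)]

/-- A linear differential operator of order two. -/
def diffOp (a : Fin n → Fin n → Pt n → ℝ) (b : Fin n → Pt n → ℝ) (c u : Pt n → ℝ) (x : Pt n) : ℝ :=
  ∑ i, ∑ j, a i j x * pd i (pd j u) x + ∑ i, b i x * pd i u x + c x * u x

lemma HBound.exists_zero (hα : α ∈ Ioo (0 : ℝ) 1) {m : ℕ} {M : ℝ} {f : Pt n → ℝ}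
    (hf : HBound α m M f) : ∃ N, HBound α 0 N f := by
  induction m generalizing M with
  | zero => exact ⟨M, hf⟩
  | succ m ih => exact ih (hf.of_succ hα)

lemma exists_common_bound {ι : Type*} [Fintype ι] {P : ι → ℝ → Prop}
    (hP : ∀ i x y, P i x → x ≤ y → P i y) (h : ∀ i, ∃ x, P i x) : ∃ x, 0 ≤ x ∧ ∀ i, P i x := by
  choose C hC using h
  refine ⟨∑ i, |C i|, Finset.sum_nonneg fun i _ => abs_nonneg _, fun i => hP i _ _ (hC i) ?_⟩
  exact (le_abs_self _).trans
    (Finset.single_le_sum (f := fun i => |C i|) (fun i _ => abs_nonneg _) (Finset.mem_univ i))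

lemma exists_hBound_diffOp (hα : α ∈ Ioo (0 : ℝ) 1) (n m : ℕ) :
    ∃ K, 0 ≤ K ∧ ∀ (a : Fin n → Fin n → Pt n → ℝ) (b : Fin n → Pt n → ℝ) (c u : Pt n → ℝ) (M N : ℝ),
      (∀ i j, HBound α m M (a i j)) → (∀ i, HBound α m M (b i)) → HBound α m M c →
      HBound α (m + 2) N u → HBound α m (K * (M * N)) (diffOp a b c u) := by
  set q : ℝ := (2 * ((n : ℝ) + 2)) ^ m * 2 with hq
  refine ⟨n * (n * q) + n * (q * (n + 2)) + q * (n + 2) ^ 2, by positivity,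
    fun a b c u M N ha hb hc hu => ?_⟩
  have h1 := HBound.sum_univ fun i => HBound.sum_univ fun j =>
    (ha i j).mul hα ((hu.pd_bound j).pd_bound i)
  have h2 := HBound.sum_univ fun i => (hb i).mul hα ((hu.pd_bound i).of_succ hα)
  have h3 := hc.mul hα ((hu.of_succ hα).of_succ hα)
  refine ((h1.add h2).add h3).mono (le_of_eq ?_)
  simp only [Fintype.card_fin, hq]
  ring

/-- Solving a small perturbation of an equation with a right inverse, by a Neumann series. -/
lemma exists_solution_of_small (hα : α ∈ Ioo (0 : ℝ) 1) {m : ℕ} {A : Matrix (Fin n) (Fin n) ℝ}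
    {T : (Pt n → ℝ) → Pt n → ℝ} {δ C K ε : ℝ}
    (hT : ∀ M w, HBound α m M w → HBound α (m + 2) (C * M) (T w))
    (hTA : ∀ M w, HBound α 0 M w → (∀ x, δ ≤ ‖x‖ → w x = 0) →
      ∀ x, ‖x‖ < δ → ∑ i, ∑ l, A i l * pd i (pd l (T w)) x = w x)
    {a : Fin n → Fin n → Pt n → ℝ} {b : Fin n → Pt n → ℝ} {c : Pt n → ℝ}
    (hK : ∀ N u, HBound α (m + 2) N u → HBound α m (K * (ε * N)) (diffOp a b c u))
    (ha : ∀ i j x, δ ≤ ‖x‖ → a i j x = 0) (hb : ∀ i x, δ ≤ ‖x‖ → b i x = 0)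
    (hc : ∀ x, δ ≤ ‖x‖ → c x = 0) (hε : K * (ε * C) ≤ 1 / 2) {d : Pt n → ℝ} {M : ℝ}
    (hd : HBound α m M d) (hd0 : ∀ x, δ ≤ ‖x‖ → d x = 0) :
    ∃ v, HBound α (m + 2) (2 * C * M) v ∧ ∀ x, ‖x‖ < δ →
      ∑ i, ∑ l, A i l * pd i (pd l v) x + diffOp a b c v x = d x := by
  let D : ℕ → Pt n → ℝ := fun j => Nat.rec d (fun _ w x => (-1) * diffOp a b c (T w) x) j
  have hD1 : ∀ j x, D (j + 1) x = -diffOp a b c (T (D j)) x := fun j x => neg_one_mul _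
  have hDb : ∀ j, HBound α m (M * (1 / 2) ^ j) (D j) := by
    intro j
    induction j with
    | zero => simpa [D] using hd
    | succ j ih =>
      refine ((hK _ _ (hT _ _ ih)).const_mul (-1)).mono ?_
      have := ih.nonneg
      calc |(-1 : ℝ)| * (K * (ε * (C * (M * (1 / 2) ^ j))))
          = (K * (ε * C)) * (M * (1 / 2) ^ j) := by rw [abs_neg, abs_one]; ring
        _ ≤ 1 / 2 * (M * (1 / 2) ^ j) := by gcongr
        _ = _ := by ring
  have hDs : ∀ j x, δ ≤ ‖x‖ → D j x = 0 := by
    intro j x hx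
    cases j with
    | zero => exact hd0 x hx
    | succ j =>
      rw [hD1, diffOp]
      simp [ha _ _ x hx, hb _ x hx, hc x hx]
  have hf := fun j => hT _ _ (hDb j)
  have hg : HasSum (fun j : ℕ => (1 / 2 : ℝ) ^ j) 2 := hasSum_geometric_two
  have hS : HasSum (fun j : ℕ => C * (M * (1 / 2 : ℝ) ^ j)) (2 * C * M) := by
    rw [show 2 * C * M = C * (M * 2) by ring]
    exact (hg.mul_left M).mul_left C
  have hv := HBound.tsum hS.summable hf
  rw [hS.tsum_eq] at hv
  refine ⟨_, hv, fun x hx => ?_⟩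
  have e1 : ∀ i, pd i (fun x => ∑' j, T (D j) x) = fun x => ∑' j, pd i (T (D j)) x := fun i =>
    HBound.pd_tsum hS.summable hf i
  have e2 : ∀ i l, pd i (pd l (fun x => ∑' j, T (D j) x))
      = fun x => ∑' j, pd i (pd l (T (D j))) x := fun i l => by
    rw [e1]
    exact HBound.pd_tsum hS.summable (fun j => (hf j).pd_bound l) i
  have s2 : ∀ i l, HasSum (fun j => pd i (pd l (T (D j))) x)
      (pd i (pd l (fun x => ∑' j, T (D j) x)) x) := fun i l => by
    rw [e2]
    exact (HBound.summable hS.summable (fun j => ((hf j).pd_bound l).pd_bound i) x).hasSum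
  have s1 : ∀ i, HasSum (fun j => pd i (T (D j)) x) (pd i (fun x => ∑' j, T (D j) x) x) :=
    fun i => by
      rw [e1]
      exact (HBound.summable hS.summable (fun j => (hf j).pd_bound i) x).hasSum
  have s0 : HasSum (fun j => T (D j) x) (∑' j, T (D j) x) :=
    (HBound.summable hS.summable hf x).hasSum
  have t1 := (hasSum_sum fun i (_ : i ∈ Finset.univ) => hasSum_sum fun l
    (_ : l ∈ Finset.univ) => (s2 i l).mul_left (A i l)).add
    (((hasSum_sum fun i (_ : i ∈ Finset.univ) => hasSum_sum fun l
    (_ : l ∈ Finset.univ) => (s2 i l).mul_left (a i l x)).add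
    (hasSum_sum fun i (_ : i ∈ Finset.univ) => (s1 i).mul_left (b i x))).add
    (s0.mul_left (c x)))
  have hDsum : Summable fun j => D j x :=
    HBound.summable (hg.summable.mul_left M) hDb x
  have t2 := hDsum.hasSum.sub ((hasSum_nat_add_iff' 1).2 hDsum.hasSum)
  rw [Finset.sum_range_one, sub_sub_cancel] at t2
  refine t1.unique (Eq.subst (motive := fun F => HasSum F (D 0 x)) (funext fun j => ?_) t2)
  obtain ⟨N, hN⟩ := (hDb j).exists_zero hα
  rw [hTA N (D j) hN (hDs j) x hx, hD1, sub_neg_eq_add]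
  rfl

lemma exists_cutoff (n : ℕ) {ρ : ℝ} (hρ : 0 < ρ) : ∃ η : Pt n → ℝ, ContDiff ℝ ∞ η ∧
    HasCompactSupport η ∧ tsupport η ⊆ Metric.ball 0 ρ ∧ ∀ x, ‖x‖ < ρ / 4 → η x = 1 := by
  let η : ContDiffBump (0 : Pt n) := ⟨ρ / 4, ρ / 2, by positivity, by linarith⟩
  refine ⟨η, η.contDiff, η.hasCompactSupport, ?_, fun x hx => ?_⟩
  · rw [η.tsupport_eq]
    exact Metric.closedBall_subset_ball (by change ρ / 2 < ρ; linarith)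
  · exact η.one_of_mem_closedBall (mem_closedBall_zero_iff.2 hx.le)

lemma pd_pd_comp_smul (r : ℝ) (f : Pt n → ℝ) (x : Pt n) (i j : Fin n) :
    pd i (pd j fun y => f (r • y)) x = r ^ 2 * pd i (pd j f) (r • x) := by
  have : (pd j fun y => f (r • y)) = fun y => r * pd j f (r • y) :=
    funext fun y => pd_comp_smul r f y j
  rw [this, pd_const_mul, pd_comp_smul]
  ring

/-- Near a point, an elliptic equation has a solution with arbitrarily small first order jet. -/
lemma exists_small_solution (hn : 3 ≤ n) (hα : α ∈ Ioo (0 : ℝ) 1) {m : ℕ}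
    {a : Fin n → Fin n → Pt n → ℝ} {b : Fin n → Pt n → ℝ} {c h : Pt n → ℝ} {M : ℝ}
    (ha : ∀ i j, HBound α m M (a i j)) (hb : ∀ i, HBound α m M (b i)) (hc : HBound α m M c)
    (hh : HBound α m M h) (hA : (Matrix.of fun i j => a i j 0).PosDef) {ε : ℝ} (hε : 0 < ε) :
    ∃ ρ > 0, ∃ N v, HBound α (m + 2) N v ∧ (∀ x, ‖x‖ < ρ → diffOp a b c v x = h x) ∧
      |v 0| < ε ∧ ∀ i, |pd i v 0| < ε := by
  obtain ⟨T, δ, hδ, hTb, hTA⟩ := exists_right_inverse hn hα hA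
  obtain ⟨C, hC, hT⟩ := hTb m
  obtain ⟨K, hK, hKb⟩ := exists_hBound_diffOp hα n m
  obtain ⟨η, hη, hηc, hηs, hη1⟩ := exists_cutoff n hδ
  have hη0 : ∀ x, δ ≤ ‖x‖ → η x = 0 := fun x hx =>
    image_eq_zero_of_notMem_tsupport fun h => absurd (mem_ball_zero_iff.1 (hηs h)) (not_lt.2 hx)
  have hmono : ∀ (f : Pt n → ℝ) (q : ℝ → ℝ) (x y : ℝ), (∀ r ∈ Ioc (0 : ℝ) 1, 0 ≤ q r) →
      (∀ r ∈ Ioc (0 : ℝ) 1, HBound α m (x * q r) (fun z => η z * f (r • z))) → x ≤ y →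
      ∀ r ∈ Ioc (0 : ℝ) 1, HBound α m (y * q r) (fun z => η z * f (r • z)) :=
    fun f q x y hq hx hxy r hr => (hx r hr).mono (mul_le_mul_of_nonneg_right hxy (hq r hr))
  have hq : ∀ r ∈ Ioc (0 : ℝ) 1, 0 ≤ r ^ α := fun r hr => Real.rpow_nonneg hr.1.le _
  obtain ⟨Ca, hCa, hab⟩ := exists_common_bound
    (P := fun (p : Fin n × Fin n) x => ∀ r ∈ Ioc (0 : ℝ) 1,
      HBound α m (x * r ^ α) (fun z => η z * (a p.1 p.2 (r • z) - a p.1 p.2 0)))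
    (fun p x y => hmono (fun z => a p.1 p.2 z - a p.1 p.2 0) _ x y hq)
    (fun p => by
      have := (ha p.1 p.2).add (HBound.const m (-(a p.1 p.2 0)))
      obtain ⟨D, -, hD⟩ := exists_hBound_mul_comp_smul_small hα this (by simp) hη hηc
      exact ⟨D, by simpa only [sub_eq_add_neg] using hD⟩)
  obtain ⟨Cb, hCb, hbb⟩ := exists_common_bound
    (P := fun (i : Fin n) x => ∀ r ∈ Ioc (0 : ℝ) 1, HBound α m (x * 1) (fun z => η z * b i (r • z)))
    (fun i x y => hmono (b i) (fun _ => 1) x y fun _ _ => zero_le_one)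
    (fun i => by
      obtain ⟨D, -, hD⟩ := exists_hBound_mul_comp_smul hα (hb i) hη hηc
      exact ⟨D, by simpa only [mul_one] using hD⟩)
  obtain ⟨Cc, hCc, hcb⟩ := exists_hBound_mul_comp_smul hα hc hη hηc
  obtain ⟨Ch, hCh, hhb⟩ := exists_hBound_mul_comp_smul hα hh hη hηc
  set B := Ca + Cb + Cc with hB
  obtain ⟨r, hr, hr1, hr2⟩ : ∃ r ∈ Ioc (0 : ℝ) 1, K * (B * r ^ α * C) ≤ 1 / 2 ∧
      2 * C * Ch * r < ε := by
    have t1 : Filter.Tendsto (fun r : ℝ => K * (B * r ^ α * C)) (𝓝[>] 0) (𝓝 0) := by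
      have : ContinuousAt (fun r : ℝ => K * (B * r ^ α * C)) 0 :=
        (((Real.continuousAt_rpow_const 0 α (Or.inr hα.1.le)).const_mul B).mul_const C).const_mul K
      have := this.tendsto
      simp only [Real.zero_rpow hα.1.ne', mul_zero, zero_mul] at this
      exact this.mono_left nhdsWithin_le_nhds
    have t2 : Filter.Tendsto (fun r : ℝ => 2 * C * Ch * r) (𝓝[>] 0) (𝓝 0) := by
      have : ContinuousAt (fun r : ℝ => 2 * C * Ch * r) 0 := by fun_prop
      have := this.tendsto
      simp only [mul_zero] at this
      exact this.mono_left nhdsWithin_le_nhds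
    obtain ⟨r, ⟨h1, h2⟩, h3⟩ := (((t1.eventually (ge_mem_nhds (by norm_num : (0 : ℝ) < 1 / 2))).and
      (t2.eventually (gt_mem_nhds hε))).and (Ioc_mem_nhdsGT one_pos)).exists
    exact ⟨r, h3, h1, h2⟩
  have hrα : r ≤ r ^ α := by
    have := Real.rpow_le_rpow_of_exponent_ge hr.1 hr.2 hα.2.le
    rwa [Real.rpow_one] at this
  have hrr : r ^ 2 ≤ r := by nlinarith [hr.1, hr.2]
  have hr0 := hr.1
  have hrα0 := hq r hr
  have ha' : ∀ i j, HBound α m (B * r ^ α) (fun z => η z * (a i j (r • z) - a i j 0)) :=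
    fun i j => (hab (i, j) r hr).mono (mul_le_mul_of_nonneg_right (by linarith) hrα0)
  have hb' : ∀ i, HBound α m (B * r ^ α) (fun z => r * (η z * b i (r • z))) := fun i => by
    refine ((hbb i r hr).const_mul r).mono ?_
    rw [abs_of_pos hr0, mul_one, mul_comm]
    exact mul_le_mul (by linarith) hrα hr0.le (by positivity)
  have hc' : HBound α m (B * r ^ α) (fun z => r ^ 2 * (η z * c (r • z))) := by
    refine ((hcb r hr).const_mul (r ^ 2)).mono ?_
    rw [abs_of_pos (by positivity), mul_comm]
    exact mul_le_mul (by linarith) (hrr.trans hrα) (by positivity) (by positivity)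
  obtain ⟨V, hV, hVe⟩ := exists_solution_of_small hα hT hTA
    (fun N u hu => hKb _ _ _ _ _ _ ha' hb' hc' hu)
    (fun i j x hx => by simp [hη0 x hx]) (fun i x hx => by simp [hη0 x hx])
    (fun x hx => by simp [hη0 x hx]) hr1 ((hhb r hr).const_mul (r ^ 2))
    (fun x hx => by simp [hη0 x hx])
  rw [abs_of_pos (by positivity : 0 < r ^ 2)] at hV
  have hd1 : ∀ i x, pd i (fun y => V (r⁻¹ • y)) x = r⁻¹ * pd i V (r⁻¹ • x) := fun i x =>
    pd_comp_smul _ _ _ _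
  have hd2 := fun i j x => pd_pd_comp_smul r⁻¹ V x i j
  refine ⟨r * (δ / 4), by positivity, _, fun y => V (r⁻¹ • y), hV.comp_smul r⁻¹, fun y hy => ?_,
    ?_, fun i => ?_⟩
  · obtain ⟨x, rfl⟩ : ∃ x, y = r • x := ⟨r⁻¹ • y, by rw [smul_inv_smul₀ hr0.ne']⟩
    have hx : ‖x‖ < δ / 4 := by
      rw [norm_smul, Real.norm_of_nonneg hr0.le] at hy
      exact lt_of_mul_lt_mul_left hy hr0.le
    have he := hVe x (by linarith)
    simp only [diffOp, hη1 x hx, one_mul, Matrix.of_apply] at he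
    simp only [diffOp, hd1, hd2, inv_smul_smul₀ hr0.ne']
    have hr2' : r ^ 2 ≠ 0 := by positivity
    apply mul_left_cancel₀ hr2'
    have e1 : ∑ i, r * b i (r • x) * pd i V x = r ^ 2 * ∑ i, b i (r • x) * (r⁻¹ * pd i V x) := by
      rw [Finset.mul_sum]
      refine Finset.sum_congr rfl fun i _ => ?_
      field_simp
    have e2 : ∑ i, ∑ j, a i j 0 * pd i (pd j V) x
        + ∑ i, ∑ j, (a i j (r • x) - a i j 0) * pd i (pd j V) x
        = r ^ 2 * ∑ i, ∑ j, a i j (r • x) * (r⁻¹ ^ 2 * pd i (pd j V) x) := by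
      simp only [Finset.mul_sum, ← Finset.sum_add_distrib]
      refine Finset.sum_congr rfl fun i _ => Finset.sum_congr rfl fun j _ => ?_
      field_simp
      ring
    linear_combination he - e1 - e2
  · change |V (r⁻¹ • 0)| < ε
    rw [smul_zero]
    refine (hV.bound 0).trans_lt (lt_of_le_of_lt ?_ hr2)
    calc 2 * C * (r ^ 2 * Ch) = 2 * C * Ch * r ^ 2 := by ring
      _ ≤ _ := by gcongr
  · rw [hd1, smul_zero, abs_mul, abs_of_pos (inv_pos.2 hr0)]
    refine lt_of_le_of_lt (mul_le_mul_of_nonneg_left ((hV.pd_bound i).bound 0) (by positivity)) ?_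
    calc r⁻¹ * (2 * C * (r ^ 2 * Ch)) = 2 * C * Ch * r := by field_simp
      _ < _ := hr2

/-- Local solvability of homogeneous elliptic equations with approximately prescribed first
order jet. -/
theorem exists_local_solution (hn : 3 ≤ n) (hα : α ∈ Ioo (0 : ℝ) 1) {m : ℕ} {U : Set (Pt n)}
    (hU : IsOpen U) (h0 : (0 : Pt n) ∈ U)
    {a : Fin n → Fin n → Pt n → ℝ} {b : Fin n → Pt n → ℝ} {c : Pt n → ℝ}
    (ha : ∀ i j, CHolderOn m α U (a i j)) (hb : ∀ i, CHolderOn m α U (b i))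
    (hc : CHolderOn m α U c) (hA : (Matrix.of fun i j => a i j 0).PosDef)
    (p : ℝ) (l : Fin n → ℝ) {ε : ℝ} (hε : 0 < ε) :
    ∃ V, IsOpen V ∧ (0 : Pt n) ∈ V ∧ V ⊆ U ∧ ∃ u, CHolderOn (m + 2) α V u ∧
      (∀ x ∈ V, diffOp a b c u x = 0) ∧ |u 0 - p| < ε ∧ ∀ i, |pd i u 0 - l i| < ε := by
  let P : Pt n → ℝ := fun x => p + ∑ j, l j * x j
  have hPc : ContDiff ℝ ∞ P := by
    change ContDiff ℝ ∞ fun x : Pt n => p + ∑ j, l j * x j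
    fun_prop
  have hPd : Differentiable ℝ P := hPc.differentiable (by simp)
  have hP1 : ∀ i, pd i P = fun _ => l i := fun i => funext fun x => by
    rw [pd_add (differentiableAt_const _) (by fun_prop), pd_const, zero_add, pd_lin]
  let h : Pt n → ℝ := fun x => (-1) * (∑ i, l i * b i x + c x * P x)
  have hh : CHolderOn m α U h := CHolderOn.const_mul hα.1 hU
    (CHolderOn.add hα.1 hU (CHolderOn.sum hα.1 hU fun i _ => CHolderOn.const_mul hα.1 hU (hb i) _)
      (CHolderOn.mul hα hU hc (CHolderOn.of_contDiff hα hU hPc))) _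
  obtain ⟨δ, hδ, hδs, hcut⟩ : ∃ δ > 0, Metric.ball (0 : Pt n) δ ⊆ U ∧ ∀ χ : Pt n → ℝ,
      ContDiff ℝ ∞ χ → HasCompactSupport χ → tsupport χ ⊆ Metric.ball 0 δ →
      (∀ i j, ∃ M, HBound α m M (fun x => χ x * a i j x)) ∧
      (∀ i, ∃ M, HBound α m M (fun x => χ x * b i x)) ∧
      (∃ M, HBound α m M (fun x => χ x * c x)) ∧ ∃ M, HBound α m M (fun x => χ x * h x) := by
    choose da ha1 ha2 ha3 using fun p : Fin n × Fin n => exists_hBound_cutoff hα hU h0 (ha p.1 p.2)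
    choose db hb1 hb2 hb3 using fun i => exists_hBound_cutoff hα hU h0 (hb i)
    obtain ⟨dc, hc1, hc2, hc3⟩ := exists_hBound_cutoff hα hU h0 hc
    obtain ⟨dh, hh1, hh2, hh3⟩ := exists_hBound_cutoff hα hU h0 hh
    have i₀ : Fin n := ⟨0, by omega⟩
    have : Nonempty (Fin n) := ⟨i₀⟩
    obtain ⟨pa, hpa⟩ := Finite.exists_min da
    obtain ⟨pb, hpb⟩ := Finite.exists_min db
    have hs : ∀ {s d : ℝ}, d ≤ s → Metric.ball (0 : Pt n) d ⊆ Metric.ball 0 s :=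
      fun h => Metric.ball_subset_ball h
    refine ⟨min (min (da pa) (db pb)) (min dc dh),
      lt_min (lt_min (ha1 _) (hb1 _)) (lt_min hc1 hh1), (hs ?_).trans hc2, fun χ h1 h2 h3 =>
      ⟨fun i j => ha3 (i, j) χ h1 h2 (h3.trans (hs ?_)), fun i => hb3 i χ h1 h2 (h3.trans (hs ?_)),
        hc3 χ h1 h2 (h3.trans (hs ?_)), hh3 χ h1 h2 (h3.trans (hs ?_))⟩⟩
    · exact (min_le_right _ _).trans (min_le_left _ _)
    · exact (min_le_left _ _).trans ((min_le_left _ _).trans (hpa _))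
    · exact (min_le_left _ _).trans ((min_le_right _ _).trans (hpb _))
    · exact (min_le_right _ _).trans (min_le_left _ _)
    · exact (min_le_right _ _).trans (min_le_right _ _)
  obtain ⟨χ, hχ, hχc, hχs, hχ1⟩ := exists_cutoff n hδ
  obtain ⟨ha', hb', ⟨Mc, hMc⟩, ⟨Mh, hMh⟩⟩ := hcut χ hχ hχc hχs
  obtain ⟨Ma, hMa, hMa'⟩ := exists_common_bound
    (P := fun (p : Fin n × Fin n) x => HBound α m x (fun z => χ z * a p.1 p.2 z))
    (fun p x y h hxy => h.mono hxy) (fun p => ha' p.1 p.2)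
  obtain ⟨Mb, hMb, hMb'⟩ := exists_common_bound
    (P := fun (i : Fin n) x => HBound α m x (fun z => χ z * b i z))
    (fun p x y h hxy => h.mono hxy) hb'
  have hMc0 := hMc.nonneg
  have hMh0 := hMh.nonneg
  have hχ0 : χ 0 = 1 := hχ1 0 (by rw [norm_zero]; positivity)
  obtain ⟨ρ, hρ, N, v, hv, hve, hv0, hv1⟩ := exists_small_solution hn hα
    (a := fun i j x => χ x * a i j x) (b := fun i x => χ x * b i x) (c := fun x => χ x * c x)
    (h := fun x => χ x * h x) (M := Ma + Mb + Mc + Mh)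
    (fun i j => (hMa' (i, j)).mono (by linarith)) (fun i => (hMb' i).mono (by linarith))
    (hMc.mono (by linarith)) (hMh.mono (by linarith)) (by simpa only [hχ0, one_mul] using hA) hε
  have hvd : Differentiable ℝ v := hv.differentiable
  have hvd1 : ∀ i, Differentiable ℝ (pd i v) := fun i => (hv.pd_bound i).differentiable
  have hu1 : ∀ i, pd i (fun x => P x + v x) = fun x => l i + pd i v x := fun i => funext fun x => by
    rw [pd_add (hPd x) (hvd x), hP1]
  have hu2 : ∀ i j x, pd i (pd j fun x => P x + v x) x = pd i (pd j v) x := fun i j x => by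
    rw [hu1, pd_add (differentiableAt_const _) (hvd1 j x), pd_const, zero_add]
  have hVo : IsOpen (Metric.ball (0 : Pt n) (min ρ (δ / 4))) := Metric.isOpen_ball
  refine ⟨Metric.ball 0 (min ρ (δ / 4)), hVo, Metric.mem_ball_self (by positivity),
    (Metric.ball_subset_ball ((min_le_right _ _).trans (by linarith))).trans hδs,
    fun x => P x + v x, CHolderOn.add hα.1 hVo (CHolderOn.of_contDiff hα hVo hPc)
      (hv.cHolderOn hα.1 hVo), fun x hx => ?_, ?_, fun i => ?_⟩
  · rw [mem_ball_zero_iff, lt_min_iff] at hx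
    have he := hve x hx.1
    simp only [diffOp, hχ1 x hx.2, one_mul] at he
    simp only [diffOp, hu2]
    simp only [hu1, mul_add, Finset.sum_add_distrib]
    simp only [h] at he
    have e : ∑ i, b i x * l i = ∑ i, l i * b i x :=
      Finset.sum_congr rfl fun i _ => mul_comm _ _
    rw [e]
    linarith
  · simpa [P] using hv0
  · rw [hu1, add_sub_cancel_left]
    exact hv1 i

lemma pd_component {Z : Pt n → Pt n} {x : Pt n} (hZ : DifferentiableAt ℝ Z x) (i a : Fin n) :
    pd i (fun y => Z y a) x = fderiv ℝ Z x (Pi.single i 1) a := by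
  rw [pd, (hasFDerivAt_pi'.1 hZ.hasFDerivAt a).fderiv]
  rfl

lemma fderiv_eq_jac_mulVec {Z : Pt n → Pt n} {x : Pt n} (hZ : DifferentiableAt ℝ Z x) (v : Pt n) :
    fderiv ℝ Z x v = jac Z x *ᵥ v := by
  ext i
  have h := (hasFDerivAt_pi'.1 hZ.hasFDerivAt i).fderiv
  have : fderiv ℝ Z x v i = fderiv ℝ (fun y => Z y i) x v := by rw [h]; rfl
  rw [this, fderiv_apply_eq_sum_pd, Matrix.mulVec, dotProduct]
  exact Finset.sum_congr rfl fun j _ => mul_comm _ _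

lemma det_fderiv_eq_det_jac {Z : Pt n → Pt n} {x : Pt n} (hZ : DifferentiableAt ℝ Z x) :
    (fderiv ℝ Z x).det = (jac Z x).det := by
  have : ((fderiv ℝ Z x : Pt n →L[ℝ] Pt n) : Pt n →ₗ[ℝ] Pt n) = Matrix.toLin' (jac Z x) :=
    LinearMap.ext fun v => by rw [Matrix.toLin'_apply]; exact fderiv_eq_jac_mulVec hZ v
  rw [ContinuousLinearMap.det, this, LinearMap.det_toLin']

/-- The inverse function theorem in Hölder classes. -/
theorem exists_local_inverse (hα : α ∈ Ioo (0 : ℝ) 1) {m : ℕ} {U : Set (Pt n)} (hU : IsOpen U)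
    {p : Pt n} (hp : p ∈ U) {Z : Pt n → Pt n} (hZ : ∀ i, CHolderOn (m + 1) α U fun x => Z x i)
    (hdet : (jac Z p).det ≠ 0) :
    ∃ V, IsOpen V ∧ p ∈ V ∧ V ⊆ U ∧ InjOn Z V ∧ IsOpen (Z '' V) ∧
      ∃ Zinv : Pt n → Pt n, (∀ i, CHolderOn (m + 1) α (Z '' V) fun y => Zinv y i) ∧
        ∀ x ∈ V, Zinv (Z x) = x := by
  have hZ1 : ContDiffOn ℝ 1 Z U := contDiffOn_pi.2 fun i => (hZ i).1.of_le (by norm_cast; omega)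
  have hZd : ∀ x ∈ U, DifferentiableAt ℝ Z x := fun x hx =>
    (hZ1.contDiffAt (hU.mem_nhds hx)).differentiableAt one_ne_zero
  have hjac : ∀ i j, CHolderOn m α U fun x => jac Z x i j := fun i j =>
    (hZ i).partialDeriv hα.1 hU j
  have hdc : ContinuousOn (fun x => (jac Z x).det) U := (CHolderOn.det hα hU hjac).1.continuousOn
  let equiv : ∀ x, (jac Z x).det ≠ 0 → x ∈ U → (Pt n ≃L[ℝ] Pt n) := fun x h hx =>
    (fderiv ℝ Z x).toContinuousLinearEquivOfDetNeZero (by rwa [det_fderiv_eq_det_jac (hZd x hx)])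
  have hequiv : ∀ x h hx, HasFDerivAt Z (equiv x h hx : Pt n →L[ℝ] Pt n) x := fun x h hx => by
    rw [ContinuousLinearMap.coe_toContinuousLinearEquivOfDetNeZero]
    exact (hZd x hx).hasFDerivAt
  have hcd := hZ1.contDiffAt (hU.mem_nhds hp)
  let e := hcd.toOpenPartialHomeomorph Z (hequiv p hdet hp) one_ne_zero
  have hpe : p ∈ e.source := hcd.mem_toOpenPartialHomeomorph_source _ _
  let V : Set (Pt n) := e.source ∩ (U ∩ (fun x => (jac Z x).det) ⁻¹' {0}ᶜ)
  have hV : IsOpen V := e.open_source.inter (hdc.isOpen_inter_preimage hU isOpen_compl_singleton)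
  have hW : IsOpen (Z '' V) := e.isOpen_image_of_subset_source hV inter_subset_left
  have hinv : ∀ x ∈ V, e.symm (Z x) = x := fun x hx => e.left_inv hx.1
  have hd : ∀ x ∈ V, ∃ (h : (jac Z x).det ≠ 0) (hx : x ∈ U),
      HasFDerivAt e.symm ((equiv x h hx).symm : Pt n →L[ℝ] Pt n) (Z x) := fun x hx => by
    have h := hequiv x hx.2.2 hx.2.1
    refine ⟨hx.2.2, hx.2.1, e.hasFDerivAt_symm (e.map_source hx.1) ?_⟩
    rw [hinv x hx]
    exact h
  have hE1 : ContDiffOn ℝ 1 e.symm (Z '' V) := by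
    rintro _ ⟨x, hx, rfl⟩
    obtain ⟨h, hxU, -⟩ := hd x hx
    refine (e.contDiffAt_symm (f₀' := equiv x h hxU) (e.map_source hx.1) ?_ ?_).contDiffWithinAt
    · rw [e.left_inv hx.1]
      exact hequiv x h hxU
    · rw [e.left_inv hx.1]
      exact hZ1.contDiffAt (hU.mem_nhds hxU)
  have hpd : ∀ i a, EqOn (pd i fun y => e.symm y a)
      (fun y => (jac Z (e.symm y))⁻¹ a i) (Z '' V) := by
    rintro i a _ ⟨x, hx, rfl⟩
    obtain ⟨h, hxU, hdx⟩ := hd x hx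
    have hu : IsUnit (jac Z x).det := isUnit_iff_ne_zero.2 h
    rw [pd_component hdx.differentiableAt, hdx.fderiv]
    simp only [hinv x hx]
    set w := (equiv x h hxU).symm (Pi.single i 1) with hw
    have h1 : jac Z x *ᵥ w = Pi.single i 1 := by
      rw [← fderiv_eq_jac_mulVec (hZd x hxU)]
      exact (equiv x h hxU).apply_symm_apply _
    have h2 : w = (jac Z x)⁻¹ *ᵥ Pi.single i 1 := by
      rw [← h1, Matrix.mulVec_mulVec, Matrix.nonsing_inv_mul _ hu, Matrix.one_mulVec]
    change w a = _
    rw [h2, Matrix.mulVec_single_one, Matrix.col_apply]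
  have hVU : V ⊆ U := fun x hx => hx.2.1
  have hmaps : MapsTo e.symm (Z '' V) V := by
    rintro _ ⟨x, hx, rfl⟩
    rwa [hinv x hx]
  have hreg : ∀ j ≤ m + 1, ∀ a, CHolderOn j α (Z '' V) fun y => e.symm y a := by
    intro j hj
    induction j with
    | zero => exact fun a => .of_contDiffOn hα hW (by simpa using contDiffOn_pi.1 hE1 a)
    | succ j ih =>
      intro a
      refine (cHolderOn_succ hα.1 hW).2
        ⟨(contDiffOn_pi.1 hE1 a).differentiableOn one_ne_zero, fun i => ?_⟩
      have h1 : CHolderOn m α V fun x => (jac Z x)⁻¹ a i :=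
        CHolderOn.matrix_inv hα hV (fun i j => (hjac i j).mono hα.1 hU hV hVU)
          (fun x hx => hx.2.2) a i
      exact ((h1.of_le hα hV (by omega)).comp hα hW hV (ih (by omega)) hE1 hmaps).congr
        hα.1 hW (hpd i a)
  exact ⟨V, hV, ⟨hpe, hp, hdet⟩, hVU, e.injOn.mono inter_subset_left, hW, e.symm,
    hreg _ le_rfl, hinv⟩

section Geometry

variable {k : ℕ} {U : Set (Pt n)} {g : Met n}

lemma det_ne_zero (hg : IsMetricOn g U) {x : Pt n} (hx : x ∈ U) : (g x).det ≠ 0 :=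
  (hg x hx).2.det_pos.ne'

lemma cHolderOn_christoffel (hα : α ∈ Ioo (0 : ℝ) 1) (hU : IsOpen U) (hg : IsMetricOn g U)
    (hr : MetCHolderOn (k + 1) α U g) (c a b : Fin n) : CHolderOn k α U (christoffel g c a b) := by
  have hi : ∀ i j, CHolderOn k α U fun x => (g x)⁻¹ i j :=
    CHolderOn.matrix_inv hα hU (fun i j => (hr i j).of_succ hα hU) fun x hx => det_ne_zero hg hx
  exact (CHolderOn.sum hα.1 hU fun d _ => (hi c d).mul hα hU
    ((((hr b d).partialDeriv hα.1 hU a).add hα.1 hU ((hr a d).partialDeriv hα.1 hU b)).sub hα.1 hU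
      ((hr a b).partialDeriv hα.1 hU d))).const_mul hα.1 hU _

lemma cHolderOn_ricci (hα : α ∈ Ioo (0 : ℝ) 1) (hU : IsOpen U) (hg : IsMetricOn g U)
    (hr : MetCHolderOn (k + 2) α U g) (a b : Fin n) : CHolderOn k α U (ricci g a b) := by
  have h1 := cHolderOn_christoffel hα hU hg hr
  have h2 := fun c a b => (h1 c a b).of_succ hα hU
  refine CHolderOn.sub hα.1 hU (CHolderOn.add hα.1 hU (CHolderOn.sub hα.1 hU ?_ ?_) ?_) ?_
  · exact .sum hα.1 hU fun c _ => (h1 c a b).partialDeriv hα.1 hU c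
  · exact .sum hα.1 hU fun c _ => (h1 c c b).partialDeriv hα.1 hU a
  · exact .sum hα.1 hU fun c _ => .sum hα.1 hU fun d _ => (h2 c a b).mul hα hU (h2 d d c)
  · exact .sum hα.1 hU fun c _ => .sum hα.1 hU fun d _ => (h2 d c b).mul hα hU (h2 c a d)

lemma cHolderOn_scalarCurv (hα : α ∈ Ioo (0 : ℝ) 1) (hU : IsOpen U) (hg : IsMetricOn g U)
    (hr : MetCHolderOn (k + 2) α U g) : CHolderOn k α U (scalarCurv g) :=
  .sum hα.1 hU fun a _ => .sum hα.1 hU fun b _ => CHolderOn.mul hα hU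
    (CHolderOn.matrix_inv hα hU (fun i j => ((hr i j).of_succ hα hU).of_succ hα hU)
      (fun _ hx => det_ne_zero hg hx) a b) (cHolderOn_ricci hα hU hg hr a b)

end Geometry

/-- The divergence form operator `u ↦ ∂_a (A^{ab} ∂_b u)`. -/
def divOp (A : Fin n → Fin n → Pt n → ℝ) (u : Pt n → ℝ) (x : Pt n) : ℝ :=
  ∑ a, pd a (fun y => ∑ b, A a b y * pd b u y) x

/-- The coefficients of the first order part of `divOp A`. -/
def rowDiv (A : Fin n → Fin n → Pt n → ℝ) (b : Fin n) (x : Pt n) : ℝ := ∑ a, pd a (A a b) x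

lemma divOp_eq {A : Fin n → Fin n → Pt n → ℝ} {u : Pt n → ℝ} {x : Pt n}
    (hA : ∀ a b, DifferentiableAt ℝ (A a b) x) (hu : ∀ b, DifferentiableAt ℝ (pd b u) x) :
    divOp A u x = ∑ a, ∑ b, A a b x * pd a (pd b u) x + ∑ b, rowDiv A b x * pd b u x := by
  have hd : ∀ a b, DifferentiableAt ℝ (fun y => A a b y * pd b u y) x :=
    fun a b => (hA a b).mul (hu b)
  have h : ∀ a, pd a (fun y => ∑ b, A a b y * pd b u y) x
      = ∑ b, A a b x * pd a (pd b u) x + ∑ b, pd a (A a b) x * pd b u x := fun a => by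
    rw [pd_sum fun b _ => hd a b, ← Finset.sum_add_distrib]
    refine Finset.sum_congr rfl fun b _ => ?_
    rw [pd_mul (hA a b) (hu b), add_comm]
  simp only [divOp, h, Finset.sum_add_distrib, rowDiv, Finset.sum_mul]
  rw [Finset.sum_comm (f := fun a b => pd a (A a b) x * pd b u x)]

lemma diffOp_rowDiv {A : Fin n → Fin n → Pt n → ℝ} {c u : Pt n → ℝ} {x : Pt n}
    (hA : ∀ a b, DifferentiableAt ℝ (A a b) x) (hu : ∀ b, DifferentiableAt ℝ (pd b u) x) :
    diffOp A (rowDiv A) c u x = divOp A u x + c x * u x := by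
  rw [divOp_eq hA hu, diffOp]

lemma confLap_eq (g : Met n) (u : Pt n → ℝ) (x : Pt n) :
    confLap g u x = -(√(g x).det)⁻¹ * divOp (fun a b y => √(g y).det * (g y)⁻¹ a b) u x
      + ((n : ℝ) - 2) / (4 * ((n : ℝ) - 1)) * scalarCurv g x * u x := by
  simp only [confLap, laplaceBeltrami, divOp, Finset.mul_sum, mul_assoc]

/-- If `z` is harmonic for the weight `f²`, then `z * f` satisfies the product rule without
cross terms. -/
lemma divOp_mul {k : ℕ} {U : Set (Pt n)} (hU : IsOpen U) (hα : 0 < α)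
    {S : Fin n → Fin n → Pt n → ℝ}
    {f z : Pt n → ℝ} (hf : CHolderOn (k + 2) α U f) (hz : CHolderOn (k + 2) α U z) {x : Pt n}
    (hx : x ∈ U) (hS : ∀ a b, DifferentiableAt ℝ (S a b) x) (hsymm : ∀ a b, S a b x = S b a x)
    (hfx : f x ≠ 0) (hdiv : divOp (fun a b y => f y ^ 2 * S a b y) z x = 0) :
    divOp S (fun y => f y * z y) x = z x * divOp S f x := by
  have df : ∀ y ∈ U, DifferentiableAt ℝ f y := fun y hy => hf.differentiableAt hU hy
  have dz : ∀ y ∈ U, DifferentiableAt ℝ z y := fun y hy => hz.differentiableAt hU hy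
  have df1 : ∀ b, DifferentiableAt ℝ (pd b f) x := fun b =>
    (hf.partialDeriv hα hU b).differentiableAt hU hx
  have dz1 : ∀ b, DifferentiableAt ℝ (pd b z) x := fun b =>
    (hz.partialDeriv hα hU b).differentiableAt hU hx
  have e1 : ∀ b, EqOn (pd b fun y => f y * z y) (fun y => pd b f y * z y + f y * pd b z y) U :=
    fun b y hy => pd_mul (df y hy) (dz y hy) b
  have m1 : ∀ b, DifferentiableAt ℝ (fun y => pd b f y * z y) x := fun b =>
    (df1 b).mul (dz x hx)
  have m2 : ∀ b, DifferentiableAt ℝ (fun y => f y * pd b z y) x := fun b =>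
    (df x hx).mul (dz1 b)
  have e2 : ∀ a b, pd a (pd b fun y => f y * z y) x
      = pd a (pd b f) x * z x + pd b f x * pd a z x + (pd a f x * pd b z x + f x * pd a (pd b z) x) :=
    fun a b => by
      rw [pd_congr_on hU (e1 b) a hx,
        pd_add (m1 b) (m2 b), pd_mul (df1 b) (dz x hx),
        pd_mul (df x hx) (dz1 b)]
  have d1 : ∀ b, DifferentiableAt ℝ (pd b fun y => f y * z y) x := fun b =>
    ((m1 b).add (m2 b)).congr_of_eventuallyEq
      (Filter.mem_of_superset (hU.mem_nhds hx) (e1 b))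
  have dsq : DifferentiableAt ℝ (fun y => f y ^ 2) x := (df x hx).pow 2
  have e3 : ∀ b, rowDiv (fun a b y => f y ^ 2 * S a b y) b x
      = ∑ a, 2 * f x * pd a f x * S a b x + f x ^ 2 * rowDiv S b x := fun b => by
    simp only [rowDiv, Finset.mul_sum, ← Finset.sum_add_distrib]
    refine Finset.sum_congr rfl fun a _ => ?_
    have : pd a (fun y => f y ^ 2) x = 2 * f x * pd a f x := by
      simp_rw [pow_two]
      rw [pd_mul (df x hx) (df x hx)]
      ring
    rw [pd_mul dsq (hS a b), this]
  have hA2 : ∀ a b, DifferentiableAt ℝ (fun y => f y ^ 2 * S a b y) x := fun a b => dsq.mul (hS a b)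
  rw [divOp_eq (A := fun a b y => f y ^ 2 * S a b y) hA2 dz1] at hdiv
  simp only [e3] at hdiv
  rw [divOp_eq hS d1, divOp_eq hS df1]
  simp only [e2, e1 _ hx]
  have s1 : ∑ a, ∑ b, S a b x * (pd b f x * pd a z x) = ∑ a, ∑ b, S a b x * (pd a f x * pd b z x) := by
    rw [Finset.sum_comm]
    refine Finset.sum_congr rfl fun a _ => Finset.sum_congr rfl fun b _ => ?_
    rw [hsymm]
  have s2 : ∑ b, (∑ a, 2 * f x * pd a f x * S a b x + f x ^ 2 * rowDiv S b x) * pd b z x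
      = 2 * f x * ∑ a, ∑ b, S a b x * (pd a f x * pd b z x)
        + f x ^ 2 * ∑ b, rowDiv S b x * pd b z x := by
    rw [Finset.sum_comm, Finset.mul_sum, Finset.mul_sum, ← Finset.sum_add_distrib]
    refine Finset.sum_congr rfl fun b _ => ?_
    rw [add_mul, Finset.sum_mul, Finset.mul_sum, mul_assoc]
    congr 1
    exact Finset.sum_congr rfl fun a _ => by ring
  have s3 : ∑ a, ∑ b, f x ^ 2 * S a b x * pd a (pd b z) x
      = f x ^ 2 * ∑ a, ∑ b, S a b x * pd a (pd b z) x := by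
    simp only [Finset.mul_sum, mul_assoc]
  have s4 : ∑ a, ∑ b, S a b x * (pd a (pd b f) x * z x + pd b f x * pd a z x
        + (pd a f x * pd b z x + f x * pd a (pd b z) x))
      = z x * ∑ a, ∑ b, S a b x * pd a (pd b f) x + ∑ a, ∑ b, S a b x * (pd b f x * pd a z x)
        + (∑ a, ∑ b, S a b x * (pd a f x * pd b z x)
          + f x * ∑ a, ∑ b, S a b x * pd a (pd b z) x) := by
    simp only [Finset.mul_sum, ← Finset.sum_add_distrib]
    exact Finset.sum_congr rfl fun a _ => Finset.sum_congr rfl fun b _ => by ring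
  have s5 : ∑ b, rowDiv S b x * (pd b f x * z x + f x * pd b z x)
      = z x * ∑ b, rowDiv S b x * pd b f x + f x * ∑ b, rowDiv S b x * pd b z x := by
    simp only [Finset.mul_sum, ← Finset.sum_add_distrib]
    exact Finset.sum_congr rfl fun b _ => by ring
  rw [s2, s3] at hdiv
  rw [s4, s5, s1]
  apply mul_left_cancel₀ hfx
  linear_combination hdiv

lemma cHolderOn_rowDiv {k : ℕ} {U : Set (Pt n)} (hU : IsOpen U) (hα : 0 < α)
    {A : Fin n → Fin n → Pt n → ℝ} (hA : ∀ a b, CHolderOn (k + 1) α U (A a b)) (b : Fin n) :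
    CHolderOn k α U (rowDiv A b) :=
  .sum hα hU fun a _ => (hA a b).partialDeriv hα hU a

lemma divOp_sum_mul_sub {k : ℕ} {U : Set (Pt n)} (hU : IsOpen U) (hα : 0 < α)
    {A : Fin n → Fin n → Pt n → ℝ} {z : Fin n → Pt n → ℝ}
    (hz : ∀ j, CHolderOn (k + 2) α U (z j)) {x : Pt n} (hx : x ∈ U)
    (hA : ∀ a b, DifferentiableAt ℝ (A a b) x) (N p : Fin n → ℝ) :
    divOp A (fun y => ∑ j, N j * (z j y - p j)) x = ∑ j, N j * divOp A (z j) x := by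
  have dz : ∀ j, ∀ y ∈ U, DifferentiableAt ℝ (fun y => z j y - p j) y := fun j y hy =>
    ((hz j).differentiableAt hU hy).sub_const _
  have dz1 : ∀ j b, DifferentiableAt ℝ (pd b (z j)) x := fun j b =>
    ((hz j).partialDeriv hα hU b).differentiableAt hU hx
  have e1 : ∀ b, EqOn (pd b fun y => ∑ j, N j * (z j y - p j)) (fun y => ∑ j, N j * pd b (z j) y) U :=
    fun b y hy => by
      rw [pd_sum (fun j _ => (dz j y hy).const_mul (N j))]
      refine Finset.sum_congr rfl fun j _ => ?_
      rw [pd_const_mul, pd_sub ((hz j).differentiableAt hU hy) (differentiableAt_const _), pd_const,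
        sub_zero]
  have e2 : ∀ a b, pd a (pd b fun y => ∑ j, N j * (z j y - p j)) x
      = ∑ j, N j * pd a (pd b (z j)) x := fun a b => by
    rw [pd_congr_on hU (e1 b) a hx, pd_sum (fun j _ => (dz1 j b).const_mul (N j))]
    exact Finset.sum_congr rfl fun j _ => pd_const_mul _ _ _ _
  have d1 : ∀ b, DifferentiableAt ℝ (pd b fun y => ∑ j, N j * (z j y - p j)) x := fun b =>
    (DifferentiableAt.fun_sum fun j _ => (dz1 j b).const_mul (N j)).congr_of_eventuallyEq
      (Filter.mem_of_superset (hU.mem_nhds hx) (e1 b))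
  simp only [divOp_eq hA d1, fun j => divOp_eq hA (dz1 j), e2, e1 _ hx, mul_add, Finset.mul_sum,
    Finset.sum_add_distrib]
  congr 1
  · rw [Finset.sum_comm (f := fun j a => ∑ b, N j * (A a b x * pd a (pd b (z j)) x))]
    refine Finset.sum_congr rfl fun a _ => ?_
    rw [Finset.sum_comm]
    exact Finset.sum_congr rfl fun j _ => Finset.sum_congr rfl fun b _ => by ring
  · rw [Finset.sum_comm]
    exact Finset.sum_congr rfl fun j _ => Finset.sum_congr rfl fun b _ => by ring

/-- Solutions of `divOp A z = 0` with prescribed invertible differential at the origin. -/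
lemma exists_divOp_eq_zero_jac (hn : 3 ≤ n) (hα : α ∈ Ioo (0 : ℝ) 1) {m : ℕ} {U : Set (Pt n)}
    (hU : IsOpen U) (h0 : (0 : Pt n) ∈ U) {A : Fin n → Fin n → Pt n → ℝ}
    (hA : ∀ a b, CHolderOn (m + 1) α U (A a b))
    (hA0 : (Matrix.of fun a b => A a b 0).PosDef) (B : Matrix (Fin n) (Fin n) ℝ) :
    ∃ V, IsOpen V ∧ (0 : Pt n) ∈ V ∧ V ⊆ U ∧ ∃ z : Pt n → Pt n,
      (∀ i, CHolderOn (m + 2) α V fun x => z x i) ∧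
      (∀ i, ∀ x ∈ V, divOp A (fun x => z x i) x = 0) ∧ z 0 = 0 ∧ jac z 0 = B := by
  obtain ⟨ε, hε, hdet⟩ : ∃ ε > 0, ∀ M : Matrix (Fin n) (Fin n) ℝ,
      (∀ i j, |M i j - (1 : Matrix (Fin n) (Fin n) ℝ) i j| < ε) → M.det ≠ 0 := by
    have hc : Continuous fun M : Fin n → Fin n → ℝ => (Matrix.of M).det :=
      Continuous.matrix_det continuous_id
    have ho : IsOpen {M : Fin n → Fin n → ℝ | (Matrix.of M).det ≠ 0} :=
      isOpen_ne_fun hc continuous_const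
    obtain ⟨ε, hε, hb⟩ := Metric.isOpen_iff.1 ho (Matrix.of.symm 1)
      (by
        change (1 : Matrix (Fin n) (Fin n) ℝ).det ≠ 0
        simp)
    refine ⟨ε, hε, fun M hM => hb (a := Matrix.of.symm M) ?_⟩
    rw [Metric.mem_ball, dist_pi_lt_iff hε]
    intro i
    rw [dist_pi_lt_iff hε]
    exact fun j => hM i j
  choose V hV h0V hVU z hz hsol _ hjac using fun i : Fin n =>
    exists_local_solution hn hα hU h0 (fun a b => (hA a b).of_le hα hU m.le_succ)
      (cHolderOn_rowDiv hU hα.1 hA) (.const hα hU 0) hA0 0 (fun j => (1 : Matrix (Fin n) (Fin n) ℝ) i j) hε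
  have hW : IsOpen (⋂ i, V i) := isOpen_iInter_of_finite hV
  have hWU : ⋂ i, V i ⊆ U := (iInter_subset V ⟨0, by omega⟩).trans (hVU _)
  have h0W : (0 : Pt n) ∈ ⋂ i, V i := mem_iInter.2 h0V
  have hzW : ∀ i, CHolderOn (m + 2) α (⋂ i, V i) (z i) := fun i =>
    (hz i).mono hα.1 (hV i) hW (iInter_subset V i)
  have hAd : ∀ x ∈ U, ∀ a b, DifferentiableAt ℝ (A a b) x := fun x hx a b =>
    (hA a b).differentiableAt hU hx
  have hdiv : ∀ i, ∀ x ∈ ⋂ i, V i, divOp A (z i) x = 0 := fun i x hx => by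
    have := hsol i x (mem_iInter.1 hx i)
    rwa [diffOp_rowDiv (hAd x (hWU hx))
      (fun b => ((hzW i).partialDeriv hα.1 hW b).differentiableAt hW hx), zero_mul, add_zero] at this
  set M : Matrix (Fin n) (Fin n) ℝ := Matrix.of fun i j => pd j (z i) 0 with hM
  have hMdet : IsUnit M.det := isUnit_iff_ne_zero.2 (hdet M fun i j => hjac i j)
  refine ⟨_, hW, h0W, hWU, fun x i => ∑ j, (B * M⁻¹) i j * (z j x - z j 0), fun i => ?_,
    fun i x hx => ?_, ?_, ?_⟩
  · exact .sum hα.1 hW fun j _ => ((hzW j).sub hα.1 hW (.const hα hW _)).const_mul hα.1 hW _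
  · rw [divOp_sum_mul_sub hW hα.1 hzW hx (hAd x (hWU hx))]
    simp [hdiv _ x hx]
  · ext i
    simp
  · have hd : ∀ j, DifferentiableAt ℝ (z j) 0 := fun j => (hzW j).differentiableAt hW h0W
    calc jac (fun x i => ∑ j, (B * M⁻¹) i j * (z j x - z j 0)) 0 = B * M⁻¹ * M := by
          ext i l
          rw [Matrix.mul_apply, jac, Matrix.of_apply,
            pd_sum (fun j _ => ((hd j).sub_const _).const_mul _)]
          refine Finset.sum_congr rfl fun j _ => ?_
          rw [pd_const_mul, pd_sub (hd j) (differentiableAt_const _), pd_const, sub_zero]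
          rfl
      _ = B := by rw [Matrix.mul_assoc, Matrix.nonsing_inv_mul _ hMdet, Matrix.mul_one]

lemma cHolderOn_sqrt_det_mul_inv {k : ℕ} {U : Set (Pt n)} (hα : α ∈ Ioo (0 : ℝ) 1) (hU : IsOpen U)
    {g : Met n} (hg : IsMetricOn g U) (hr : MetCHolderOn k α U g) (a b : Fin n) :
    CHolderOn k α U fun y => √(g y).det * (g y)⁻¹ a b :=
  ((CHolderOn.det hα hU hr).sqrt hα hU fun x hx => (hg x hx).2.det_pos).mul hα hU
    (.matrix_inv hα hU hr (fun x hx => (hg x hx).2.det_pos.ne') a b)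

lemma confLap_eq_zero_of_divOp {g : Met n} {u : Pt n → ℝ} {x : Pt n} (hx : (g x).PosDef)
    (h : divOp (fun a b y => √(g y).det * (g y)⁻¹ a b) u x
      = √(g x).det * (((n : ℝ) - 2) / (4 * ((n : ℝ) - 1))) * scalarCurv g x * u x) :
    confLap g u x = 0 := by
  have : √(g x).det ≠ 0 := (Real.sqrt_pos.2 hx.det_pos).ne'
  rw [confLap_eq, h]
  linear_combination (-(((n : ℝ) - 2) / (4 * ((n : ℝ) - 1))) * scalarCurv g x * u x)
    * inv_mul_cancel₀ this

lemma divOp_of_confLap_eq_zero {g : Met n} {u : Pt n → ℝ} {x : Pt n} (hx : (g x).PosDef)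
    (h : confLap g u x = 0) :
    divOp (fun a b y => √(g y).det * (g y)⁻¹ a b) u x
      = √(g x).det * (((n : ℝ) - 2) / (4 * ((n : ℝ) - 1))) * scalarCurv g x * u x := by
  have : √(g x).det ≠ 0 := (Real.sqrt_pos.2 hx.det_pos).ne'
  rw [confLap_eq] at h
  linear_combination (-√(g x).det) * h
    - divOp (fun a b y => √(g y).det * (g y)⁻¹ a b) u x * mul_inv_cancel₀ this

lemma posDef_sqrt_det_mul_inv {g : Met n} {x : Pt n} (hx : (g x).PosDef) {r : ℝ} (hr : 0 < r) :
    (Matrix.of fun a b => r * (√(g x).det * (g x)⁻¹ a b)).PosDef := by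
  have := hx.inv.smul (mul_pos hr (Real.sqrt_pos.2 hx.det_pos))
  have e : (Matrix.of fun a b => r * (√(g x).det * (g x)⁻¹ a b)) = (r * √(g x).det) • (g x)⁻¹ := by
    ext a b
    simp [mul_assoc]
  rwa [e]

lemma exists_pos_confLap_eq_zero (hn : 3 ≤ n) (hα : α ∈ Ioo (0 : ℝ) 1) {k : ℕ} {U : Set (Pt n)}
    (hU : IsOpen U) (h0 : (0 : Pt n) ∈ U) {g : Met n} (hg : IsMetricOn g U)
    (hr : MetCHolderOn (k + 2) α U g) :
    ∃ V, IsOpen V ∧ (0 : Pt n) ∈ V ∧ V ⊆ U ∧ ∃ f, CHolderOn (k + 2) α V f ∧ (∀ x ∈ V, 0 < f x) ∧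
      ∀ x ∈ V, confLap g f x = 0 := by
  have hS := cHolderOn_sqrt_det_mul_inv hα hU hg hr
  have hsq : CHolderOn k α U fun x => √(g x).det := CHolderOn.of_le hα hU
    ((CHolderOn.det hα hU hr).sqrt hα hU fun x hx => (hg x hx).2.det_pos) (by omega)
  have hS0 := posDef_sqrt_det_mul_inv (hg 0 h0).2 one_pos
  simp only [one_mul] at hS0
  obtain ⟨V, hV, h0V, hVU, f, hf, hsol, hf0, -⟩ :=
    exists_local_solution hn hα hU h0 (fun a b => (hS a b).of_le hα hU (by omega : k ≤ k + 2))
      (cHolderOn_rowDiv hU hα.1 fun a b => (hS a b).of_le hα hU (by omega : k + 1 ≤ k + 2))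
      ((hsq.const_mul hα.1 hU (-(((n : ℝ) - 2) / (4 * ((n : ℝ) - 1))))).mul hα hU
        (cHolderOn_scalarCurv hα hU hg hr)) hS0 1 0 one_half_pos
  have hW : IsOpen (V ∩ f ⁻¹' Ioi 0) := hf.1.continuousOn.isOpen_inter_preimage hV isOpen_Ioi
  refine ⟨_, hW, ⟨h0V, ?_⟩, inter_subset_left.trans hVU, f, hf.mono hα.1 hV hW inter_subset_left,
    fun x hx => hx.2, fun x hx => ?_⟩
  · have := (abs_lt.1 hf0).1
    simp only [mem_preimage, mem_Ioi]
    linarith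
  · refine confLap_eq_zero_of_divOp (hg x (hVU hx.1)).2 ?_
    have := hsol x hx.1
    rw [diffOp_rowDiv (fun a b => (hS a b).differentiableAt hU (hVU hx.1))
      (fun b => (hf.partialDeriv hα.1 hV b).differentiableAt hV hx.1)] at this
    linear_combination this

open scoped MatrixOrder Matrix.Norms.L2Operator in
lemma exists_transpose_mul_self_eq {G : Matrix (Fin n) (Fin n) ℝ} (hG : G.PosDef) :
    ∃ B : Matrix (Fin n) (Fin n) ℝ, Bᵀ * B = G ∧ B.det ≠ 0 := by
  obtain ⟨B, hB⟩ := CStarAlgebra.nonneg_iff_eq_star_mul_self.mp hG.posSemidef.nonneg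
  have h : Bᵀ * B = G := by rw [hB, star_eq_conjTranspose, conjTranspose_eq_transpose_of_trivial]
  refine ⟨B, h, fun h0 => hG.det_pos.ne' ?_⟩
  rw [← h, det_mul, h0, mul_zero]

end ConfHarm

open ConfHarm

/-- Theorem 2.2, parts (1) and (3): existence of conformal harmonic coordinates
in the interior, normalized so that the metric is the identity matrix at the center point. -/
theorem conformal_harmonic_coordinates_exist_interior
    (n k : ℕ) (hn : 3 ≤ n) (hk : 2 ≤ k) (α : ℝ) (hα : α ∈ Set.Ioo (0 : ℝ) 1)
    (Ω : Set (Pt n)) (hΩ : IsOpen Ω) (h0 : (0 : Pt n) ∈ Ω)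
    (g : Met n) (hgm : IsMetricOn g Ω) (hgr : MetCHolderOn k α Ω g) :
    ∃ V : Set (Pt n), IsOpen V ∧ (0 : Pt n) ∈ V ∧ V ⊆ Ω ∧
      ∃ (F : Fin n → Pt n → ℝ) (f : Pt n → ℝ),
        (∀ i, CHolderOn k α V (F i)) ∧ CHolderOn k α V f ∧
        (∀ x ∈ V, 0 < f x) ∧
        (∀ i, ∀ x ∈ V, confLap g (F i) x = 0) ∧ (∀ x ∈ V, confLap g f x = 0) ∧
        ∀ Z : Pt n → Pt n, (∀ x i, Z x i = F i x / f x) →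
          Z 0 = 0 ∧ Set.InjOn Z V ∧ IsOpen (Z '' V) ∧
          (∀ i, CHolderOn (k + 1) α V fun x => Z x i) ∧
          (∃ Zinv : Pt n → Pt n,
            (∀ i, CHolderOn (k + 1) α (Z '' V) fun y => Zinv y i) ∧
            ∀ x ∈ V, Zinv (Z x) = x) ∧
          (jac Z 0)ᵀ * jac Z 0 = g 0 := by
  obtain ⟨k, rfl⟩ := Nat.exists_eq_add_of_le' hk
  obtain ⟨U, hU, h0U, hUΩ, f, hf, hfpos, hfsol⟩ := exists_pos_confLap_eq_zero hn hα hΩ h0 hgm hgr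
  have hS : ∀ a b, CHolderOn (k + 2) α U fun y => √(g y).det * (g y)⁻¹ a b := fun a b =>
    (cHolderOn_sqrt_det_mul_inv hα hΩ hgm hgr a b).mono hα.1 hΩ hU hUΩ
  obtain ⟨B, hB, hBdet⟩ := exists_transpose_mul_self_eq (hgm 0 h0).2
  have hf2 : CHolderOn (k + 2) α U fun y => f y ^ 2 := by
    simpa only [pow_two] using hf.mul hα hU hf
  obtain ⟨W, hW, h0W, hWU, z, hz, hzsol, hz0, hzjac⟩ :=
    exists_divOp_eq_zero_jac hn hα hU h0U (A := fun a b y => f y ^ 2 * (√(g y).det * (g y)⁻¹ a b))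
      (fun a b => hf2.mul hα hU (hS a b))
      (posDef_sqrt_det_mul_inv (hgm 0 h0).2 (pow_pos (hfpos 0 h0U) 2)) B
  obtain ⟨V, hV, h0V, hVW, hinj, hopen, Zinv, hZinv, hleft⟩ :=
    exists_local_inverse (m := k + 2) hα hW h0W hz (by rwa [hzjac])
  have hVU := hVW.trans hWU
  have hfV := hf.mono hα.1 hU hV hVU
  have hzV : ∀ i, CHolderOn (k + 3) α V fun x => z x i := fun i => (hz i).mono hα.1 hW hV hVW
  have hzV' : ∀ i, CHolderOn (k + 2) α V fun x => z x i := fun i => (hzV i).of_succ hα hV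
  refine ⟨V, hV, h0V, hVU.trans hUΩ, fun i x => f x * z x i, f,
    fun i => hfV.mul hα hV (hzV' i), hfV, fun x hx => hfpos x (hVU hx), fun i x hx => ?_,
    fun x hx => hfsol x (hVU hx), fun Z hZ => ?_⟩
  · have hpd := (hgm x (hUΩ (hVU hx))).2
    refine confLap_eq_zero_of_divOp hpd ?_
    have hsymm : ∀ a b, √(g x).det * (g x)⁻¹ a b = √(g x).det * (g x)⁻¹ b a := fun a b => by
      rw [(posDef_isSymm hpd.inv).apply]
    rw [divOp_mul (S := fun a b y => √(g y).det * (g y)⁻¹ a b) hV hα.1 hfV (hzV' i) hx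
      (fun a b => (hS a b).differentiableAt hU (hVU hx)) hsymm (hfpos x (hVU hx)).ne'
      (hzsol i x (hVW hx)), divOp_of_confLap_eq_zero hpd (hfsol x (hVU hx))]
    ring
  · have hZz : EqOn Z z V := fun x hx => funext fun i => by
      rw [hZ, mul_div_cancel_left₀ _ (hfpos x (hVU hx)).ne']
    have hjac : jac Z 0 = B := by
      rw [← hzjac]
      ext i j
      exact pd_congr_on hV (fun x hx => congrFun (hZz hx) i) j h0V
    refine ⟨(hZz h0V).trans hz0, hinj.congr hZz.symm, ?_, fun i => ?_, ⟨Zinv, ?_, fun x hx => ?_⟩, ?_⟩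
    · rwa [hZz.image_eq]
    · exact (hzV i).congr hα.1 hV fun x hx => congrFun (hZz hx) i
    · rwa [hZz.image_eq]
    · rw [hZz hx, hleft x hx]
    · rw [hjac, hB]
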